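/- Let p ≥ 4 and q ≥ 1 satisfy 1/q + 3/p ≤ 1. There exist an absolute constant C > 0 and, for every ε > 0, a constant C_ε > 0 such that: for every N ≥ 2, θ ∈ (0,1], every N^{1/2}-short generalized Dirichlet sequence {a_n}_{n=1}^{N^{1/2}} with parameters (N,θ), every T with Nθ^{-1} ≤ T ≤ N²θ^{-1}, every interval B_T of length 2T, and every sequence of complex coefficients {b_n}_{n=1}^{N^{1/2}}, one has ( ∫_{B_T} |Σ_{n=1}^{N^{1/2}} b_n e^{i t a_n}|^p dt )^{1/p} ≤ C_ε N^ε (log(θ^{-1}+1))^C ( N^{(1/2)(1 + 1/p − 1/q)} θ^{-1/p} + T^{1/p} N^{1/4 − 1/(2q)} ) (Σ_{n=1}^{N^{1/2}} |b_n|^q)^{1/q}. -/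

import Mathlib

open MeasureTheory

/-- `{a_n}_{n=1}^{R}` is an `N^{1/2}`-short generalized Dirichlet sequence with
parameters `(N, θ)`. -/
def ShortGDS (N : ℝ) (R : ℕ) (θ : ℝ) (a : ℕ → ℝ) : Prop :=
  a 2 - a 1 ∈ Set.Icc (1 / (4 * N)) (4 / N) ∧
  ∀ i : ℕ, 1 ≤ i → i + 2 ≤ R →
    (a (i + 2) - a (i + 1)) - (a (i + 1) - a i) ∈
      Set.Icc (θ / (4 * N ^ 2)) (4 * θ / N ^ 2)

namespace ShortDirichlet

open Finset ComplexConjugate Pointwise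

/-- Near-diagonal principle for weighted sums of almost orthogonal functions. -/
theorem sum_norm_sq_le_of_nearly_orthogonal {X ι : Type*} [Fintype X] (s : Finset ι)
    (w : X → ℝ) (hw : ∀ x, 0 ≤ w x) (g : ι → X → ℂ) (r : ι → ι → Prop) [DecidableRel r]
    (hsymm : ∀ a ∈ s, ∀ b ∈ s, r a b → r b a) (Γ : ℝ)
    (hΓ : ∀ a ∈ s, ((s.filter (r a)).card : ℝ) ≤ Γ)
    (horth : ∀ a ∈ s, ∀ b ∈ s, ¬ r a b → ∑ x, (w x : ℂ) * (g a x * conj (g b x)) = 0) :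
    ∑ x, w x * ‖∑ a ∈ s, g a x‖ ^ 2 ≤ Γ * ∑ a ∈ s, ∑ x, w x * ‖g a x‖ ^ 2 := by
  classical
  set E : ι → ℝ := fun a => ∑ x, w x * ‖g a x‖ ^ 2 with hE
  have hE0 : ∀ a, 0 ≤ E a := fun a => Finset.sum_nonneg fun x _ => mul_nonneg (hw x) (sq_nonneg _)
  have hexp : ((∑ x, w x * ‖∑ a ∈ s, g a x‖ ^ 2 : ℝ) : ℂ) =
      ∑ a ∈ s, ∑ b ∈ s, ∑ x, (w x : ℂ) * (g a x * conj (g b x)) := by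
    push_cast
    have : ∀ x, (w x : ℂ) * (‖∑ a ∈ s, g a x‖ : ℂ) ^ 2 =
        ∑ a ∈ s, ∑ b ∈ s, (w x : ℂ) * (g a x * conj (g b x)) := by
      intro x
      rw [← Complex.mul_conj', map_sum, Finset.sum_mul_sum, Finset.mul_sum]
      refine Finset.sum_congr rfl fun a _ => ?_
      rw [Finset.mul_sum]
    rw [Finset.sum_congr rfl fun x _ => this x, Finset.sum_comm]
    refine Finset.sum_congr rfl fun a _ => ?_
    rw [Finset.sum_comm]
  have hpair : ∀ a b, ‖∑ x, (w x : ℂ) * (g a x * conj (g b x))‖ ≤ (E a + E b) / 2 := by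
    intro a b
    refine (norm_sum_le _ _).trans ?_
    rw [hE]
    simp only
    rw [← Finset.sum_add_distrib, Finset.sum_div]
    refine Finset.sum_le_sum fun x _ => ?_
    rw [norm_mul, norm_mul, RCLike.norm_conj, Complex.norm_real, Real.norm_of_nonneg (hw x)]
    nlinarith [mul_nonneg (hw x) (sq_nonneg (‖g a x‖ - ‖g b x‖))]
  have hre : (∑ x, w x * ‖∑ a ∈ s, g a x‖ ^ 2) ≤
      ∑ a ∈ s, ∑ b ∈ s, ‖∑ x, (w x : ℂ) * (g a x * conj (g b x))‖ := by
    have h1 : ‖((∑ x, w x * ‖∑ a ∈ s, g a x‖ ^ 2 : ℝ) : ℂ)‖ ≤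
        ∑ a ∈ s, ∑ b ∈ s, ‖∑ x, (w x : ℂ) * (g a x * conj (g b x))‖ := by
      rw [hexp]
      refine (norm_sum_le _ _).trans (Finset.sum_le_sum fun a _ => norm_sum_le _ _)
    rw [Complex.norm_real] at h1
    exact (le_abs_self _).trans h1
  refine hre.trans ?_
  have h2 : ∑ a ∈ s, ∑ b ∈ s, ‖∑ x, (w x : ℂ) * (g a x * conj (g b x))‖ ≤
      ∑ a ∈ s, ∑ b ∈ s, if r a b then (E a + E b) / 2 else 0 := by
    refine Finset.sum_le_sum fun a ha => Finset.sum_le_sum fun b hb => ?_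
    split_ifs with h
    · exact hpair a b
    · rw [horth a ha b hb h, norm_zero]
  refine h2.trans ?_
  have h3 : ∀ a ∈ s, (∑ b ∈ s, if r a b then E a / 2 else 0) ≤ Γ * (E a / 2) := by
    intro a ha
    rw [← Finset.sum_filter, Finset.sum_const, nsmul_eq_mul]
    exact mul_le_mul_of_nonneg_right (hΓ a ha) (by linarith [hE0 a])
  have h4 : ∀ b ∈ s, (∑ a ∈ s, if r a b then E b / 2 else 0) ≤ Γ * (E b / 2) := by
    intro b hb
    refine le_trans (le_of_eq ?_) (h3 b hb)
    refine Finset.sum_congr rfl fun a ha => ?_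
    have : r a b ↔ r b a := ⟨hsymm a ha b hb, hsymm b hb a ha⟩
    simp [this]
  calc ∑ a ∈ s, ∑ b ∈ s, (if r a b then (E a + E b) / 2 else 0)
      = (∑ a ∈ s, ∑ b ∈ s, if r a b then E a / 2 else 0) +
        ∑ b ∈ s, ∑ a ∈ s, if r a b then E b / 2 else 0 := by
        rw [Finset.sum_comm (s := s) (t := s) (f := fun b a => if r a b then E b / 2 else 0),
          ← Finset.sum_add_distrib]
        refine Finset.sum_congr rfl fun a _ => ?_
        rw [← Finset.sum_add_distrib]
        refine Finset.sum_congr rfl fun b _ => ?_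
        split_ifs <;> ring
    _ ≤ ∑ a ∈ s, Γ * (E a / 2) + ∑ b ∈ s, Γ * (E b / 2) :=
        add_le_add (Finset.sum_le_sum h3) (Finset.sum_le_sum h4)
    _ = Γ * ∑ a ∈ s, E a := by
        rw [← Finset.sum_add_distrib, Finset.mul_sum]
        exact Finset.sum_congr rfl fun a _ => by ring

/-! ### Characters on the grid -/

section grid

variable {Q : ℕ} [NeZero Q]

/-- The character of frequency `ζ` on the grid `ZMod Q × ZMod Q`. -/
noncomputable def chr (Q : ℕ) [NeZero Q] (ζ : ℤ × ℤ) (z : ZMod Q × ZMod Q) : ℂ :=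
  ZMod.stdAddChar ((ζ.1 : ZMod Q) * z.1 + (ζ.2 : ZMod Q) * z.2)

theorem norm_stdAddChar (x : ZMod Q) : ‖(ZMod.stdAddChar x : ℂ)‖ = 1 :=
  AddChar.norm_apply _ x

theorem conj_stdAddChar (x : ZMod Q) :
    conj (ZMod.stdAddChar x : ℂ) = ZMod.stdAddChar (-x) := by
  rw [AddChar.map_neg_eq_conj]

theorem norm_chr (ζ : ℤ × ℤ) (z : ZMod Q × ZMod Q) : ‖chr Q ζ z‖ = 1 := norm_stdAddChar _

theorem chr_add (ζ ζ' : ℤ × ℤ) : chr Q (ζ + ζ') = chr Q ζ * chr Q ζ' := by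
  funext z
  simp only [chr, Pi.mul_apply, Prod.fst_add, Prod.snd_add, ← AddChar.map_add_eq_mul]
  congr 1; push_cast; ring

theorem conj_chr (ζ : ℤ × ℤ) (z : ZMod Q × ZMod Q) : conj (chr Q ζ z) = chr Q (-ζ) z := by
  simp only [chr, conj_stdAddChar, Prod.fst_neg, Prod.snd_neg]
  congr 1; push_cast; ring

theorem chr_zero : chr Q 0 = 1 := by
  funext z; simp [chr]

theorem chr_sub_left (ζ : ℤ × ℤ) (x u y : ZMod Q) :
    chr Q ζ (x - u, y) = ZMod.stdAddChar (-((ζ.1 : ZMod Q) * u)) * chr Q ζ (x, y) := by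
  simp only [chr, ← AddChar.map_add_eq_mul]
  congr 1; ring

theorem sum_stdAddChar_mul (a : ZMod Q) :
    ∑ x : ZMod Q, (ZMod.stdAddChar (a * x) : ℂ) = if a = 0 then (Q : ℂ) else 0 := by
  have h := AddChar.sum_mulShift a (ZMod.isPrimitive_stdAddChar Q)
  simp only [ZMod.card] at h
  push_cast at h
  rw [← h]
  exact Finset.sum_congr rfl fun x _ => by rw [mul_comm]

theorem sum_chr (ζ : ℤ × ℤ) :
    ∑ z, chr Q ζ z = if (ζ.1 : ZMod Q) = 0 ∧ (ζ.2 : ZMod Q) = 0 then (Q : ℂ) ^ 2 else 0 := by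
  rw [Fintype.sum_prod_type]
  simp only [chr, AddChar.map_add_eq_mul, ← Finset.mul_sum, ← Finset.sum_mul, sum_stdAddChar_mul]
  by_cases h1 : (ζ.1 : ZMod Q) = 0 <;> by_cases h2 : (ζ.2 : ZMod Q) = 0 <;> simp [h1, h2, sq]

/-- Functions whose spectrum is contained in `A`. -/
noncomputable def spec (Q : ℕ) [NeZero Q] (A : Set (ℤ × ℤ)) :
    Submodule ℂ (ZMod Q × ZMod Q → ℂ) :=
  Submodule.span ℂ (chr Q '' A)

variable {A B : Set (ℤ × ℤ)} {f g : ZMod Q × ZMod Q → ℂ}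

theorem spec_mono (h : A ⊆ B) (hf : f ∈ spec Q A) : f ∈ spec Q B :=
  Submodule.span_mono (Set.image_mono h) hf

theorem chr_mem_spec {ζ : ℤ × ℤ} (h : ζ ∈ A) : chr Q ζ ∈ spec Q A :=
  Submodule.subset_span ⟨ζ, h, rfl⟩

theorem mul_mem_spec (hf : f ∈ spec Q A) (hg : g ∈ spec Q B) : f * g ∈ spec Q (A + B) := by
  induction hf using Submodule.span_induction with
  | mem f hf =>
    obtain ⟨ζ, hζ, rfl⟩ := hf
    induction hg using Submodule.span_induction with
    | mem g hg =>
      obtain ⟨ζ', hζ', rfl⟩ := hg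
      rw [← chr_add]
      exact chr_mem_spec (Set.add_mem_add hζ hζ')
    | zero => rw [mul_zero]; exact zero_mem _
    | add g g' _ _ h h' => rw [mul_add]; exact add_mem h h'
    | smul c g _ h => rw [mul_smul_comm]; exact Submodule.smul_mem _ _ h
  | zero => rw [zero_mul]; exact zero_mem _
  | add g g' _ _ h h' => rw [add_mul]; exact add_mem h h'
  | smul c g _ h => rw [smul_mul_assoc]; exact Submodule.smul_mem _ _ h

theorem conj_mem_spec (hf : f ∈ spec Q A) : (fun z => conj (f z)) ∈ spec Q (-A) := by
  induction hf using Submodule.span_induction with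
  | mem f hf =>
    obtain ⟨ζ, hζ, rfl⟩ := hf
    have : (fun z => conj (chr Q ζ z)) = chr Q (-ζ) := funext fun z => conj_chr ζ z
    rw [this]
    exact chr_mem_spec (by simpa using hζ)
  | zero =>
    have : (fun z => conj ((0 : ZMod Q × ZMod Q → ℂ) z)) = 0 := funext fun z => by simp
    rw [this]; exact zero_mem _
  | add g g' _ _ h h' =>
    have : (fun z => conj ((g + g') z)) = (fun z => conj (g z)) + fun z => conj (g' z) :=
      funext fun z => by simp
    rw [this]; exact add_mem h h'
  | smul c g _ h =>
    have : (fun z => conj ((c • g) z)) = conj c • fun z => conj (g z) :=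
      funext fun z => by simp
    rw [this]; exact Submodule.smul_mem _ (conj c) h

theorem one_mem_spec (h : 0 ∈ A) : (1 : ZMod Q × ZMod Q → ℂ) ∈ spec Q A := by
  rw [← chr_zero]; exact chr_mem_spec h

theorem sum_eq_zero_of_mem_spec (hf : f ∈ spec Q A)
    (h : ∀ ζ ∈ A, ¬ ((ζ.1 : ZMod Q) = 0 ∧ (ζ.2 : ZMod Q) = 0)) : ∑ z, f z = 0 := by
  induction hf using Submodule.span_induction with
  | mem f hf =>
    obtain ⟨ζ, hζ, rfl⟩ := hf
    rw [sum_chr, if_neg (h ζ hζ)]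
  | zero => simp
  | add g g' _ _ h h' => simp [Finset.sum_add_distrib, h, h']
  | smul c g _ h => simp [← Finset.mul_sum, h]

/-! ### Convolution in the first variable -/

/-- Normalised convolution in the first variable. -/
noncomputable def conv (k : ZMod Q → ℂ) (f : ZMod Q × ZMod Q → ℂ) (z : ZMod Q × ZMod Q) : ℂ :=
  (Q : ℂ)⁻¹ * ∑ u, k u * f (z.1 - u, z.2)

/-- Fourier coefficient of the kernel. -/
noncomputable def fcoef (k : ZMod Q → ℂ) (ξ : ZMod Q) : ℂ :=
  (Q : ℂ)⁻¹ * ∑ u, k u * ZMod.stdAddChar (-(ξ * u))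

theorem conv_add (k : ZMod Q → ℂ) (f g : ZMod Q × ZMod Q → ℂ) :
    conv k (f + g) = conv k f + conv k g := by
  funext z; simp [conv, mul_add, Finset.sum_add_distrib]

theorem conv_smul (k : ZMod Q → ℂ) (c : ℂ) (f : ZMod Q × ZMod Q → ℂ) :
    conv k (c • f) = c • conv k f := by
  funext z
  simp only [conv, Pi.smul_apply, smul_eq_mul]
  rw [mul_left_comm c]
  congr 1
  rw [Finset.mul_sum]
  exact Finset.sum_congr rfl fun u _ => by ring

theorem conv_zero (k : ZMod Q → ℂ) : conv k (0 : ZMod Q × ZMod Q → ℂ) = 0 := by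
  funext z; simp [conv]

theorem conv_sum {ι : Type*} (k : ZMod Q → ℂ) (s : Finset ι) (f : ι → ZMod Q × ZMod Q → ℂ) :
    conv k (∑ a ∈ s, f a) = ∑ a ∈ s, conv k (f a) := by
  classical
  induction s using Finset.induction_on with
  | empty => simp [conv_zero]
  | insert a s ha ih => rw [Finset.sum_insert ha, Finset.sum_insert ha, conv_add, ih]

theorem conv_chr (k : ZMod Q → ℂ) (ζ : ℤ × ℤ) :
    conv k (chr Q ζ) = fcoef k (ζ.1 : ZMod Q) • chr Q ζ := by
  funext z
  simp only [conv, fcoef, Pi.smul_apply, smul_eq_mul, chr_sub_left]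
  rw [mul_assoc, Finset.sum_mul]
  congr 1
  exact Finset.sum_congr rfl fun u _ => by ring

theorem conv_mem_spec (k : ZMod Q → ℂ) (hf : f ∈ spec Q A) :
    conv k f ∈ spec Q {ζ ∈ A | fcoef k (ζ.1 : ZMod Q) ≠ 0} := by
  induction hf using Submodule.span_induction with
  | mem f hf =>
    obtain ⟨ζ, hζ, rfl⟩ := hf
    rw [conv_chr]
    by_cases h : fcoef k (ζ.1 : ZMod Q) = 0
    · rw [h, zero_smul]; exact zero_mem _
    · exact Submodule.smul_mem _ _ (chr_mem_spec ⟨hζ, h⟩)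
  | zero => rw [conv_zero]; exact zero_mem _
  | add g g' _ _ h h' => rw [conv_add]; exact add_mem h h'
  | smul c g _ h => rw [conv_smul]; exact Submodule.smul_mem _ _ h

theorem conv_eq_zero (k : ZMod Q → ℂ) (hf : f ∈ spec Q A)
    (h : ∀ ζ ∈ A, fcoef k (ζ.1 : ZMod Q) = 0) : conv k f = 0 := by
  have h1 := conv_mem_spec k hf
  have h2 : {ζ ∈ A | fcoef k (ζ.1 : ZMod Q) ≠ 0} = ∅ := by
    ext ζ; simpa using fun hζ => h ζ hζ
  rw [h2] at h1
  simpa [spec] using h1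

/-- The kernel of the projection onto a single frequency. -/
noncomputable def pker (ξ : ZMod Q) (u : ZMod Q) : ℂ := ZMod.stdAddChar (ξ * u)

theorem fcoef_pker (ξ ξ' : ZMod Q) : fcoef (pker ξ) ξ' = if ξ' = ξ then 1 else 0 := by
  have hQ : (Q : ℂ) ≠ 0 := Nat.cast_ne_zero.2 (NeZero.ne Q)
  simp only [fcoef, pker, ← AddChar.map_add_eq_mul]
  have : ∀ u : ZMod Q, ξ * u + -(ξ' * u) = (ξ - ξ') * u := fun u => by ring
  simp only [this, sum_stdAddChar_mul, sub_eq_zero]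
  by_cases h : ξ = ξ'
  · simp [h, hQ]
  · simp [h, Ne.symm h]

/-- Parseval in the first variable. -/
theorem parseval_conv (f : ZMod Q × ZMod Q → ℂ) :
    ∑ ξ, ∑ z, ‖conv (pker ξ) f z‖ ^ 2 = ∑ z, ‖f z‖ ^ 2 := by
  have hQ : (Q : ℂ) ≠ 0 := Nat.cast_ne_zero.2 (NeZero.ne Q)
  have h1 : ∀ ξ x y, conv (pker ξ) f (x, y) =
      ZMod.stdAddChar (ξ * x) * ((Q : ℂ)⁻¹ * ∑ v, ZMod.stdAddChar (-(ξ * v)) * f (v, y)) := by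
    intro ξ x y
    simp only [conv, pker]
    rw [mul_left_comm]
    congr 1
    rw [Finset.mul_sum]
    refine Finset.sum_bij' (fun u _ => x - u) (fun u _ => x - u) (by simp) (by simp) (by simp)
      (by simp) ?_
    intro u _
    rw [← mul_assoc, ← AddChar.map_add_eq_mul]
    congr 3; ring
  have h2 : ∀ y, ((∑ ξ : ZMod Q, ∑ x : ZMod Q, ‖conv (pker ξ) f (x, y)‖ ^ 2 : ℝ) : ℂ) =
      ((∑ x, ‖f (x, y)‖ ^ 2 : ℝ) : ℂ) := by
    intro y
    have h3 : ∀ ξ x, ‖conv (pker ξ) f (x, y)‖ ^ 2 =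
        ‖(Q : ℂ)⁻¹ * ∑ v, ZMod.stdAddChar (-(ξ * v)) * f (v, y)‖ ^ 2 := by
      intro ξ x
      rw [h1, norm_mul, norm_stdAddChar, one_mul]
    simp only [h3, Finset.sum_const, Finset.card_univ, ZMod.card, nsmul_eq_mul]
    push_cast
    simp only [← Complex.mul_conj', map_mul, map_sum, map_inv₀, Complex.conj_natCast,
      conj_stdAddChar, neg_neg]
    have h4 : ∀ ξ : ZMod Q, (Q : ℂ) * ((Q : ℂ)⁻¹ * (∑ v, ZMod.stdAddChar (-(ξ * v)) * f (v, y)) *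
        ((Q : ℂ)⁻¹ * ∑ v, ZMod.stdAddChar (ξ * v) * conj (f (v, y)))) =
        (Q : ℂ)⁻¹ * ∑ v, ∑ v', ZMod.stdAddChar ((v' - v) * ξ) * (f (v, y) * conj (f (v', y))) := by
      intro ξ
      rw [show ∀ S S' : ℂ, (Q : ℂ) * ((Q : ℂ)⁻¹ * S * ((Q : ℂ)⁻¹ * S')) = (Q : ℂ)⁻¹ * (S * S') by
        intro S S'; field_simp, Finset.sum_mul_sum]
      congr 1
      refine Finset.sum_congr rfl fun v _ => Finset.sum_congr rfl fun v' _ => ?_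
      rw [mul_mul_mul_comm, ← AddChar.map_add_eq_mul]
      congr 3; ring
    rw [Finset.sum_congr rfl fun ξ _ => h4 ξ, ← Finset.mul_sum, Finset.sum_comm]
    rw [Finset.mul_sum]
    refine Finset.sum_congr rfl fun v _ => ?_
    rw [Finset.sum_comm]
    simp only [← Finset.sum_mul, sum_stdAddChar_mul, sub_eq_zero]
    simp [hQ]
  have h5 : ∀ y, ∑ ξ : ZMod Q, ∑ x : ZMod Q, ‖conv (pker ξ) f (x, y)‖ ^ 2 =
      ∑ x, ‖f (x, y)‖ ^ 2 := fun y => by exact_mod_cast h2 y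
  simp only [Fintype.sum_prod_type_right]
  rw [Finset.sum_comm]
  exact Finset.sum_congr rfl fun y _ => h5 y

theorem conv_conv_pker (ξ : ZMod Q) (k : ZMod Q → ℂ) (f : ZMod Q × ZMod Q → ℂ) :
    conv (pker ξ) (conv k f) = fcoef k ξ • conv (pker ξ) f := by
  have hx : ∀ (f : ZMod Q × ZMod Q → ℂ) (x y : ZMod Q), conv (pker ξ) f (x, y) =
      (Q : ℂ)⁻¹ * ∑ v, ZMod.stdAddChar (ξ * (x - v)) * f (v, y) := by
    intro f x y
    simp only [conv, pker]
    congr 1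
    refine Finset.sum_bij' (fun u _ => x - u) (fun u _ => x - u) (by simp) (by simp) (by simp)
      (by simp) ?_
    intro u _
    rw [sub_sub_cancel]
  funext ⟨x, y⟩
  rw [Pi.smul_apply, smul_eq_mul, hx, hx]
  simp only [conv, fcoef]
  rw [mul_mul_mul_comm, Finset.sum_mul_sum, mul_assoc]
  congr 1
  have h1 : ∀ v : ZMod Q, ZMod.stdAddChar (ξ * (x - v)) * ((Q : ℂ)⁻¹ * ∑ u, k u * f (v - u, y)) =
      (Q : ℂ)⁻¹ * ∑ u, ZMod.stdAddChar (ξ * (x - v)) * (k u * f (v - u, y)) := by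
    intro v
    rw [mul_left_comm, Finset.mul_sum]
  rw [Finset.sum_congr rfl fun v _ => h1 v, ← Finset.mul_sum]
  congr 1
  rw [Finset.sum_comm]
  refine Finset.sum_congr rfl fun u _ => ?_
  refine Finset.sum_bij' (fun v _ => v - u) (fun v _ => v + u) (by simp) (by simp) (by simp)
    (by simp) ?_
  intro v _
  rw [show ξ * (x - v) = -(ξ * u) + ξ * (x - (v - u)) by ring, AddChar.map_add_eq_mul]
  ring

end grid

section fejer

variable {Q : ℕ} [NeZero Q]

/-- The one-sided Dirichlet kernel. -/
noncomputable def dker (Q : ℕ) [NeZero Q] (l : ℕ) (u : ZMod Q) : ℂ :=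
  ∑ j ∈ range l, ZMod.stdAddChar ((j : ZMod Q) * u)

/-- The Fejér kernel. -/
noncomputable def fejer (Q : ℕ) [NeZero Q] (l : ℕ) (u : ZMod Q) : ℝ := ‖dker Q l u‖ ^ 2 / l

/-- Smoothing in the first variable by the Fejér kernel. -/
noncomputable def rsm (l : ℕ) (g : ZMod Q × ZMod Q → ℝ) (z : ZMod Q × ZMod Q) : ℝ :=
  (Q : ℝ)⁻¹ * ∑ u, fejer Q l u * g (z.1 - u, z.2)

/-- The Fourier multiplier of the Fejér kernel. -/
noncomputable def lam (Q : ℕ) [NeZero Q] (l : ℕ) (ξ : ZMod Q) : ℝ :=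
  (((range l ×ˢ range l).filter fun p => (p.1 : ZMod Q) - (p.2 : ZMod Q) = ξ).card : ℝ) / l

theorem fejer_nonneg (l : ℕ) (u : ZMod Q) : 0 ≤ fejer Q l u := by
  unfold fejer; positivity

theorem ofReal_rsm (l : ℕ) (g : ZMod Q × ZMod Q → ℝ) (z : ZMod Q × ZMod Q) :
    (rsm l g z : ℂ) = conv (fun u => (fejer Q l u : ℂ)) (fun z => (g z : ℂ)) z := by
  simp [rsm, conv]

theorem fcoef_fejer (l : ℕ) (ξ : ZMod Q) :
    fcoef (fun u => (fejer Q l u : ℂ)) ξ = lam Q l ξ := by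
  have hQ : (Q : ℂ) ≠ 0 := Nat.cast_ne_zero.2 (NeZero.ne Q)
  have h1 : ∀ u, (fejer Q l u : ℂ) * ZMod.stdAddChar (-(ξ * u)) =
      (l : ℂ)⁻¹ * ∑ p ∈ range l ×ˢ range l,
        ZMod.stdAddChar (((p.1 : ZMod Q) - (p.2 : ZMod Q) - ξ) * u) := by
    intro u
    simp only [fejer, dker]
    push_cast
    rw [← Complex.mul_conj', map_sum, Finset.sum_mul_sum, ← Finset.sum_product', div_eq_inv_mul,
      mul_assoc, Finset.sum_mul]
    congr 1
    refine Finset.sum_congr rfl fun p _ => ?_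
    rw [conj_stdAddChar, ← AddChar.map_add_eq_mul, ← AddChar.map_add_eq_mul]
    congr 1; ring
  simp only [fcoef, h1, ← Finset.mul_sum]
  rw [Finset.sum_comm]
  simp only [sum_stdAddChar_mul, sub_eq_zero (b := ξ), lam]
  rw [← Finset.sum_filter, Finset.sum_const, nsmul_eq_mul]
  push_cast
  field_simp

theorem lam_nonneg (l : ℕ) (ξ : ZMod Q) : 0 ≤ lam Q l ξ := by unfold lam; positivity

omit [NeZero Q] in
theorem natCast_inj_of_lt {a b : ℕ} (ha : a < Q) (hb : b < Q) (h : (a : ZMod Q) = b) : a = b := by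
  rw [ZMod.natCast_eq_natCast_iff'] at h
  rwa [Nat.mod_eq_of_lt ha, Nat.mod_eq_of_lt hb] at h

theorem lam_le_one {l : ℕ} (hl : l ≤ Q) (ξ : ZMod Q) : lam Q l ξ ≤ 1 := by
  unfold lam
  refine div_le_one_of_le₀ ?_ (Nat.cast_nonneg _)
  rw [Nat.cast_le]
  conv_rhs => rw [← Finset.card_range l]
  refine Finset.card_le_card_of_injOn Prod.fst ?_ ?_
  · intro p hp
    simp only [Finset.coe_filter, Finset.mem_product, Set.mem_ofPred_eq] at hp
    exact hp.1.1
  · rintro ⟨a, b⟩ hp ⟨a', b'⟩ hp' h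
    simp only [Finset.coe_filter, Finset.mem_product, Set.mem_ofPred_eq, Finset.mem_range]
      at hp hp' h
    subst h
    have : (b : ZMod Q) = b' := by
      have := hp.2.trans hp'.2.symm
      linear_combination -this
    rw [natCast_inj_of_lt (hp.1.2.trans_le hl) (hp'.1.2.trans_le hl) this]

theorem one_sub_lam_le {l : ℕ} (hl0 : 0 < l) (ξ : ℤ) :
    1 - lam Q l (ξ : ZMod Q) ≤ |(ξ : ℝ)| / l := by
  have hl : (0 : ℝ) < l := by exact_mod_cast hl0
  have key : ((l - ξ.natAbs : ℕ) : ℝ) ≤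
      (((range l ×ˢ range l).filter fun p => (p.1 : ZMod Q) - (p.2 : ZMod Q) = (ξ : ZMod Q)).card
        : ℝ) := by
    rw [Nat.cast_le]
    conv_lhs => rw [← Finset.card_range (l - ξ.natAbs)]
    rcases Int.natAbs_eq ξ with h | h
    · refine Finset.card_le_card_of_injOn (fun j => (j + ξ.natAbs, j)) ?_ ?_
      · intro j hj
        simp only [Finset.coe_range, Set.mem_Iio] at hj
        simp only [Finset.coe_filter, Finset.mem_product, Finset.mem_range, Set.mem_ofPred_eq]
        refine ⟨⟨by omega, by omega⟩, ?_⟩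
        rw [h]; push_cast; simp
      · intro a _ b _ hab
        simpa using hab
    · refine Finset.card_le_card_of_injOn (fun j => (j, j + ξ.natAbs)) ?_ ?_
      · intro j hj
        simp only [Finset.coe_range, Set.mem_Iio] at hj
        simp only [Finset.coe_filter, Finset.mem_product, Finset.mem_range, Set.mem_ofPred_eq]
        refine ⟨⟨by omega, by omega⟩, ?_⟩
        rw [h]; push_cast; simp
      · intro a _ b _ hab
        simpa using (Prod.ext_iff.1 hab).1
  have h2 : (l : ℝ) - |(ξ : ℝ)| ≤ ((l - ξ.natAbs : ℕ) : ℝ) := by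
    have : (l : ℤ) - |ξ| ≤ ((l - ξ.natAbs : ℕ) : ℤ) := by
      rw [Int.abs_eq_natAbs]; omega
    have h3 : (((l : ℤ) - |ξ| : ℤ) : ℝ) ≤ (((l - ξ.natAbs : ℕ) : ℤ) : ℝ) := by exact_mod_cast this
    simpa using h3
  unfold lam
  rw [sub_le_iff_le_add, ← add_div, le_div_iff₀ hl]
  linarith

omit [NeZero Q] in
theorem int_eq_of_cast_eq {a b : ℤ} (h : (a : ZMod Q) = b) (hab : |a - b| < Q) : a = b := by
  rw [← sub_eq_zero, ← Int.cast_sub, ZMod.intCast_zmod_eq_zero_iff_dvd] at h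
  have := Int.eq_zero_of_abs_lt_dvd h hab
  omega

theorem lam_eq_zero {l : ℕ} {ξ : ℤ} (h : (l : ℤ) ≤ |ξ|) (hQ : |ξ| + l ≤ Q) :
    lam Q l (ξ : ZMod Q) = 0 := by
  unfold lam
  rw [Finset.filter_eq_empty_iff.2, Finset.card_empty]
  · simp
  rintro ⟨a, b⟩ hp he
  simp only [Finset.mem_product, Finset.mem_range] at hp he
  have h1 : ((a - b : ℤ) : ZMod Q) = (ξ : ZMod Q) := by push_cast; exact he
  have h2 : |((a : ℤ) - b)| < l := by rw [abs_lt]; constructor <;> omega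
  have h3 := int_eq_of_cast_eq h1 (by
    have := abs_sub (a - b : ℤ) ξ
    omega)
  rw [h3] at h2
  omega

theorem rsm_mono (l : ℕ) {g g' : ZMod Q × ZMod Q → ℝ} (h : ∀ z, g z ≤ g' z)
    (z : ZMod Q × ZMod Q) : rsm l g z ≤ rsm l g' z := by
  unfold rsm
  gcongr with u _
  · exact fejer_nonneg l u
  · exact h _

theorem rsm_nonneg (l : ℕ) {g : ZMod Q × ZMod Q → ℝ} (h : ∀ z, 0 ≤ g z)
    (z : ZMod Q × ZMod Q) : 0 ≤ rsm l g z := by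
  unfold rsm
  exact mul_nonneg (by positivity)
    (Finset.sum_nonneg fun u _ => mul_nonneg (fejer_nonneg l u) (h _))

theorem rsm_sum {ι : Type*} (l : ℕ) (s : Finset ι) (g : ι → ZMod Q × ZMod Q → ℝ)
    (z : ZMod Q × ZMod Q) : rsm l (fun z => ∑ a ∈ s, g a z) z = ∑ a ∈ s, rsm l (g a) z := by
  simp only [rsm, Finset.mul_sum]
  rw [Finset.sum_comm]

theorem rsm_const_mul (l : ℕ) (c : ℝ) (g : ZMod Q × ZMod Q → ℝ)
    (z : ZMod Q × ZMod Q) : rsm l (fun z => c * g z) z = c * rsm l g z := by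
  simp only [rsm, Finset.mul_sum]
  exact Finset.sum_congr rfl fun _ _ => by ring

theorem lam_zero {l : ℕ} (hl0 : 0 < l) (hl : l ≤ Q) : lam Q l 0 = 1 := by
  have h1 := one_sub_lam_le (Q := Q) hl0 0
  have h2 := lam_le_one hl (0 : ZMod Q)
  simp at h1
  linarith

theorem sum_fejer {l : ℕ} (hl0 : 0 < l) (hl : l ≤ Q) : (Q : ℝ)⁻¹ * ∑ u, fejer Q l u = 1 := by
  have h := fcoef_fejer (Q := Q) l 0
  rw [lam_zero hl0 hl] at h
  simp only [fcoef, zero_mul, neg_zero, AddChar.map_zero_eq_one, mul_one] at h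
  have h2 : (((Q : ℝ)⁻¹ * ∑ u, fejer Q l u : ℝ) : ℂ) = ((1 : ℝ) : ℂ) := by
    push_cast; rw [h]; norm_num
  exact_mod_cast h2

theorem sum_rsm {l : ℕ} (hl0 : 0 < l) (hl : l ≤ Q) (g : ZMod Q × ZMod Q → ℝ) :
    ∑ z, rsm l g z = ∑ z, g z := by
  simp only [rsm, ← Finset.mul_sum]
  rw [Finset.sum_comm]
  simp only [← Finset.mul_sum]
  have h : ∀ u : ZMod Q, ∑ z : ZMod Q × ZMod Q, g (z.1 - u, z.2) = ∑ z, g z := by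
    intro u
    exact Fintype.sum_equiv ((Equiv.subRight u).prodCongr (Equiv.refl _)) _ _ fun z => rfl
  simp only [h, ← Finset.sum_mul]
  rw [← mul_assoc, sum_fejer hl0 hl, one_mul]

theorem rsm_le_const {l : ℕ} (hl0 : 0 < l) (hl : l ≤ Q) {g : ZMod Q × ZMod Q → ℝ} {c : ℝ}
    (h : ∀ z, g z ≤ c) (z : ZMod Q × ZMod Q) : rsm l g z ≤ c := by
  refine (rsm_mono l (g' := fun _ => c) h z).trans (le_of_eq ?_)
  simp only [rsm, ← Finset.sum_mul]
  rw [← mul_assoc, sum_fejer hl0 hl, one_mul]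

theorem norm_dker_mul_le (K l : ℕ) (u : ZMod Q) : ‖dker Q (K * l) u‖ ≤ K * ‖dker Q l u‖ := by
  induction K with
  | zero => simp [dker]
  | succ K ih =>
    have : dker Q ((K + 1) * l) u = dker Q (K * l) u +
        ZMod.stdAddChar (((K * l : ℕ) : ZMod Q) * u) * dker Q l u := by
      simp only [dker]
      rw [add_mul, one_mul, Finset.sum_range_add, Finset.mul_sum]
      congr 1
      refine Finset.sum_congr rfl fun j _ => ?_
      rw [← AddChar.map_add_eq_mul]
      congr 1; push_cast; ring
    rw [this]
    refine (norm_add_le _ _).trans ?_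
    rw [norm_mul, norm_stdAddChar]
    push_cast
    linarith

theorem rsm_mul_le {K l : ℕ} (hK : 0 < K) {g : ZMod Q × ZMod Q → ℝ}
    (h : ∀ z, 0 ≤ g z) (z : ZMod Q × ZMod Q) : rsm (K * l) g z ≤ K * rsm l g z := by
  rw [← rsm_const_mul]
  unfold rsm
  refine mul_le_mul_of_nonneg_left (Finset.sum_le_sum fun u _ => ?_) (by positivity)
  rw [← mul_assoc, mul_comm _ (K : ℝ)]
  refine mul_le_mul_of_nonneg_right ?_ (h _)
  unfold fejer
  rcases Nat.eq_zero_or_pos l with rfl | hl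
  · simp
  have hl' : (0 : ℝ) < l := by exact_mod_cast hl
  have hK' : (0 : ℝ) < K := by exact_mod_cast hK
  have h1 := norm_dker_mul_le K l u
  push_cast
  rw [div_le_iff₀ (by positivity)]
  calc ‖dker Q (K * l) u‖ ^ 2 ≤ (K * ‖dker Q l u‖) ^ 2 := by gcongr
    _ = K * (‖dker Q l u‖ ^ 2 / l) * (K * l) := by field_simp

variable {A B : Set (ℤ × ℤ)} {f g : ZMod Q × ZMod Q → ℂ}

theorem norm_sq_mem_spec (hf : f ∈ spec Q A) :
    (fun z => ((‖f z‖ ^ 2 : ℝ) : ℂ)) ∈ spec Q (A - A) := by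
  have h := mul_mem_spec hf (conj_mem_spec hf)
  rw [sub_eq_add_neg]
  convert h using 1
  funext z
  rw [Pi.mul_apply, Complex.mul_conj']
  push_cast
  rfl

theorem rsm_mem_spec {l : ℕ} {g : ZMod Q × ZMod Q → ℝ} (hg : (fun z => (g z : ℂ)) ∈ spec Q A) :
    (fun z => (rsm l g z : ℂ)) ∈ spec Q {ζ ∈ A | lam Q l (ζ.1 : ZMod Q) ≠ 0} := by
  have h := conv_mem_spec (fun u => (fejer Q l u : ℂ)) hg
  have h1 : (fun z => (rsm l g z : ℂ)) =
      conv (fun u => (fejer Q l u : ℂ)) (fun z => (g z : ℂ)) := funext fun z => ofReal_rsm l g z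
  rw [h1]
  refine spec_mono ?_ h
  rintro ζ ⟨h2, h3⟩
  refine ⟨h2, ?_⟩
  rw [fcoef_fejer] at h3
  exact_mod_cast h3

/-- Near-diagonal principle for smoothed square functions. -/
theorem rsm_norm_sum_sq_le {ι : Type*} (l : ℕ) (s : Finset ι)
    (f : ι → ZMod Q × ZMod Q → ℂ) (A : ι → Set (ℤ × ℤ)) (hf : ∀ a ∈ s, f a ∈ spec Q (A a))
    (r : ι → ι → Prop) [DecidableRel r]
    (hsymm : ∀ a ∈ s, ∀ b ∈ s, r a b → r b a) (Γ : ℝ)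
    (hΓ : ∀ a ∈ s, ((s.filter (r a)).card : ℝ) ≤ Γ)
    (horth : ∀ a ∈ s, ∀ b ∈ s, ¬ r a b → ∀ ζ ∈ A a, ∀ ζ' ∈ A b,
      lam Q l ((ζ.1 - ζ'.1 : ℤ) : ZMod Q) = 0) (z : ZMod Q × ZMod Q) :
    rsm l (fun z => ‖∑ a ∈ s, f a z‖ ^ 2) z ≤ Γ * ∑ a ∈ s, rsm l (fun z => ‖f a z‖ ^ 2) z := by
  have h := sum_norm_sq_le_of_nearly_orthogonal s (fejer Q l) (fejer_nonneg l)
    (fun a u => f a (z.1 - u, z.2)) r hsymm Γ hΓ ?_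
  · simp only [rsm]
    rw [← Finset.mul_sum, mul_left_comm]
    exact mul_le_mul_of_nonneg_left h (by positivity)
  intro a ha b hb hab
  have h1 := conv_eq_zero (fun u => (fejer Q l u : ℂ))
    (mul_mem_spec (hf a ha) (conj_mem_spec (hf b hb))) ?_
  · have h2 := congrFun h1 z
    simp only [conv, Pi.mul_apply, Pi.zero_apply, mul_eq_zero, inv_eq_zero] at h2
    exact h2.resolve_left (Nat.cast_ne_zero.2 (NeZero.ne Q))
  rintro _ ⟨ζ, hζ, ζ', hζ', rfl⟩
  rw [fcoef_fejer]
  have := horth a ha b hb hab ζ hζ (-ζ') hζ'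
  simp only [Prod.fst_neg, sub_neg_eq_add] at this
  rw [Prod.fst_add, this, Complex.ofReal_zero]

theorem inv_sq_mul_cancel {q : ℝ} (hq : q ≠ 0) (c l S : ℝ) :
    q⁻¹ ^ 2 * ((q * c) * (q * l * S)) = c * l * S := by
  field_simp

theorem norm_sq_le_rsm {l : ℕ} (hl0 : 0 < l) (N₀ : ℕ) (m₀ : ℤ) (hf : f ∈ spec Q A)
    (hA : ∀ ζ ∈ A, m₀ ≤ ζ.1 ∧ ζ.1 ≤ m₀ + N₀) (z : ZMod Q × ZMod Q) :
    ‖f z‖ ^ 2 ≤ (N₀ + l) / l * rsm l (fun z => ‖f z‖ ^ 2) z := by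
  classical
  have hQ : (Q : ℂ) ≠ 0 := Nat.cast_ne_zero.2 (NeZero.ne Q)
  have hQ' : (Q : ℝ) ≠ 0 := Nat.cast_ne_zero.2 (NeZero.ne Q)
  have hl : (0 : ℝ) < l := by exact_mod_cast hl0
  -- the frequencies of `u ↦ κ(u) f(x - u, y)`
  set M : Finset (ZMod Q) := (range (N₀ + l)).image
    (fun j : ℕ => ((j : ℤ) - m₀ - N₀ : ZMod Q)) with hM
  have hMcard : (M.card : ℝ) ≤ N₀ + l := by
    have : M.card ≤ N₀ + l := Finset.card_image_le.trans (by simp)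
    exact_mod_cast this
  set W : Submodule ℂ (ZMod Q → ℂ) :=
    Submodule.span ℂ ((fun (m : ZMod Q) (u : ZMod Q) => (ZMod.stdAddChar (m * u) : ℂ)) '' (M : Set (ZMod Q)))
    with hW
  have hF : (fun u => dker Q l u * f (z.1 - u, z.2)) ∈ W := by
    induction hf using Submodule.span_induction with
    | mem f hf =>
      obtain ⟨ζ, hζ, rfl⟩ := hf
      have : (fun u => dker Q l u * chr Q ζ (z.1 - u, z.2)) = chr Q ζ z •
          ∑ j ∈ range l, fun u : ZMod Q => (ZMod.stdAddChar (((j : ZMod Q) - (ζ.1 : ZMod Q)) * u) : ℂ) := by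
        funext u
        simp only [dker, chr_sub_left, Pi.smul_apply, Finset.sum_apply, smul_eq_mul, Prod.mk.eta]
        rw [Finset.sum_mul, Finset.mul_sum]
        refine Finset.sum_congr rfl fun j _ => ?_
        rw [sub_mul, sub_eq_add_neg, AddChar.map_add_eq_mul]
        ring
      rw [this]
      refine Submodule.smul_mem _ _ (Submodule.sum_mem _ fun j hj => Submodule.subset_span ?_)
      refine ⟨_, ?_, rfl⟩
      have h1 := hA ζ hζ
      rw [Finset.mem_range] at hj
      rw [hM]
      simp only [Finset.coe_image, Set.mem_image, Finset.mem_coe, Finset.mem_range]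
      refine ⟨(j + m₀ + N₀ - ζ.1).toNat, by omega, ?_⟩
      have h2 : (((j + m₀ + N₀ - ζ.1).toNat : ℤ) : ZMod Q) = ((j + m₀ + N₀ - ζ.1 : ℤ) : ZMod Q) := by
        rw [Int.toNat_of_nonneg (by omega)]
      rw [h2]; push_cast; ring
    | zero =>
      have : (fun u => dker Q l u * (0 : ZMod Q × ZMod Q → ℂ) (z.1 - u, z.2)) = 0 := by
        funext u; simp
      rw [this]; exact zero_mem W
    | add f f' _ _ h h' =>
      have : (fun u => dker Q l u * (f + f') (z.1 - u, z.2)) =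
        (fun u => dker Q l u * f (z.1 - u, z.2)) + fun u => dker Q l u * f' (z.1 - u, z.2) := by
        funext u; simp [mul_add]
      rw [this]; exact add_mem h h'
    | smul c f _ h =>
      have : (fun u => dker Q l u * (c • f) (z.1 - u, z.2)) =
        c • (fun u => dker Q l u * f (z.1 - u, z.2)) := by
        funext u; simp; ring
      rw [this]; exact Submodule.smul_mem _ _ h
  have hrep : ∀ F ∈ W, F 0 = (Q : ℂ)⁻¹ * ∑ u, (∑ m ∈ M, ZMod.stdAddChar (-(m * u))) * F u := by
    intro F hF
    induction hF using Submodule.span_induction with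
    | mem F hF =>
      obtain ⟨m, hm, rfl⟩ := hF
      simp only [mul_zero, AddChar.map_zero_eq_one, Finset.sum_mul, ← AddChar.map_add_eq_mul]
      rw [Finset.sum_comm]
      have : ∀ m' u : ZMod Q, -(m' * u) + m * u = (m - m') * u := fun m' u => by ring
      simp only [this, sum_stdAddChar_mul, sub_eq_zero]
      rw [Finset.sum_ite_eq, if_pos (by simpa using hm), inv_mul_cancel₀ hQ]
    | zero => simp
    | add f f' _ _ h h' =>
      simp only [Pi.add_apply, mul_add, Finset.sum_add_distrib]
      rw [h, h']
    | smul c f _ h =>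
      simp only [Pi.smul_apply, smul_eq_mul]
      rw [h, mul_left_comm, Finset.mul_sum]
      congr 1
      exact Finset.sum_congr rfl fun u _ => by ring
  have hdir : ∑ u : ZMod Q, ‖∑ m ∈ M, (ZMod.stdAddChar (-(m * u)) : ℂ)‖ ^ 2 = Q * M.card := by
    have : ((∑ u : ZMod Q, ‖∑ m ∈ M, (ZMod.stdAddChar (-(m * u)) : ℂ)‖ ^ 2 : ℝ) : ℂ) = Q * M.card := by
      push_cast
      have h1 : ∀ u : ZMod Q, (‖∑ m ∈ M, (ZMod.stdAddChar (-(m * u)) : ℂ)‖ : ℂ) ^ 2 =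
          ∑ m ∈ M, ∑ m' ∈ M, ZMod.stdAddChar ((m' - m) * u) := by
        intro u
        rw [← Complex.mul_conj', map_sum, Finset.sum_mul_sum]
        refine Finset.sum_congr rfl fun m _ => Finset.sum_congr rfl fun m' _ => ?_
        rw [conj_stdAddChar, ← AddChar.map_add_eq_mul]
        congr 1; ring
      simp only [h1]
      rw [Finset.sum_comm]
      have h2 : ∀ m ∈ M, ∑ u : ZMod Q, ∑ m' ∈ M, (ZMod.stdAddChar ((m' - m) * u) : ℂ) = Q := by
        intro m hm
        rw [Finset.sum_comm]
        simp only [sum_stdAddChar_mul, sub_eq_zero]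
        rw [Finset.sum_ite_eq', if_pos hm]
      rw [Finset.sum_congr rfl h2, Finset.sum_const, nsmul_eq_mul, mul_comm]
    exact_mod_cast this
  have h0 := hrep _ hF
  have hd0 : dker Q l 0 = l := by simp [dker]
  simp only [sub_zero, Prod.mk.eta, hd0] at h0
  have hCS : (l * ‖f z‖) ^ 2 ≤ (Q : ℝ)⁻¹ ^ 2 * ((Q * M.card) *
      ∑ u, ‖dker Q l u * f (z.1 - u, z.2)‖ ^ 2) := by
    have h1 : l * ‖f z‖ = ‖(l : ℂ) * f z‖ := by simp
    rw [h1, h0, norm_mul, mul_pow, ← hdir]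
    have h2 : ‖(Q : ℂ)⁻¹‖ = (Q : ℝ)⁻¹ := by simp
    rw [h2]
    refine mul_le_mul_of_nonneg_left ?_ (by positivity)
    refine le_trans ?_ (Finset.sum_mul_sq_le_sq_mul_sq _ _ _)
    gcongr
    refine (norm_sum_le _ _).trans (le_of_eq ?_)
    exact Finset.sum_congr rfl fun u _ => norm_mul _ _
  have hrsm : ∑ u, ‖dker Q l u * f (z.1 - u, z.2)‖ ^ 2 =
      Q * l * rsm l (fun z => ‖f z‖ ^ 2) z := by
    simp only [rsm, fejer]
    have h1 : ∀ S : ℝ, (Q : ℝ) * l * ((Q : ℝ)⁻¹ * S) = l * S := fun S => by field_simp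
    rw [h1, Finset.mul_sum]
    refine Finset.sum_congr rfl fun u _ => ?_
    rw [norm_mul]; field_simp
  rw [hrsm] at hCS
  have hr0 : 0 ≤ rsm l (fun z => ‖f z‖ ^ 2) z := rsm_nonneg l (fun _ => by positivity) z
  have h3 : (Q : ℝ)⁻¹ ^ 2 * ((Q * M.card) * (Q * l * rsm l (fun z => ‖f z‖ ^ 2) z)) =
      M.card * l * rsm l (fun z => ‖f z‖ ^ 2) z := by
    exact inv_sq_mul_cancel hQ' _ _ _
  rw [h3] at hCS
  rw [div_mul_eq_mul_div, le_div_iff₀ hl]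
  have h4 : (l : ℝ) * (‖f z‖ ^ 2 * l) ≤ l * ((N₀ + l) * rsm l (fun z => ‖f z‖ ^ 2) z) := by
    calc (l : ℝ) * (‖f z‖ ^ 2 * l) = (l * ‖f z‖) ^ 2 := by ring
      _ ≤ M.card * l * rsm l (fun z => ‖f z‖ ^ 2) z := hCS
      _ ≤ (N₀ + l) * l * rsm l (fun z => ‖f z‖ ^ 2) z := by gcongr
      _ = _ := by ring
  exact le_of_mul_le_mul_left h4 hl

end fejer

/-! ### Spectral boxes -/

/-- Frequencies close to a segment of slope `c` through `(n₀, y₀)`. -/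
def box (n₀ y₀ c r Y : ℝ) : Set (ℤ × ℤ) :=
  {ζ | |(ζ.1 : ℝ) - n₀| ≤ r ∧ |(ζ.2 : ℝ) - y₀ - c * ((ζ.1 : ℝ) - n₀)| ≤ Y}

theorem box_change {n₀ y₀ c r Y n₁ y₁ c' r' Y' : ℝ} (hr : |n₀ - n₁| + r ≤ r')
    (hY : |y₀ - y₁ - c' * (n₀ - n₁)| + |c - c'| * r + Y ≤ Y') :
    box n₀ y₀ c r Y ⊆ box n₁ y₁ c' r' Y' := by
  rintro ⟨ξ, η⟩ ⟨h1, h2⟩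
  refine ⟨?_, ?_⟩
  · have := abs_sub_le (ξ : ℝ) n₀ n₁
    simp only at h1 ⊢
    linarith
  · simp only at h1 h2 ⊢
    have h3 : (η : ℝ) - y₁ - c' * (ξ - n₁) =
        (y₀ - y₁ - c' * (n₀ - n₁)) + (c - c') * (ξ - n₀) + (η - y₀ - c * (ξ - n₀)) := by ring
    rw [h3]
    have h4 : |(c - c') * ((ξ : ℝ) - n₀)| ≤ |c - c'| * r := by
      rw [abs_mul]; gcongr
    exact (abs_add_three _ _ _).trans (by linarith)

theorem box_mono {n₀ y₀ c r Y r' Y' : ℝ} (hr : r ≤ r') (hY : Y ≤ Y') :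
    box n₀ y₀ c r Y ⊆ box n₀ y₀ c r' Y' := fun _ h => ⟨h.1.trans hr, h.2.trans hY⟩

theorem box_add (n₀ y₀ n₁ y₁ c r Y r' Y' : ℝ) :
    box n₀ y₀ c r Y + box n₁ y₁ c r' Y' ⊆ box (n₀ + n₁) (y₀ + y₁) c (r + r') (Y + Y') := by
  rintro _ ⟨⟨ξ, η⟩, ⟨h1, h2⟩, ⟨ξ', η'⟩, ⟨h3, h4⟩, rfl⟩
  simp only at h1 h2 h3 h4
  refine ⟨?_, ?_⟩
  · simp only [Prod.mk_add_mk, Int.cast_add]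
    have := abs_add_le ((ξ : ℝ) - n₀) (ξ' - n₁)
    rw [show (ξ : ℝ) + ξ' - (n₀ + n₁) = (ξ - n₀) + (ξ' - n₁) by ring]
    linarith
  · simp only [Prod.mk_add_mk, Int.cast_add]
    have := abs_add_le ((η : ℝ) - y₀ - c * (ξ - n₀)) (η' - y₁ - c * (ξ' - n₁))
    rw [show (η : ℝ) + η' - (y₀ + y₁) - c * (ξ + ξ' - (n₀ + n₁)) =
      ((η : ℝ) - y₀ - c * (ξ - n₀)) + (η' - y₁ - c * (ξ' - n₁)) by ring]
    linarith

theorem box_neg (n₀ y₀ c r Y : ℝ) : -box n₀ y₀ c r Y ⊆ box (-n₀) (-y₀) c r Y := by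
  rintro ⟨ξ, η⟩ ⟨h1, h2⟩
  simp only [Prod.fst_neg, Prod.snd_neg, Int.cast_neg] at h1 h2
  refine ⟨?_, ?_⟩
  · rw [← abs_neg]; convert h1 using 2; ring
  · rw [← abs_neg]; convert h2 using 2; ring

theorem box_sub (n₀ y₀ n₁ y₁ c r Y r' Y' : ℝ) :
    box n₀ y₀ c r Y - box n₁ y₁ c r' Y' ⊆ box (n₀ - n₁) (y₀ - y₁) c (r + r') (Y + Y') := by
  rw [sub_eq_add_neg, sub_eq_add_neg, sub_eq_add_neg]
  exact (Set.add_subset_add_left (box_neg _ _ _ _ _)).trans (box_add _ _ _ _ _ _ _ _ _)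

theorem zero_mem_box {c r Y : ℝ} (hr : 0 ≤ r) (hY : 0 ≤ Y) : (0 : ℤ × ℤ) ∈ box 0 0 c r Y := by
  constructor <;> simpa

theorem abs_le_of_mem_box {n₀ y₀ c r Y : ℝ} {ζ : ℤ × ℤ} (h : ζ ∈ box n₀ y₀ c r Y) :
    |(ζ.1 : ℝ)| ≤ |n₀| + r ∧ |(ζ.2 : ℝ)| ≤ |y₀| + |c| * r + Y := by
  obtain ⟨h1, h2⟩ := h
  constructor
  · have := abs_add_le n₀ ((ζ.1 : ℝ) - n₀)
    rw [add_sub_cancel] at this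
    linarith
  · have h3 := abs_add_three y₀ (c * ((ζ.1 : ℝ) - n₀)) ((ζ.2 : ℝ) - y₀ - c * ((ζ.1 : ℝ) - n₀))
    rw [show y₀ + c * ((ζ.1 : ℝ) - n₀) + ((ζ.2 : ℝ) - y₀ - c * ((ζ.1 : ℝ) - n₀)) = ζ.2 by ring,
      abs_mul] at h3
    have : |c| * |(ζ.1 : ℝ) - n₀| ≤ |c| * r := by gcongr
    linarith

theorem int_eq_zero_of_cast {Q : ℕ} {a : ℤ} (h : (a : ZMod Q) = 0) (ha : |(a : ℝ)| < Q) :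
    a = 0 := by
  rw [ZMod.intCast_zmod_eq_zero_iff_dvd] at h
  refine Int.eq_zero_of_abs_lt_dvd h ?_
  have : ((|a| : ℤ) : ℝ) < (Q : ℝ) := by push_cast; exact ha
  exact_mod_cast this

section grid

variable {Q : ℕ} [NeZero Q] {f g : ZMod Q × ZMod Q → ℂ}

/-- The integral of a function with spectrum in a box not containing `0` vanishes. -/
theorem sum_eq_zero_of_mem_box {n₀ y₀ c r Y : ℝ} (hf : f ∈ spec Q (box n₀ y₀ c r Y))
    (h1 : |n₀| + r < Q) (h2 : |y₀| + |c| * r + Y < Q)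
    (h : ¬ (|n₀| ≤ r ∧ |y₀ - c * n₀| ≤ Y)) : ∑ z, f z = 0 := by
  refine sum_eq_zero_of_mem_spec hf ?_
  rintro ⟨ξ, η⟩ hζ ⟨h3, h4⟩
  obtain ⟨h5, h6⟩ := abs_le_of_mem_box hζ
  have hξ := int_eq_zero_of_cast h3 (h5.trans_lt h1)
  have hη := int_eq_zero_of_cast h4 (h6.trans_lt h2)
  simp only at hξ hη
  subst hξ hη
  refine h ?_
  obtain ⟨h7, h8⟩ := hζ
  simp only [Int.cast_zero, zero_sub, abs_neg] at h7 h8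
  refine ⟨h7, ?_⟩
  rw [← abs_neg]
  convert h8 using 2
  ring

theorem mul_mem_box {n₀ y₀ n₁ y₁ c r Y r' Y' : ℝ} (hf : f ∈ spec Q (box n₀ y₀ c r Y))
    (hg : g ∈ spec Q (box n₁ y₁ c r' Y')) :
    f * g ∈ spec Q (box (n₀ + n₁) (y₀ + y₁) c (r + r') (Y + Y')) :=
  spec_mono (box_add _ _ _ _ _ _ _ _ _) (mul_mem_spec hf hg)

theorem conj_mem_box {n₀ y₀ c r Y : ℝ} (hf : f ∈ spec Q (box n₀ y₀ c r Y)) :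
    (fun z => conj (f z)) ∈ spec Q (box (-n₀) (-y₀) c r Y) :=
  spec_mono (box_neg _ _ _ _ _) (conj_mem_spec hf)

theorem one_mem_box {c r Y : ℝ} (hr : 0 ≤ r) (hY : 0 ≤ Y) :
    (1 : ZMod Q × ZMod Q → ℂ) ∈ spec Q (box 0 0 c r Y) := one_mem_spec (zero_mem_box hr hY)

theorem mul_mem_box_zero {c r Y r' Y' : ℝ} (hf : f ∈ spec Q (box 0 0 c r Y))
    (hg : g ∈ spec Q (box 0 0 c r' Y')) : f * g ∈ spec Q (box 0 0 c (r + r') (Y + Y')) := by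
  simpa using mul_mem_box hf hg

theorem pow_mem_box_zero {c r Y : ℝ} (hf : f ∈ spec Q (box 0 0 c r Y)) (k : ℕ) :
    f ^ k ∈ spec Q (box 0 0 c (k * r) (k * Y)) := by
  induction k with
  | zero => simpa using one_mem_box (Q := Q) (c := c) le_rfl le_rfl
  | succ k ih =>
    rw [pow_succ]
    convert mul_mem_box_zero ih hf using 3 <;> push_cast <;> ring

end grid

/-! ### Chebyshev-type polynomials -/

/-- The polynomials with `sin ((2 * k + 1) φ) = sin φ * cheb k (sin φ ^ 2)`. -/
def cheb : ℕ → ℝ → ℝ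
  | 0, _ => 1
  | 1, u => 3 - 4 * u
  | k + 2, u => 2 * (1 - 2 * u) * cheb (k + 1) u - cheb k u

theorem sin_mul_cheb (φ : ℝ) (k : ℕ) :
    Real.sin φ * cheb k (Real.sin φ ^ 2) = Real.sin ((2 * k + 1) * φ) := by
  induction k using Nat.twoStepInduction with
  | zero => simp [cheb]
  | one =>
    have : ((2 * ((1 : ℕ) : ℝ) + 1) * φ) = 3 * φ := by push_cast; ring
    rw [this, Real.sin_three_mul]
    simp only [cheb]; ring
  | more k ih1 ih2 =>
    simp only [cheb]
    have h1 : Real.sin ((2 * ((k + 2 : ℕ) : ℝ) + 1) * φ) =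
        2 * Real.cos (2 * φ) * Real.sin ((2 * ((k + 1 : ℕ) : ℝ) + 1) * φ) -
          Real.sin ((2 * (k : ℝ) + 1) * φ) := by
      have e1 : (2 * ((k + 2 : ℕ) : ℝ) + 1) * φ = (2 * ((k + 1 : ℕ) : ℝ) + 1) * φ + 2 * φ := by
        push_cast; ring
      have e2 : (2 * (k : ℝ) + 1) * φ = (2 * ((k + 1 : ℕ) : ℝ) + 1) * φ - 2 * φ := by
        push_cast; ring
      rw [e1, e2, Real.sin_add, Real.sin_sub]; ring
    rw [h1, ← ih1, ← ih2, Real.cos_two_mul, Real.cos_sq']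
    ring

theorem cheb_zero (k : ℕ) : cheb k 0 = 2 * k + 1 := by
  induction k using Nat.twoStepInduction with
  | zero => simp [cheb]
  | one => norm_num [cheb]
  | more k ih1 ih2 => simp only [cheb]; rw [ih1, ih2]; push_cast; ring

theorem abs_sin_nat_mul_le (d : ℕ) (φ : ℝ) : |Real.sin (d * φ)| ≤ d * |Real.sin φ| := by
  induction d with
  | zero => simp
  | succ d ih =>
    push_cast
    rw [add_mul, one_mul, Real.sin_add]
    refine (abs_add_le _ _).trans ?_
    rw [abs_mul, abs_mul]
    have h1 := Real.abs_cos_le_one φ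
    have h2 := Real.abs_cos_le_one (d * φ)
    nlinarith [abs_nonneg (Real.sin (d * φ)), abs_nonneg (Real.sin φ)]

theorem one_sub_cos_nat_mul_le (d : ℕ) (φ : ℝ) :
    1 - Real.cos (d * φ) ≤ d ^ 2 * (1 - Real.cos φ) := by
  have h : ∀ x : ℝ, 1 - Real.cos x = 2 * Real.sin (x / 2) ^ 2 := by
    intro x
    have := Real.cos_sq (x / 2)
    have h2 := Real.sin_sq (x / 2)
    rw [mul_div_cancel₀ x (two_ne_zero)] at this
    linarith
  rw [h, h]
  have h1 := abs_sin_nat_mul_le d (φ / 2)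
  rw [← mul_div_assoc] at h1
  have h2 := pow_le_pow_left₀ (abs_nonneg _) h1 2
  rw [mul_pow, sq_abs, sq_abs] at h2
  linarith

theorem abs_nat_mul_sin_sub_le (d : ℕ) {φ : ℝ} (hs : 0 ≤ Real.sin φ) (hc : 0 ≤ Real.cos φ) :
    |d * Real.sin φ - Real.sin (d * φ)| ≤ d ^ 3 * Real.sin φ ^ 3 := by
  have h1 : 1 - Real.cos φ ≤ Real.sin φ ^ 2 := by
    rw [Real.sin_sq]; nlinarith [Real.cos_le_one φ]
  induction d with
  | zero => simp
  | succ d ih =>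
    have e : ((d + 1 : ℕ) : ℝ) * Real.sin φ - Real.sin (((d + 1 : ℕ) : ℝ) * φ) =
        (d * Real.sin φ - Real.sin (d * φ)) + Real.sin (d * φ) * (1 - Real.cos φ) +
          Real.sin φ * (1 - Real.cos (d * φ)) := by
      push_cast
      rw [add_mul (d : ℝ) 1 φ, one_mul, Real.sin_add]; ring
    rw [e]
    refine (abs_add_three _ _ _).trans ?_
    have h2 : |Real.sin (d * φ) * (1 - Real.cos φ)| ≤ d * Real.sin φ ^ 3 := by
      rw [abs_mul, abs_of_nonneg (by linarith [Real.cos_le_one φ] : 0 ≤ 1 - Real.cos φ)]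
      have := abs_sin_nat_mul_le d φ
      rw [abs_of_nonneg hs] at this
      calc |Real.sin (d * φ)| * (1 - Real.cos φ) ≤ (d * Real.sin φ) * Real.sin φ ^ 2 := by
            gcongr; linarith [Real.cos_le_one φ]
        _ = _ := by ring
    have h3 : |Real.sin φ * (1 - Real.cos (d * φ))| ≤ d ^ 2 * Real.sin φ ^ 3 := by
      rw [abs_mul, abs_of_nonneg hs,
        abs_of_nonneg (by linarith [Real.cos_le_one (d * φ)] : 0 ≤ 1 - Real.cos (d * φ))]
      calc Real.sin φ * (1 - Real.cos (d * φ)) ≤ Real.sin φ * (d ^ 2 * Real.sin φ ^ 2) := by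
            gcongr
            exact (one_sub_cos_nat_mul_le d φ).trans (by gcongr)
        _ = _ := by ring
    have h4 : 0 ≤ Real.sin φ ^ 3 := by positivity
    push_cast
    have h5 : (d : ℝ) ^ 3 + d + d ^ 2 ≤ (d + 1) ^ 3 := by
      have : (0 : ℝ) ≤ d := Nat.cast_nonneg d
      nlinarith [sq_nonneg (d : ℝ)]
    nlinarith

theorem cheb_bounds (k : ℕ) {u : ℝ} (h0 : 0 ≤ u) (h1 : u ≤ 1) :
    |cheb k u| ≤ 2 * k + 1 ∧ cheb k u ^ 2 * u ≤ 1 ∧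
      |(2 * k + 1) - cheb k u| ≤ (2 * k + 1) ^ 3 * u := by
  rcases h0.eq_or_lt with rfl | h0
  · rw [cheb_zero]
    refine ⟨le_of_eq (abs_of_nonneg (by positivity)), by simp, by simp⟩
  have hsq : Real.sqrt u ≤ 1 := Real.sqrt_le_one.2 h1
  have hsp : 0 < Real.sqrt u := Real.sqrt_pos.2 h0
  set φ := Real.arcsin (Real.sqrt u) with hφ
  have hs : Real.sin φ = Real.sqrt u := Real.sin_arcsin (by linarith) hsq
  have hc : 0 ≤ Real.cos φ := Real.cos_arcsin_nonneg _
  have hu : Real.sin φ ^ 2 = u := by rw [hs, Real.sq_sqrt h0.le]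
  have hm := sin_mul_cheb φ k
  rw [hu] at hm
  have hsφ : 0 < Real.sin φ := by rw [hs]; exact hsp
  have hcast : (2 * (k : ℝ) + 1) = ((2 * k + 1 : ℕ) : ℝ) := by push_cast; ring
  refine ⟨?_, ?_, ?_⟩
  · have h2 := abs_sin_nat_mul_le (2 * k + 1) φ
    rw [← hcast, ← hm, abs_mul, mul_comm (|Real.sin φ|)] at h2
    exact le_of_mul_le_mul_right h2 (abs_pos.2 hsφ.ne')
  · have h2 := Real.sin_sq_le_one ((2 * k + 1) * φ)
    rw [← hm, mul_pow, hu] at h2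
    linarith
  · have h2 := abs_nat_mul_sin_sub_le (2 * k + 1) hsφ.le hc
    rw [← hcast, ← hm, mul_comm (2 * (k : ℝ) + 1), ← mul_sub, abs_mul, abs_of_pos hsφ] at h2
    have h3 : (2 * (k : ℝ) + 1) ^ 3 * Real.sin φ ^ 3 =
        Real.sin φ * ((2 * (k : ℝ) + 1) ^ 3 * u) := by rw [← hu]; ring
    rw [h3] at h2
    exact le_of_mul_le_mul_left h2 hsφ

theorem cheb_mem_spec {Q : ℕ} [NeZero Q] {v : ZMod Q × ZMod Q → ℝ} {c r Y : ℝ} (hr : 0 ≤ r)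
    (hY : 0 ≤ Y) (hv : (fun z => (v z : ℂ)) ∈ spec Q (box 0 0 c r Y)) (k : ℕ) :
    (fun z => (cheb k (v z) : ℂ)) ∈ spec Q (box 0 0 c (k * r) (k * Y)) := by
  induction k using Nat.twoStepInduction with
  | zero =>
    have : (fun z => (cheb 0 (v z) : ℂ)) = 1 := by funext z; simp [cheb]
    rw [this]; simpa using one_mem_box (Q := Q) (c := c) le_rfl le_rfl
  | one =>
    have : (fun z => (cheb 1 (v z) : ℂ)) = (3 : ℂ) • 1 - (4 : ℂ) • fun z => (v z : ℂ) := by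
      funext z; simp [cheb]
    rw [this, Nat.cast_one, one_mul, one_mul]
    exact sub_mem (Submodule.smul_mem _ _ (one_mem_box hr hY)) (Submodule.smul_mem _ _ hv)
  | more k ih1 ih2 =>
    have : (fun z => (cheb (k + 2) (v z) : ℂ)) =
        ((2 : ℂ) • 1 - (4 : ℂ) • fun z => (v z : ℂ)) * (fun z => (cheb (k + 1) (v z) : ℂ)) -
          fun z => (cheb k (v z) : ℂ) := by
      funext z
      simp only [cheb, Pi.sub_apply, Pi.mul_apply, Pi.smul_apply, Pi.one_apply, smul_eq_mul]
      push_cast; ring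
    rw [this]
    refine sub_mem ?_ (spec_mono (box_mono ?_ ?_) ih1)
    · have h1 : ((2 : ℂ) • 1 - (4 : ℂ) • fun z => (v z : ℂ)) ∈ spec Q (box 0 0 c r Y) :=
        sub_mem (Submodule.smul_mem _ _ (one_mem_box hr hY)) (Submodule.smul_mem _ _ hv)
      refine spec_mono (box_mono ?_ ?_) (mul_mem_box_zero h1 ih2) <;> push_cast <;> linarith
    · gcongr; omega
    · gcongr; omega

/-- Coefficients, a uniformly convex frequency sequence with integer approximations, and a
branching parameter. -/
structure Setup where
  /-- coefficients -/
  b : ℕ → ℂ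
  /-- integer frequencies -/
  G : ℕ → ℤ
  /-- convex sequence -/
  γ : ℕ → ℝ
  /-- size of the second differences -/
  h : ℝ
  /-- distortion of the second differences -/
  C₀ : ℝ
  /-- branching parameter -/
  k : ℕ
  norm_b_le : ∀ n, ‖b n‖ ≤ 1
  abs_G_sub_le : ∀ n, |(G n : ℝ) - γ n| ≤ 1
  h_pos : 0 < h
  h_le_one : h ≤ 1
  one_le_C₀ : 1 ≤ C₀
  k_pos : 0 < k
  le_second_diff : ∀ n, h ≤ (γ (n + 2) - γ (n + 1)) - (γ (n + 1) - γ n)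
  second_diff_le : ∀ n, (γ (n + 2) - γ (n + 1)) - (γ (n + 1) - γ n) ≤ C₀ * h

namespace Setup

variable (S : Setup)

/-- Branching number. -/
def K : ℕ := 4 * S.k

/-- Half degree of the pruning polynomials. -/
def e : ℕ := 40 * S.k ^ 2

/-- Length of the bottom blocks. -/
def D : ℕ := 80 * S.k ^ 2 + 1

/-- Length of the blocks at level `i`. -/
def s (i : ℕ) : ℕ := S.D * S.K ^ i

/-- Slopes. -/
def c (n : ℕ) : ℝ := S.γ (n + 1) - S.γ n

/-- Spectral thickness at level `i`. -/
def Yt (i : ℕ) : ℝ := S.C₀ * 15 ^ i * (1 + S.h * (S.s i) ^ 2)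

theorem four_le_K : 4 ≤ S.K := by have := S.k_pos; unfold K; omega

theorem D_eq : (S.D : ℝ) = 2 * S.e + 1 := by unfold D e; push_cast; ring

theorem D_eq' : (S.D : ℝ) = 5 * (S.K : ℝ) ^ 2 + 1 := by unfold D K; push_cast; ring

theorem K_pos : 0 < S.K := by have := S.four_le_K; omega

theorem D_pos : 0 < S.D := by unfold D; omega

theorem s_pos (i : ℕ) : 0 < S.s i := Nat.mul_pos S.D_pos (pow_pos S.K_pos i)

theorem s_succ (i : ℕ) : S.s (i + 1) = S.K * S.s i := by unfold s; ring

theorem s_mono {i j : ℕ} (hij : i ≤ j) : S.s i ≤ S.s j :=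
  Nat.mul_le_mul_left _ (Nat.pow_le_pow_right S.K_pos hij)

theorem pow_le_s (i : ℕ) : S.K ^ i ≤ S.s i := Nat.le_mul_of_pos_left _ S.D_pos

theorem C₀_pos : 0 < S.C₀ := one_pos.trans_le S.one_le_C₀

theorem Yt_pos (i : ℕ) : 0 < S.Yt i := by
  have := S.C₀_pos; have := S.h_pos; unfold Yt; positivity

theorem c_add (n r : ℕ) : S.h * r ≤ S.c (n + r) - S.c n ∧ S.c (n + r) - S.c n ≤ S.C₀ * S.h * r := by
  induction r with
  | zero => simp
  | succ r ih =>
    have h1 := S.le_second_diff (n + r)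
    have h2 := S.second_diff_le (n + r)
    unfold c at *
    push_cast
    rw [show n + (r + 1) + 1 = n + r + 2 by ring, ← add_assoc]
    constructor <;> linarith [ih.1, ih.2]

theorem γ_add (n r : ℕ) : 0 ≤ S.γ (n + r) - S.γ n - S.c n * r ∧
    S.γ (n + r) - S.γ n - S.c n * r ≤ S.C₀ * S.h * r ^ 2 := by
  induction r with
  | zero => simp
  | succ r ih =>
    obtain ⟨h1, h2⟩ := S.c_add n r
    have h3 : S.γ (n + (r + 1)) - S.γ (n + r) = S.c (n + r) := rfl
    have h4 := mul_nonneg S.h_pos.le (Nat.cast_nonneg (α := ℝ) r)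
    have h5 := mul_pos S.C₀_pos S.h_pos
    have h6 : (0 : ℝ) ≤ r := Nat.cast_nonneg r
    push_cast
    constructor
    · linarith [ih.1]
    · nlinarith [ih.2, mul_nonneg h5.le h6]

/-- Pruning multiplier. -/
noncomputable def P (B : ℝ) (i : ℕ) (v : ℝ) : ℝ :=
  if S.h * (S.s i) ^ 2 < 1 then 1 else cheb S.e (v / B ^ 2) / S.D

/-- The pruned wave packets. -/
noncomputable def ft (Q : ℕ) [NeZero Q] (B : ℝ) : ℕ → ℕ → ZMod Q × ZMod Q → ℂ
  | 0, a => fun z => ∑ r ∈ range S.D, S.b (S.D * a + r) * chr Q ((S.D * a + r : ℕ), S.G (S.D * a + r)) z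
  | i + 1, a => fun z => ∑ r ∈ range S.K, ft Q B i (S.K * a + r) z *
      (S.P B i (rsm (S.K ^ i) (fun z => ‖ft Q B i (S.K * a + r) z‖ ^ 2) z) : ℂ)

variable (Q : ℕ) [NeZero Q] (B : ℝ)

/-- Local square function. -/
noncomputable def v (i a : ℕ) : ZMod Q × ZMod Q → ℝ :=
  rsm (S.K ^ i) (fun z => ‖S.ft Q B i a z‖ ^ 2)

/-- The wave packets after pruning. -/
noncomputable def fp (i a : ℕ) (z : ZMod Q × ZMod Q) : ℂ :=
  S.ft Q B i a z * (S.P B i (S.v Q B i a z) : ℂ)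

theorem ft_succ (i a : ℕ) (z : ZMod Q × ZMod Q) :
    S.ft Q B (i + 1) a z = ∑ r ∈ range S.K, S.fp Q B i (S.K * a + r) z := rfl

/-- The box containing the spectrum of the wave packet. -/
def tbox (i a : ℕ) (r Y : ℝ) : Set (ℤ × ℤ) :=
  box ((S.s i * a : ℕ) : ℝ) (S.γ (S.s i * a)) (S.c (S.s i * a)) r Y

variable {Q B}

theorem tbox_sub_mono (n r : ℕ) {ρ Y ρ' Y' : ℝ} (hρ : 0 ≤ ρ) (h1 : r + ρ ≤ ρ')
    (h2 : Y + S.C₀ * S.h * (r ^ 2 + r * ρ) ≤ Y') :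
    box ((n + r : ℕ) : ℝ) (S.γ (n + r)) (S.c (n + r)) ρ Y ⊆
      box (n : ℝ) (S.γ n) (S.c n) ρ' Y' := by
  obtain ⟨h3, h4⟩ := S.c_add n r
  obtain ⟨h5, h6⟩ := S.γ_add n r
  have h7 : (0 : ℝ) ≤ r := Nat.cast_nonneg r
  refine box_change ?_ ?_
  · push_cast
    rw [add_sub_cancel_left, abs_of_nonneg h7]
    exact h1
  · push_cast
    rw [add_sub_cancel_left, abs_of_nonneg h5, abs_of_nonneg ((mul_nonneg S.h_pos.le h7).trans h3)]
    have := mul_le_mul_of_nonneg_right h4 hρ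
    linarith

theorem v_mem_spec_of {i a : ℕ} (hQ : 4 * S.s i ≤ Q)
    (h : S.ft Q B i a ∈ spec Q (S.tbox i a (5 / 4 * S.s i) (S.Yt i))) :
    (fun z => (S.v Q B i a z : ℂ)) ∈
      spec Q (box 0 0 (S.c (S.s i * a)) (S.K ^ i : ℕ) (2 * S.Yt i)) := by
  have h1 := rsm_mem_spec (l := S.K ^ i) (norm_sq_mem_spec h)
  refine spec_mono ?_ h1
  rintro ζ ⟨hζ, hl⟩
  have h2 := box_sub _ _ _ _ _ _ _ _ _ hζ
  rw [sub_self, sub_self] at h2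
  obtain ⟨h3, h4⟩ := h2
  refine ⟨?_, by linarith⟩
  by_contra hcon
  push Not at hcon
  refine hl (lam_eq_zero ?_ ?_)
  · simp only [sub_zero] at hcon
    have : ((S.K ^ i : ℕ) : ℝ) < ((|ζ.1| : ℤ) : ℝ) := by push_cast at hcon ⊢; exact hcon
    exact_mod_cast this.le
  · rw [sub_zero] at h3
    have h5 : ((S.K ^ i : ℕ) : ℝ) ≤ S.s i := by exact_mod_cast S.pow_le_s i
    have h6 : (4 * S.s i : ℝ) ≤ Q := by exact_mod_cast hQ
    have h7 : (((|ζ.1| : ℤ) + (S.K ^ i : ℕ) : ℤ) : ℝ) ≤ ((Q : ℤ) : ℝ) := by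
      push_cast at h5 ⊢
      have := (S.s_pos i)
      have : (0 : ℝ) < S.s i := by exact_mod_cast this
      linarith
    exact_mod_cast h7

theorem fp_mem_spec_of {i a : ℕ} (hQ : 4 * S.s i ≤ Q)
    (h : S.ft Q B i a ∈ spec Q (S.tbox i a (5 / 4 * S.s i) (S.Yt i))) :
    S.fp Q B i a ∈ spec Q (S.tbox i a (2 * S.s i)
      (if S.h * (S.s i) ^ 2 < 1 then S.Yt i else S.D * S.Yt i)) := by
  have hs : (0 : ℝ) < S.s i := by exact_mod_cast S.s_pos i
  have hY := S.Yt_pos i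
  by_cases hp : S.h * (S.s i : ℝ) ^ 2 < 1
  · have h1 : S.fp Q B i a = S.ft Q B i a := by
      funext z; simp [fp, P, hp]
    rw [h1, if_pos hp]
    exact spec_mono (box_mono (by linarith) le_rfl) h
  · rw [if_neg hp]
    have hv := S.v_mem_spec_of hQ h
    have h2 : (fun z => ((S.v Q B i a z / B ^ 2 : ℝ) : ℂ)) ∈
        spec Q (box 0 0 (S.c (S.s i * a)) (S.K ^ i : ℕ) (2 * S.Yt i)) := by
      have : (fun z => ((S.v Q B i a z / B ^ 2 : ℝ) : ℂ)) =
          (((B ^ 2)⁻¹ : ℝ) : ℂ) • fun z => (S.v Q B i a z : ℂ) := by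
        funext z; simp [div_eq_inv_mul]
      rw [this]; exact Submodule.smul_mem _ _ hv
    have h3 := cheb_mem_spec (by positivity) (by positivity) h2 S.e
    have h4 : S.fp Q B i a = (S.D : ℂ)⁻¹ •
        (S.ft Q B i a * fun z => (cheb S.e (S.v Q B i a z / B ^ 2) : ℂ)) := by
      funext z
      simp only [fp, P, hp, if_false, Pi.smul_apply, Pi.mul_apply, smul_eq_mul]
      push_cast; ring
    rw [h4]
    refine Submodule.smul_mem _ _ ?_
    have h5 := mul_mem_box h h3
    rw [add_zero, add_zero] at h5
    refine spec_mono (box_mono ?_ ?_) h5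
    · have h6 : (S.s i : ℝ) = (2 * S.e + 1) * (S.K ^ i : ℕ) := by
        rw [← D_eq]; unfold s; push_cast; ring
      have h7 : (0 : ℝ) ≤ (S.K ^ i : ℕ) := Nat.cast_nonneg _
      linarith
    · rw [D_eq]; linarith

theorem ft_mem_spec (i a : ℕ) (hQ : 4 * S.s i ≤ Q) :
    S.ft Q B i a ∈ spec Q (S.tbox i a (5 / 4 * S.s i) (S.Yt i)) := by
  have hC := S.one_le_C₀
  have hh := S.h_pos
  induction i generalizing a with
  | zero =>
    have h1 : S.ft Q B 0 a = ∑ r ∈ range S.D, S.b (S.D * a + r) •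
        chr Q ((S.D * a + r : ℕ), S.G (S.D * a + r)) := by
      funext z; simp [ft]
    rw [h1]
    refine Submodule.sum_mem _ fun r hr => Submodule.smul_mem _ _ (chr_mem_spec ?_)
    have hs : S.s 0 = S.D := by simp [s]
    have hr' : (r : ℝ) ≤ S.D := by
      have := (Finset.mem_range.1 hr).le
      exact_mod_cast this
    have hr0 : (0 : ℝ) ≤ r := Nat.cast_nonneg r
    unfold tbox
    rw [hs]
    refine S.tbox_sub_mono (S.D * a) r (ρ := 0) (Y := 1) le_rfl ?_ ?_ ?_
    · linarith
    · simp only [Yt, pow_zero, hs, mul_zero, add_zero, mul_one]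
      have : (r : ℝ) ^ 2 ≤ (S.D : ℝ) ^ 2 := by gcongr
      have := mul_le_mul_of_nonneg_left this (mul_pos S.C₀_pos hh).le
      linarith
    · constructor
      · simp
      · simp only [sub_self, mul_zero, sub_zero, Int.cast_natCast]
        exact S.abs_G_sub_le _
  | succ i ih =>
    have hQ' : 4 * S.s i ≤ Q := (Nat.mul_le_mul_left 4 (S.s_mono (Nat.le_succ i))).trans hQ
    have h1 : S.ft Q B (i + 1) a = ∑ r ∈ range S.K, S.fp Q B i (S.K * a + r) := by
      funext z; rw [ft_succ, Finset.sum_apply]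
    rw [h1]
    refine Submodule.sum_mem _ fun r hr => spec_mono ?_ (S.fp_mem_spec_of hQ' (ih _ hQ'))
    unfold tbox
    have e1 : S.s i * (S.K * a + r) = S.s (i + 1) * a + r * S.s i := by rw [s_succ]; ring
    rw [e1]
    have hs : (0 : ℝ) < S.s i := by exact_mod_cast S.s_pos i
    have hr' : (r : ℝ) + 1 ≤ S.K := by exact_mod_cast Finset.mem_range.1 hr
    have hr0 : (0 : ℝ) ≤ r := Nat.cast_nonneg r
    have hK : (4 : ℝ) ≤ S.K := by exact_mod_cast S.four_le_K
    refine S.tbox_sub_mono _ (r * S.s i) (by positivity) ?_ ?_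
    · rw [s_succ]; push_cast; nlinarith
    · have h2 : ((r * S.s i : ℕ) : ℝ) ^ 2 + ((r * S.s i : ℕ) : ℝ) * (2 * S.s i) ≤
          3 * (S.s (i + 1) : ℝ) ^ 2 := by
        rw [s_succ]; push_cast
        have : (r : ℝ) ^ 2 + 2 * r ≤ 3 * S.K ^ 2 := by nlinarith
        nlinarith [sq_nonneg (S.s i : ℝ)]
      have h3 : (if S.h * (S.s i : ℝ) ^ 2 < 1 then S.Yt i else S.D * S.Yt i) ≤
          S.C₀ * 15 ^ i * (1 + 12 * S.h * (S.s (i + 1) : ℝ) ^ 2) := by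
        have hsK : (S.s (i + 1) : ℝ) = S.K * S.s i := by rw [s_succ]; push_cast; rfl
        have hx : 0 ≤ S.h * (S.s i : ℝ) ^ 2 := by positivity
        split_ifs with hp
        · unfold Yt
          have hC0 := S.C₀_pos
          refine mul_le_mul_of_nonneg_left ?_ (by positivity)
          rw [hsK]
          have : (S.s i : ℝ) ^ 2 ≤ 12 * (S.K * S.s i) ^ 2 := by
            rw [mul_pow]
            have : (1 : ℝ) ≤ (S.K : ℝ) ^ 2 := by nlinarith
            nlinarith [sq_nonneg (S.s i : ℝ)]
          nlinarith
        · unfold Yt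
          push Not at hp
          have h4 : (S.D : ℝ) * (1 + S.h * (S.s i : ℝ) ^ 2) ≤
              1 + 12 * S.h * (S.s (i + 1) : ℝ) ^ 2 := by
            rw [hsK, D_eq', mul_pow]
            have h5 : (16 : ℝ) ≤ (S.K : ℝ) ^ 2 := by nlinarith
            nlinarith [mul_le_mul_of_nonneg_right h5 hx]
          have h6 : 0 ≤ S.C₀ * 15 ^ i := by have := S.C₀_pos; positivity
          nlinarith [mul_le_mul_of_nonneg_left h4 h6]
      have h4 : S.C₀ * S.h * (((r * S.s i : ℕ) : ℝ) ^ 2 + ((r * S.s i : ℕ) : ℝ) * (2 * S.s i)) ≤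
          S.C₀ * S.h * (3 * (S.s (i + 1) : ℝ) ^ 2) :=
        mul_le_mul_of_nonneg_left h2 (mul_pos S.C₀_pos hh).le
      have h5 : S.C₀ * S.h * (3 * (S.s (i + 1) : ℝ) ^ 2) ≤
          S.C₀ * 15 ^ i * (3 * S.h * (S.s (i + 1) : ℝ) ^ 2) := by
        have : (1 : ℝ) ≤ 15 ^ i := one_le_pow₀ (by norm_num)
        have hx : 0 ≤ S.C₀ * (3 * S.h * (S.s (i + 1) : ℝ) ^ 2) := by
          have := S.C₀_pos; positivity
        nlinarith
      have h6 : 0 ≤ S.C₀ * 15 ^ i := by have := S.C₀_pos; positivity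
      have h7 : S.Yt (i + 1) = 15 * (S.C₀ * 15 ^ i * (1 + S.h * (S.s (i + 1) : ℝ) ^ 2)) := by
        unfold Yt; ring
      rw [h7]
      nlinarith

theorem v_mem_spec (i a : ℕ) (hQ : 4 * S.s i ≤ Q) :
    (fun z => (S.v Q B i a z : ℂ)) ∈
      spec Q (box 0 0 (S.c (S.s i * a)) (S.K ^ i : ℕ) (2 * S.Yt i)) :=
  S.v_mem_spec_of hQ (S.ft_mem_spec i a hQ)

theorem fp_mem_spec (i a : ℕ) (hQ : 4 * S.s i ≤ Q) :
    S.fp Q B i a ∈ spec Q (S.tbox i a (2 * S.s i)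
      (if S.h * (S.s i) ^ 2 < 1 then S.Yt i else S.D * S.Yt i)) :=
  S.fp_mem_spec_of hQ (S.ft_mem_spec i a hQ)

/-! ### Pointwise bounds -/

theorem v_nonneg (i a : ℕ) (z : ZMod Q × ZMod Q) : 0 ≤ S.v Q B i a z :=
  rsm_nonneg _ (fun _ => sq_nonneg _) z

theorem norm_ft_sq_le (i a : ℕ) (hQ : 4 * S.s i ≤ Q) (z : ZMod Q × ZMod Q) :
    ‖S.ft Q B i a z‖ ^ 2 ≤ 5 * S.D * S.v Q B i a z := by
  have hs : (0 : ℝ) < S.s i := by exact_mod_cast S.s_pos i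
  have hl : (0 : ℝ) < (S.K ^ i : ℕ) := by exact_mod_cast pow_pos S.K_pos i
  have hK : (4 : ℝ) ≤ S.K := by exact_mod_cast S.four_le_K
  have hD : (2 : ℝ) ≤ S.D := by rw [D_eq']; nlinarith
  have h1 := norm_sq_le_rsm (l := S.K ^ i) (pow_pos S.K_pos i) (3 * S.s i)
    (S.s i * a - 3 * S.s i / 2 : ℤ) (S.ft_mem_spec (B := B) i a hQ) ?_ z
  · refine h1.trans (mul_le_mul_of_nonneg_right ?_ (S.v_nonneg i a z))
    rw [div_le_iff₀ hl]
    have : (S.s i : ℝ) = S.D * (S.K ^ i : ℕ) := by unfold s; push_cast; rfl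
    push_cast at this ⊢
    rw [this]
    push_cast at hl
    nlinarith
  rintro ζ ⟨h2, -⟩
  push_cast at h2
  rw [abs_le] at h2
  have h3 : (S.s i * a : ℝ) - 3 / 2 * S.s i ≤ ζ.1 := by linarith
  have h4 : (ζ.1 : ℝ) ≤ (S.s i * a : ℝ) + 3 / 2 * S.s i := by linarith
  have h5 : 2 * (S.s i * a : ℤ) - 3 * S.s i ≤ 2 * ζ.1 := by
    have : ((2 * (S.s i * a : ℤ) - 3 * S.s i : ℤ) : ℝ) ≤ ((2 * ζ.1 : ℤ) : ℝ) := by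
      push_cast; linarith
    exact_mod_cast this
  have h6 : 4 * ζ.1 ≤ 4 * (S.s i * a : ℤ) + 5 * S.s i := by
    have : ((4 * ζ.1 : ℤ) : ℝ) ≤ ((4 * (S.s i * a : ℤ) + 5 * S.s i : ℤ) : ℝ) := by
      push_cast; linarith
    exact_mod_cast this
  have h7 : -(5 * S.s i : ℤ) ≤ 4 * (ζ.1 - S.s i * a) := by
    have : ((-(5 * S.s i : ℤ) : ℤ) : ℝ) ≤ ((4 * (ζ.1 - S.s i * a) : ℤ) : ℝ) := by
      push_cast; linarith
    exact_mod_cast this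
  have h8 : (0 : ℤ) < S.s i := by exact_mod_cast S.s_pos i
  push_cast
  generalize (S.s i : ℤ) * a = X at *
  omega

theorem P_bounds (i : ℕ) {x : ℝ} (hB : 0 < B) (h0 : 0 ≤ x) (h1 : x ≤ B ^ 2) :
    |S.P B i x| ≤ 1 ∧ (1 ≤ S.h * (S.s i) ^ 2 → S.P B i x ^ 2 * x ≤ B ^ 2 / S.D ^ 2) ∧
      |1 - S.P B i x| ≤ S.D ^ 2 * x / B ^ 2 := by
  have hD : (0 : ℝ) < S.D := by exact_mod_cast S.D_pos
  unfold P
  split_ifs with hp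
  · refine ⟨by simp, fun h => absurd hp (not_lt.2 h), ?_⟩
    simp only [sub_self, abs_zero]
    positivity
  · have hu0 : 0 ≤ x / B ^ 2 := by positivity
    have hu1 : x / B ^ 2 ≤ 1 := by rw [div_le_one (by positivity)]; exact h1
    obtain ⟨h2, h3, h4⟩ := cheb_bounds S.e hu0 hu1
    rw [← D_eq] at h2 h4
    refine ⟨?_, fun _ => ?_, ?_⟩
    · rw [abs_div, abs_of_pos hD, div_le_one hD]; exact h2
    · rw [div_pow, le_div_iff₀ (by positivity)]
      have : cheb S.e (x / B ^ 2) ^ 2 / S.D ^ 2 * x * S.D ^ 2 =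
          cheb S.e (x / B ^ 2) ^ 2 * (x / B ^ 2) * B ^ 2 := by field_simp
      rw [this]
      nlinarith [sq_nonneg B]
    · have : 1 - cheb S.e (x / B ^ 2) / S.D = (S.D - cheb S.e (x / B ^ 2)) / S.D := by
        field_simp
      rw [this, abs_div, abs_of_pos hD, div_le_iff₀ hD]
      refine h4.trans (le_of_eq ?_)
      ring

theorem norm_ft_le (hB : 0 < B) (hDB : (S.D : ℝ) ^ 2 ≤ S.h * B ^ 2) (i a : ℕ)
    (hQ : 4 * S.s i ≤ Q) :
    (∀ z, ‖S.ft Q B i a z‖ ≤ B) ∧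
      ((i = 0 ∨ ∃ j, i = j + 1 ∧ S.h * (S.s j) ^ 2 < 1) → ∀ z, ‖S.ft Q B i a z‖ ≤ S.s i) := by
  have hD : (0 : ℝ) < S.D := by exact_mod_cast S.D_pos
  have hK : (4 : ℝ) ≤ S.K := by exact_mod_cast S.four_le_K
  have hh := S.h_pos
  induction i generalizing a with
  | zero =>
    have h1 : ∀ z, ‖S.ft Q B 0 a z‖ ≤ S.D := by
      intro z
      refine (norm_sum_le _ _).trans ?_
      refine (Finset.sum_le_card_nsmul _ _ 1 fun r _ => ?_).trans (by simp)
      rw [norm_mul, norm_chr, mul_one]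
      exact S.norm_b_le _
    have h2 : (S.D : ℝ) ≤ B := by
      refine le_of_sq_le_sq ?_ hB.le |>.trans le_rfl
      nlinarith [S.h_le_one, sq_nonneg B]
    refine ⟨fun z => (h1 z).trans h2, fun _ z => ?_⟩
    simpa [s] using h1 z
  | succ i ih =>
    have hQ' : 4 * S.s i ≤ Q := (Nat.mul_le_mul_left 4 (S.s_mono (Nat.le_succ i))).trans hQ
    have hlQ : S.K ^ i ≤ Q := by have := S.pow_le_s i; omega
    by_cases hp : S.h * (S.s i : ℝ) ^ 2 < 1
    · have h1 : ∀ z, ‖S.ft Q B (i + 1) a z‖ ≤ S.s (i + 1) := by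
        intro z
        rw [ft_succ]
        refine (norm_sum_le _ _).trans ?_
        refine (Finset.sum_le_card_nsmul _ _ (S.s i : ℝ) fun r _ => ?_).trans ?_
        · have : S.fp Q B i (S.K * a + r) z = S.ft Q B i (S.K * a + r) z := by
            simp [fp, P, hp]
          rw [this]
          refine (ih _ hQ').2 ?_ z
          rcases i with - | i
          · exact Or.inl rfl
          · refine Or.inr ⟨i, rfl, lt_of_le_of_lt ?_ hp⟩
            have : (S.s i : ℝ) ≤ S.s (i + 1) := by exact_mod_cast S.s_mono (Nat.le_succ i)
            gcongr
        · rw [Finset.card_range, nsmul_eq_mul, s_succ]; push_cast; rfl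
      have h2 : (S.s (i + 1) : ℝ) ≤ B := by
        rw [s_succ]; push_cast
        refine le_of_sq_le_sq ?_ hB.le
        have h3 : S.h * (S.K * S.s i) ^ 2 ≤ S.h * B ^ 2 := by
          have h4 : (S.K : ℝ) ≤ S.D := by rw [D_eq']; nlinarith
          have h5 : (S.K : ℝ) ^ 2 ≤ S.D ^ 2 := by gcongr
          have : S.h * (S.K * S.s i : ℝ) ^ 2 = S.K ^ 2 * (S.h * S.s i ^ 2) := by ring
          nlinarith
        exact le_of_mul_le_mul_left h3 hh
      exact ⟨fun z => (h1 z).trans h2, fun _ => h1⟩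
    · refine ⟨?_, ?_⟩
      · intro z
        rw [ft_succ]
        refine (norm_sum_le _ _).trans ?_
        have h1 : ∀ r ∈ range S.K, ‖S.fp Q B i (S.K * a + r) z‖ ≤ B / S.K := by
          intro r _
          set a' := S.K * a + r
          have hv : S.v Q B i a' z ≤ B ^ 2 := by
            refine rsm_le_const (pow_pos S.K_pos i) hlQ (fun z => ?_) z
            exact pow_le_pow_left₀ (norm_nonneg _) ((ih a' hQ').1 z) 2
          obtain ⟨h2, h3, h4⟩ := S.P_bounds i hB (S.v_nonneg i a' z) hv
          have h5 := S.norm_ft_sq_le (B := B) i a' hQ' z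
          refine le_of_sq_le_sq ?_ (by positivity)
          unfold fp
          rw [norm_mul, mul_pow, Complex.norm_real, Real.norm_eq_abs, sq_abs]
          calc ‖S.ft Q B i a' z‖ ^ 2 * S.P B i (S.v Q B i a' z) ^ 2
              ≤ (5 * S.D * S.v Q B i a' z) * S.P B i (S.v Q B i a' z) ^ 2 := by gcongr
            _ = 5 * S.D * (S.P B i (S.v Q B i a' z) ^ 2 * S.v Q B i a' z) := by ring
            _ ≤ 5 * S.D * (B ^ 2 / S.D ^ 2) := by gcongr; exact h3 (not_lt.1 hp)
            _ = 5 * B ^ 2 / S.D := by field_simp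
            _ ≤ (B / S.K) ^ 2 := by
              rw [div_pow, div_le_div_iff₀ hD (by positivity), D_eq']
              nlinarith [sq_nonneg B]
        refine (Finset.sum_le_card_nsmul _ _ _ h1).trans (le_of_eq ?_)
        rw [Finset.card_range, nsmul_eq_mul]; field_simp
      · rintro (h | ⟨j, hj, h⟩)
        · omega
        · obtain rfl : i = j := by omega
          exact absurd h hp

theorem v_le (hB : 0 < B) (hDB : (S.D : ℝ) ^ 2 ≤ S.h * B ^ 2) (i a : ℕ)
    (hQ : 4 * S.s i ≤ Q) (z : ZMod Q × ZMod Q) : S.v Q B i a z ≤ B ^ 2 := by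
  have hlQ : S.K ^ i ≤ Q := by have := S.pow_le_s i; omega
  refine rsm_le_const (pow_pos S.K_pos i) hlQ (fun z => ?_) z
  exact pow_le_pow_left₀ (norm_nonneg _) ((S.norm_ft_le hB hDB i a hQ).1 z) 2

theorem norm_fp_le (hB : 0 < B) (hDB : (S.D : ℝ) ^ 2 ≤ S.h * B ^ 2) (i a : ℕ)
    (hQ : 4 * S.s i ≤ Q) (z : ZMod Q × ZMod Q) : ‖S.fp Q B i a z‖ ≤ ‖S.ft Q B i a z‖ := by
  obtain ⟨h2, -, -⟩ := S.P_bounds i hB (S.v_nonneg i a z) (S.v_le hB hDB i a hQ z)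
  unfold fp
  rw [norm_mul, Complex.norm_real, Real.norm_eq_abs]
  exact mul_le_of_le_one_right (norm_nonneg _) h2

theorem norm_ft_sub_fp_le (hB : 0 < B) (hDB : (S.D : ℝ) ^ 2 ≤ S.h * B ^ 2) (i a : ℕ)
    (hQ : 4 * S.s i ≤ Q) (z : ZMod Q × ZMod Q) :
    ‖S.ft Q B i a z - S.fp Q B i a z‖ ≤ S.D ^ 2 * S.v Q B i a z / B := by
  obtain ⟨-, -, h4⟩ := S.P_bounds i hB (S.v_nonneg i a z) (S.v_le hB hDB i a hQ z)
  have h1 : S.ft Q B i a z - S.fp Q B i a z =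
      S.ft Q B i a z * ((1 - S.P B i (S.v Q B i a z) : ℝ) : ℂ) := by
    unfold fp; push_cast; ring
  rw [h1, norm_mul, Complex.norm_real, Real.norm_eq_abs]
  calc _ ≤ B * (S.D ^ 2 * S.v Q B i a z / B ^ 2) := by
        gcongr
        exact (S.norm_ft_le hB hDB i a hQ).1 z
    _ = _ := by field_simp

end Setup

theorem sum_Ico_mul_eq {M : Type*} [AddCommMonoid M] (K A B : ℕ) (f : ℕ → M) :
    ∑ n ∈ Ico (A * K) (B * K), f n = ∑ a ∈ Ico A B, ∑ r ∈ range K, f (K * a + r) := by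
  rcases le_total B A with h | h
  · rw [Finset.Ico_eq_empty_of_le h, Finset.Ico_eq_empty_of_le (Nat.mul_le_mul_right K h)]; simp
  induction B, h using Nat.le_induction with
  | base => simp
  | succ B hB ih =>
    rw [Finset.sum_Ico_succ_top hB, ← ih, add_mul, one_mul,
      ← Finset.sum_Ico_consecutive f (Nat.mul_le_mul_right K hB) (Nat.le_add_right _ _)]
    congr 1
    rw [Finset.sum_Ico_eq_sum_range]
    simp [mul_comm]

/-- A self-improving bound for damped quantities. -/
theorem mul_one_sub_pow_le {x : ℝ} (h0 : 0 ≤ x) (h1 : x ≤ 1) {k : ℕ} (hk : 0 < k) :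
    x * (1 - x) ^ k ≤ 1 / k := by
  have hk' : (0 : ℝ) < k := by exact_mod_cast hk
  have h2 : 1 + k * x ≤ (1 + x) ^ k := one_add_mul_le_pow (by linarith) k
  have h3 : (1 - x) ^ k * (1 + x) ^ k ≤ 1 := by
    rw [← mul_pow]
    exact pow_le_one₀ (by nlinarith) (by nlinarith)
  have h4 : 0 ≤ (1 - x) ^ k := pow_nonneg (by linarith) k
  rw [le_div_iff₀ hk']
  nlinarith [mul_le_mul_of_nonneg_left h2 h4]

namespace Setup

variable (S : Setup) (Q : ℕ) [NeZero Q] (B : ℝ)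

/-- Indices of the level `i` blocks inside the block `a` of level `j`. -/
def idx (j a i : ℕ) : Finset ℕ := Ico (a * S.K ^ (j - i)) ((a + 1) * S.K ^ (j - i))

theorem idx_self (j a : ℕ) : S.idx j a j = {a} := by
  simp [idx]

theorem sum_idx {M : Type*} [AddCommMonoid M] {j i : ℕ} (a : ℕ) (hij : i + 1 ≤ j) (f : ℕ → M) :
    ∑ n ∈ S.idx j a i, f n = ∑ a' ∈ S.idx j a (i + 1), ∑ r ∈ range S.K, f (S.K * a' + r) := by
  unfold idx
  have : j - i = (j - (i + 1)) + 1 := by omega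
  rw [this, pow_succ, ← mul_assoc, ← mul_assoc, sum_Ico_mul_eq]

/-- Children decomposition. -/
theorem sum_idx_children {M : Type*} [AddCommMonoid M] {j i : ℕ} (a : ℕ) (hij : i ≤ j)
    (f : ℕ → M) :
    ∑ n ∈ S.idx (j + 1) a i, f n = ∑ r ∈ range S.K, ∑ n ∈ S.idx j (S.K * a + r) i, f n := by
  induction hij using Nat.decreasingInduction generalizing f with
  | self =>
    rw [S.sum_idx a le_rfl]
    simp [idx_self]
  | of_succ i hi ih =>
    rw [S.sum_idx a (by omega), ih]
    exact Finset.sum_congr rfl fun r _ => (S.sum_idx _ (by omega) f).symm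

/-- Square sum of the coefficients over a block. -/
noncomputable def m (j a : ℕ) : ℝ := ∑ a' ∈ S.idx j a 0, ∑ r ∈ range S.D, ‖S.b (S.D * a' + r)‖ ^ 2

/-- Smoothed square function of a block. -/
noncomputable def T (j a i : ℕ) (z : ZMod Q × ZMod Q) : ℝ := ∑ a' ∈ S.idx j a i, S.v Q B i a' z

/-- Square function of a block. -/
noncomputable def Sq (j a i : ℕ) (z : ZMod Q × ZMod Q) : ℝ :=
  ∑ a' ∈ S.idx j a i, ‖S.ft Q B i a' z‖ ^ 2

/-- High-frequency part of the smoothed square function at level `i + 1`. -/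
noncomputable def H (j a i : ℕ) (z : ZMod Q × ZMod Q) : ℝ :=
  S.T Q B j a (i + 1) z - rsm (S.K ^ i) (S.Sq Q B j a (i + 1)) z

/-- Pruned sum over a block. -/
noncomputable def F (j a i : ℕ) (z : ZMod Q × ZMod Q) : ℂ := ∑ a' ∈ S.idx j a i, S.ft Q B i a' z

/-- Damping weights. -/
noncomputable def ω (j a : ℕ) : ℕ → ZMod Q × ZMod Q → ℝ
  | 0, _ => 1
  | i + 1, z => ω j a i z *
      (1 - ω j a i z * S.T Q B j a (i + 1) z / (9 * S.K * 36 ^ i * S.m j a)) ^ S.k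

variable {Q B}

theorem m_nonneg (j a : ℕ) : 0 ≤ S.m j a := by unfold m; positivity

theorem T_nonneg (j a i : ℕ) (z : ZMod Q × ZMod Q) : 0 ≤ S.T Q B j a i z :=
  Finset.sum_nonneg fun a' _ => S.v_nonneg i a' z

theorem Sq_nonneg (j a i : ℕ) (z : ZMod Q × ZMod Q) : 0 ≤ S.Sq Q B j a i z :=
  Finset.sum_nonneg fun _ _ => sq_nonneg _

theorem Sq_le (j a i : ℕ) (hQ : 4 * S.s i ≤ Q) (z : ZMod Q × ZMod Q) :
    S.Sq Q B j a i z ≤ 5 * S.D * S.T Q B j a i z := by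
  unfold Sq T
  rw [Finset.mul_sum]
  exact Finset.sum_le_sum fun a' _ => S.norm_ft_sq_le i a' hQ z

theorem v_zero_le (a : ℕ) (hQ : 4 * S.s 0 ≤ Q) (z : ZMod Q × ZMod Q) :
    S.v Q B 0 a z ≤ ∑ r ∈ range S.D, ‖S.b (S.D * a + r)‖ ^ 2 := by
  have hs : S.s 0 = S.D := by simp [s]
  have hD := S.D_pos
  have h := rsm_norm_sum_sq_le (Q := Q) 1 (range S.D)
    (fun r => S.b (S.D * a + r) • chr Q ((S.D * a + r : ℕ), S.G (S.D * a + r)))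
    (fun r => {(((S.D * a + r : ℕ) : ℤ), S.G (S.D * a + r))})
    (fun r _ => Submodule.smul_mem _ _ (chr_mem_spec rfl)) (fun r r' => r = r')
    (fun _ _ _ _ h => h.symm) 1 ?_ ?_ z
  · have h1 : S.v Q B 0 a z = rsm 1 (fun z => ‖∑ r ∈ range S.D, (S.b (S.D * a + r) •
        chr Q ((S.D * a + r : ℕ), S.G (S.D * a + r))) z‖ ^ 2) z := by
      simp [v, ft]
    rw [h1]
    refine h.trans ?_
    rw [one_mul]
    refine Finset.sum_le_sum fun r _ => ?_
    refine rsm_le_const one_pos (by omega) (fun z => ?_) z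
    simp [norm_chr]
  · intro r hr
    simp [Finset.filter_eq, hr]
  · rintro r hr r' hr' hne ζ rfl ζ' rfl
    simp only [Finset.mem_range] at hr hr'
    refine lam_eq_zero ?_ ?_ <;> push_cast <;> rw [add_sub_add_left_eq_sub] <;>
      rcases abs_cases ((r : ℤ) - r') with h | h <;> omega

theorem T_zero_le (j a : ℕ) (hQ : 4 * S.s 0 ≤ Q) (z : ZMod Q × ZMod Q) :
    S.T Q B j a 0 z ≤ S.m j a :=
  Finset.sum_le_sum fun a' _ => S.v_zero_le a' hQ z

theorem rsm_ft_succ_le (hB : 0 < B) (hDB : (S.D : ℝ) ^ 2 ≤ S.h * B ^ 2) (i a : ℕ)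
    (hQ : 4 * S.s (i + 1) ≤ Q) (z : ZMod Q × ZMod Q) :
    rsm (S.K ^ i) (fun z => ‖S.ft Q B (i + 1) a z‖ ^ 2) z ≤
      9 * ∑ r ∈ range S.K, S.v Q B i (S.K * a + r) z := by
  have hQ' : 4 * S.s i ≤ Q := (Nat.mul_le_mul_left 4 (S.s_mono (Nat.le_succ i))).trans hQ
  have hs : (0 : ℝ) < S.s i := by exact_mod_cast S.s_pos i
  have hl : ((S.K ^ i : ℕ) : ℝ) ≤ S.s i := by exact_mod_cast S.pow_le_s i
  have hQr : (4 * (S.K * S.s i) : ℝ) ≤ Q := by rw [s_succ] at hQ; exact_mod_cast hQ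
  have hK : (4 : ℝ) ≤ S.K := by exact_mod_cast S.four_le_K
  have h := rsm_norm_sum_sq_le (Q := Q) (S.K ^ i) (range S.K)
    (fun r => S.fp Q B i (S.K * a + r)) _ (fun r _ => S.fp_mem_spec i _ hQ')
    (fun r r' => r ≤ r' + 4 ∧ r' ≤ r + 4) (fun _ _ _ _ h => h.symm) 9 ?_ ?_ z
  · simp only [ft_succ]
    refine h.trans ?_
    gcongr with r _
    refine rsm_mono _ (fun z => ?_) z
    exact pow_le_pow_left₀ (norm_nonneg _) (S.norm_fp_le hB hDB i _ hQ' z) 2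
  · intro r _
    have h1 : (range S.K).filter (fun r' => r ≤ r' + 4 ∧ r' ≤ r + 4) ⊆ Icc (r - 4) (r + 4) := by
      intro x hx
      simp only [Finset.mem_filter, Finset.mem_Icc] at hx ⊢
      omega
    have h2 := Finset.card_le_card h1
    rw [Nat.card_Icc] at h2
    have h3 : r + 4 + 1 - (r - 4) ≤ 9 := by omega
    exact_mod_cast h2.trans h3
  · rintro r hr r' hr' hne ζ ⟨h1, -⟩ ζ' ⟨h2, -⟩
    simp only [Finset.mem_range] at hr hr'
    push_cast at h1 h2
    rw [abs_le] at h1 h2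
    have hr1 : (r : ℝ) + 1 ≤ S.K := by exact_mod_cast hr
    have hr2 : (r' : ℝ) + 1 ≤ S.K := by exact_mod_cast hr'
    have hr3 : (0 : ℝ) ≤ r := Nat.cast_nonneg r
    have hr4 : (0 : ℝ) ≤ r' := Nat.cast_nonneg r'
    have e1 : ∀ x : ℝ, (S.s i : ℝ) * (S.K * a + x) = S.s i * (S.K * a) + S.s i * x := fun x => by
      ring
    rw [e1] at h1 h2
    have key : (S.s i : ℝ) ≤ |(ζ.1 : ℝ) - ζ'.1| := by
      have h5 : r' + 5 ≤ r ∨ r + 5 ≤ r' := by omega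
      rcases h5 with h5 | h5
      · have h6 : (r' : ℝ) + 5 ≤ r := by exact_mod_cast h5
        have := mul_le_mul_of_nonneg_left h6 hs.le
        refine le_trans ?_ (le_abs_self _)
        linarith [h1.1, h2.2]
      · have h6 : (r : ℝ) + 5 ≤ r' := by exact_mod_cast h5
        have := mul_le_mul_of_nonneg_left h6 hs.le
        refine le_trans ?_ (neg_le_abs _)
        linarith [h2.1, h1.2]
    have key2 : |(ζ.1 : ℝ) - ζ'.1| ≤ S.K * S.s i + 4 * S.s i := by
      have h7 := mul_le_mul_of_nonneg_left (by linarith : (r : ℝ) ≤ S.K) hs.le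
      have h8 := mul_le_mul_of_nonneg_left (by linarith : (r' : ℝ) ≤ S.K) hs.le
      have h9 := mul_nonneg hs.le hr3
      have h10 := mul_nonneg hs.le hr4
      rw [abs_le]
      constructor <;> linarith [h1.1, h1.2, h2.1, h2.2]
    refine lam_eq_zero ?_ ?_
    · have : (((S.K ^ i : ℕ) : ℤ) : ℝ) ≤ ((|ζ.1 - ζ'.1| : ℤ) : ℝ) := by
        push_cast at hl ⊢; linarith
      exact_mod_cast this
    · have : ((|ζ.1 - ζ'.1| + (S.K ^ i : ℕ) : ℤ) : ℝ) ≤ ((Q : ℤ) : ℝ) := by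
        push_cast at hl ⊢; nlinarith
      exact_mod_cast this

theorem rsm_Sq_succ_le (hB : 0 < B) (hDB : (S.D : ℝ) ^ 2 ≤ S.h * B ^ 2) {j i : ℕ} (a : ℕ)
    (hij : i + 1 ≤ j) (hQ : 4 * S.s (i + 1) ≤ Q) (z : ZMod Q × ZMod Q) :
    rsm (S.K ^ i) (S.Sq Q B j a (i + 1)) z ≤ 9 * S.T Q B j a i z := by
  unfold T
  rw [S.sum_idx a hij, Finset.mul_sum]
  have h := rsm_sum (S.K ^ i) (S.idx j a (i + 1)) (fun a' z => ‖S.ft Q B (i + 1) a' z‖ ^ 2) z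
  refine h.trans_le (Finset.sum_le_sum fun a' _ => S.rsm_ft_succ_le hB hDB i a' hQ z)

theorem T_eq_rsm (j a i : ℕ) (z : ZMod Q × ZMod Q) :
    S.T Q B j a i z = rsm (S.K ^ i) (S.Sq Q B j a i) z :=
  (rsm_sum (S.K ^ i) (S.idx j a i) (fun a' z => ‖S.ft Q B i a' z‖ ^ 2) z).symm

theorem T_succ_le (hB : 0 < B) (hDB : (S.D : ℝ) ^ 2 ≤ S.h * B ^ 2) {j i : ℕ} (a : ℕ)
    (hij : i + 1 ≤ j) (hQ : 4 * S.s (i + 1) ≤ Q) (z : ZMod Q × ZMod Q) :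
    S.T Q B j a (i + 1) z ≤ 9 * S.K * S.T Q B j a i z := by
  have h1 := S.rsm_Sq_succ_le hB hDB a hij hQ z
  rw [T_eq_rsm, pow_succ', show (9 : ℝ) * S.K * S.T Q B j a i z = S.K * (9 * S.T Q B j a i z) by ring]
  refine (rsm_mul_le S.K_pos (S.Sq_nonneg j a (i + 1)) z).trans ?_
  gcongr

theorem sum_T_eq {i : ℕ} (j a : ℕ) (hQ : 4 * S.s i ≤ Q) :
    ∑ z, S.T Q B j a i z = ∑ z, S.Sq Q B j a i z := by
  have hlQ : S.K ^ i ≤ Q := by have := S.pow_le_s i; omega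
  rw [← sum_rsm (pow_pos S.K_pos i) hlQ (S.Sq Q B j a i)]
  exact Finset.sum_congr rfl fun z _ => S.T_eq_rsm j a i z

theorem sum_T_le (hB : 0 < B) (hDB : (S.D : ℝ) ^ 2 ≤ S.h * B ^ 2) {j i : ℕ} (a : ℕ)
    (hij : i ≤ j) (hQ : 4 * S.s i ≤ Q) : ∑ z, S.T Q B j a i z ≤ 9 ^ i * (Q ^ 2 * S.m j a) := by
  induction i with
  | zero =>
    refine (Finset.sum_le_card_nsmul _ _ _ fun z _ => S.T_zero_le j a hQ z).trans (le_of_eq ?_)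
    simp [ZMod.card, sq]
  | succ i ih =>
    have hQ' : 4 * S.s i ≤ Q := (Nat.mul_le_mul_left 4 (S.s_mono (Nat.le_succ i))).trans hQ
    have hlQ : S.K ^ i ≤ Q := by have := S.pow_le_s i; omega
    rw [S.sum_T_eq j a hQ, ← sum_rsm (pow_pos S.K_pos i) hlQ]
    refine (Finset.sum_le_sum fun z _ => S.rsm_Sq_succ_le hB hDB a hij hQ z).trans ?_
    rw [← Finset.mul_sum, pow_succ]
    linarith [ih (by omega) hQ']

theorem H_ge (hB : 0 < B) (hDB : (S.D : ℝ) ^ 2 ≤ S.h * B ^ 2) {j i : ℕ} (a : ℕ)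
    (hij : i + 1 ≤ j) (hQ : 4 * S.s (i + 1) ≤ Q) (z : ZMod Q × ZMod Q)
    (h1 : S.T Q B j a i z ≤ 18 ^ i * S.m j a)
    (h2 : 18 ^ (i + 1) * S.m j a < S.T Q B j a (i + 1) z) : S.m j a ≤ S.H Q B j a i z := by
  have h3 := S.rsm_Sq_succ_le hB hDB a hij hQ z
  have h4 : S.m j a ≤ 18 ^ i * S.m j a :=
    le_mul_of_one_le_left (S.m_nonneg j a) (one_le_pow₀ (by norm_num))
  have h5 := S.m_nonneg j a
  unfold H
  rw [pow_succ] at h2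
  linarith

/-! ### Weights -/

theorem ω_bounds (hB : 0 < B) (hDB : (S.D : ℝ) ^ 2 ≤ S.h * B ^ 2) {j i : ℕ} (a : ℕ)
    (hij : i ≤ j) (hQ : 4 * S.s i ≤ Q) (hm : 0 < S.m j a) (z : ZMod Q × ZMod Q) :
    0 ≤ S.ω Q B j a i z ∧ S.ω Q B j a i z ≤ 1 ∧
      S.ω Q B j a i z * S.T Q B j a i z ≤ 36 ^ i * S.m j a := by
  induction i with
  | zero => simpa [ω] using S.T_zero_le (B := B) j a hQ z
  | succ i ih =>
    have hQ' : 4 * S.s i ≤ Q := (Nat.mul_le_mul_left 4 (S.s_mono (Nat.le_succ i))).trans hQ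
    obtain ⟨h1, h2, h3⟩ := ih (by omega) hQ'
    have hK : (0 : ℝ) < S.K := by exact_mod_cast S.K_pos
    have hk : (0 : ℝ) < S.k := by exact_mod_cast S.k_pos
    have hU : 0 < 9 * S.K * 36 ^ i * S.m j a := by positivity
    set U := 9 * S.K * 36 ^ i * S.m j a with hUdef
    set x := S.ω Q B j a i z * S.T Q B j a (i + 1) z / U with hx
    have hT := S.T_succ_le hB hDB a hij hQ z
    have hx0 : 0 ≤ x := by
      have := S.T_nonneg (Q := Q) (B := B) j a (i + 1) z
      positivity
    have hx1 : x ≤ 1 := by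
      rw [hx, div_le_one hU, hUdef]
      calc S.ω Q B j a i z * S.T Q B j a (i + 1) z
          ≤ S.ω Q B j a i z * (9 * S.K * S.T Q B j a i z) := by gcongr
        _ = 9 * S.K * (S.ω Q B j a i z * S.T Q B j a i z) := by ring
        _ ≤ 9 * S.K * (36 ^ i * S.m j a) := by gcongr
        _ = _ := by ring
    have hω : S.ω Q B j a (i + 1) z = S.ω Q B j a i z * (1 - x) ^ S.k := rfl
    have hp0 : 0 ≤ (1 - x) ^ S.k := pow_nonneg (by linarith) _
    have hp1 : (1 - x) ^ S.k ≤ 1 := pow_le_one₀ (by linarith) (by linarith)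
    rw [hω]
    refine ⟨mul_nonneg h1 hp0, mul_le_one₀ h2 hp0 hp1, ?_⟩
    have h4 : S.ω Q B j a i z * (1 - x) ^ S.k * S.T Q B j a (i + 1) z =
        U * (x * (1 - x) ^ S.k) := by
      rw [hx]; field_simp
    rw [h4]
    refine (mul_le_mul_of_nonneg_left (mul_one_sub_pow_le hx0 hx1 S.k_pos) hU.le).trans
      (le_of_eq ?_)
    have : (S.K : ℝ) = 4 * S.k := by unfold K; push_cast; ring
    rw [hUdef, this, pow_succ]; field_simp; norm_num

theorem ω_ge (hB : 0 < B) (hDB : (S.D : ℝ) ^ 2 ≤ S.h * B ^ 2) {j i : ℕ} (a : ℕ)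
    (hij : i ≤ j) (hQ : 4 * S.s i ≤ Q) (hm : 0 < S.m j a) (z : ZMod Q × ZMod Q)
    (hT : ∀ l ≤ i, S.T Q B j a l z ≤ 18 ^ l * S.m j a) : (1 / 2) ^ i ≤ S.ω Q B j a i z := by
  induction i with
  | zero => simp [ω]
  | succ i ih =>
    have hQ' : 4 * S.s i ≤ Q := (Nat.mul_le_mul_left 4 (S.s_mono (Nat.le_succ i))).trans hQ
    have h0 := ih (by omega) hQ' fun l hl => hT l (by omega)
    obtain ⟨h1, h2, h3⟩ := S.ω_bounds hB hDB a (by omega : i ≤ j) hQ' hm z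
    have hk : (0 : ℝ) < S.k := by exact_mod_cast S.k_pos
    have hkK : (S.K : ℝ) = 4 * S.k := by unfold K; push_cast; ring
    have hK : (0 : ℝ) < S.K := by exact_mod_cast S.K_pos
    have hU : 0 < 9 * S.K * 36 ^ i * S.m j a := by positivity
    set x := S.ω Q B j a i z * S.T Q B j a (i + 1) z / (9 * S.K * 36 ^ i * S.m j a) with hx
    have hω : S.ω Q B j a (i + 1) z = S.ω Q B j a i z * (1 - x) ^ S.k := rfl
    have hx2 : x ≤ 1 / (2 * S.k) := by
      rw [hx, div_le_iff₀ hU, hkK]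
      have e1 : 1 / (2 * (S.k : ℝ)) * (9 * (4 * S.k) * 36 ^ i * S.m j a) = 18 * 36 ^ i * S.m j a := by
        field_simp; ring
      rw [e1]
      have h4 := hT (i + 1) le_rfl
      have h5 : (18 : ℝ) ^ (i + 1) ≤ 18 * 36 ^ i := by
        rw [pow_succ']; gcongr; norm_num
      have h6 := S.T_nonneg (Q := Q) (B := B) j a (i + 1) z
      calc _ ≤ 1 * S.T Q B j a (i + 1) z := by gcongr
        _ ≤ 18 ^ (i + 1) * S.m j a := by rw [one_mul]; exact h4
        _ ≤ _ := by gcongr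
    have h7 : 1 + S.k * (-x) ≤ (1 + (-x)) ^ S.k := by
      refine one_add_mul_le_pow ?_ _
      have : 1 / (2 * (S.k : ℝ)) ≤ 1 := by
        rw [div_le_one (by positivity)]
        have : (1 : ℝ) ≤ S.k := by exact_mod_cast S.k_pos
        linarith
      linarith
    have h8 : S.k * x ≤ 1 / 2 := by
      calc S.k * x ≤ S.k * (1 / (2 * S.k)) := by gcongr
        _ = 1 / 2 := by field_simp
    have h9 : 1 / 2 ≤ (1 - x) ^ S.k := by
      rw [← sub_eq_add_neg] at h7; linarith
    rw [hω, pow_succ]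
    gcongr

/-! ### Pruning error -/

theorem F_succ {j i : ℕ} (a : ℕ) (hij : i + 1 ≤ j) (z : ZMod Q × ZMod Q) :
    S.F Q B j a (i + 1) z = ∑ a' ∈ S.idx j a i, S.fp Q B i a' z := by
  rw [S.sum_idx a hij]
  rfl

theorem norm_F_sub_le (hB : 0 < B) (hDB : (S.D : ℝ) ^ 2 ≤ S.h * B ^ 2) {j i : ℕ} (a : ℕ)
    (hij : i ≤ j) (hQ : 4 * S.s i ≤ Q) {M : ℝ} (hM : 0 ≤ M) (z : ZMod Q × ZMod Q)
    (hT : ∀ l < i, S.T Q B j a l z ≤ 18 ^ l * M) :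
    ‖S.F Q B j a 0 z - S.F Q B j a i z‖ ≤ 18 ^ i * (S.D ^ 2 * M / B) := by
  induction i with
  | zero => simp; positivity
  | succ i ih =>
    have hQ' : 4 * S.s i ≤ Q := (Nat.mul_le_mul_left 4 (S.s_mono (Nat.le_succ i))).trans hQ
    have h0 := ih (by omega) hQ' fun l hl => hT l (by omega)
    have h1 : ‖S.F Q B j a i z - S.F Q B j a (i + 1) z‖ ≤ 18 ^ i * (S.D ^ 2 * M / B) := by
      rw [S.F_succ a hij]
      unfold F
      rw [← Finset.sum_sub_distrib]
      refine (norm_sum_le _ _).trans ?_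
      refine (Finset.sum_le_sum fun a' _ => S.norm_ft_sub_fp_le hB hDB i a' hQ' z).trans ?_
      rw [← Finset.sum_div, ← Finset.mul_sum]
      have := hT i (by omega)
      calc _ ≤ (S.D : ℝ) ^ 2 * (18 ^ i * M) / B := by
            unfold T at this
            gcongr
        _ = _ := by ring
    have h2 := norm_sub_le_norm_sub_add_norm_sub (S.F Q B j a 0 z) (S.F Q B j a i z)
      (S.F Q B j a (i + 1) z)
    rw [pow_succ]
    have : 0 ≤ (18 : ℝ) ^ i * (S.D ^ 2 * M / B) := by positivity
    linarith

end Setup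

namespace Setup

variable (S : Setup) {Q : ℕ} [NeZero Q] {B : ℝ}

theorem c_mono {n n' : ℕ} (h : n ≤ n') : S.c n ≤ S.c n' := by
  obtain ⟨r, rfl⟩ := Nat.exists_eq_add_of_le h
  have := (S.c_add n r).1
  have h1 := S.h_pos
  have : 0 ≤ S.h * r := by positivity
  linarith

theorem h_mul_le_c_sub {n n' : ℕ} (h : n ≤ n') : S.h * ((n' : ℝ) - n) ≤ S.c n' - S.c n := by
  obtain ⟨r, rfl⟩ := Nat.exists_eq_add_of_le h
  have := (S.c_add n r).1
  push_cast
  rwa [add_sub_cancel_left]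

theorem c_sub_le_mul {n n' : ℕ} (h : n ≤ n') : S.c n' - S.c n ≤ S.C₀ * S.h * ((n' : ℝ) - n) := by
  obtain ⟨r, rfl⟩ := Nat.exists_eq_add_of_le h
  have := (S.c_add n r).2
  push_cast
  rwa [add_sub_cancel_left]

theorem γ_sub_bounds (n r : ℕ) : S.c n * r ≤ S.γ (n + r) - S.γ n ∧
    S.γ (n + r) - S.γ n ≤ S.c (n + r) * r := by
  refine ⟨by linarith [(S.γ_add n r).1], ?_⟩
  induction r with
  | zero => simp
  | succ r ih =>
    have h3 : S.γ (n + (r + 1)) - S.γ (n + r) = S.c (n + r) := rfl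
    have h4 : S.c (n + r) ≤ S.c (n + (r + 1)) := S.c_mono (by omega)
    push_cast
    have h5 := mul_le_mul_of_nonneg_right h4 (Nat.cast_nonneg (α := ℝ) r)
    linarith

/-- Mean slopes lie between the extreme slopes. -/
theorem exists_slope {n n' p q : ℕ} (h1 : p ≤ n) (h2 : p ≤ n') (h3 : n ≤ q) (h4 : n' ≤ q) :
    ∃ μ, S.γ n - S.γ n' = μ * ((n : ℝ) - n') ∧ S.c p ≤ μ ∧ μ ≤ S.c q := by
  wlog h : n' ≤ n generalizing n n'
  · obtain ⟨μ, h5, h6, h7⟩ := this h2 h1 h4 h3 (by omega)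
    exact ⟨μ, by linarith, h6, h7⟩
  obtain ⟨r, rfl⟩ := Nat.exists_eq_add_of_le h
  rcases Nat.eq_zero_or_pos r with rfl | hr
  · exact ⟨S.c p, by simp, le_rfl, S.c_mono (h1.trans h3)⟩
  have hr' : (0 : ℝ) < r := by exact_mod_cast hr
  obtain ⟨h5, h6⟩ := S.γ_sub_bounds n' r
  refine ⟨(S.γ (n' + r) - S.γ n') / r, ?_, ?_, ?_⟩
  · push_cast; field_simp; ring
  · rw [le_div_iff₀ hr']
    exact (mul_le_mul_of_nonneg_right (S.c_mono h2) hr'.le).trans h5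
  · rw [div_le_iff₀ hr']
    exact h6.trans (mul_le_mul_of_nonneg_right (S.c_mono h3) hr'.le)

/-- A size bound controlling all frequencies up to level `J`. -/
noncomputable def Xb (J : ℕ) : ℝ :=
  S.s J + ∑ n ∈ range (S.s J + 1), (|S.γ n| + |S.c n| * S.s J) + S.C₀ * 15 ^ J * (1 + S.h * S.s J ^ 2)

section Xb

variable (J : ℕ)

theorem sum_Xb_nonneg : 0 ≤ ∑ n ∈ range (S.s J + 1), (|S.γ n| + |S.c n| * S.s J) := by
  positivity

theorem thick_nonneg : 0 ≤ S.C₀ * 15 ^ J * (1 + S.h * (S.s J : ℝ) ^ 2) := by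
  have := S.C₀_pos; have := S.h_pos; positivity

theorem s_le_Xb : S.s J ≤ S.Xb J := by
  have := S.sum_Xb_nonneg J; have := S.thick_nonneg J; unfold Xb; linarith

theorem thick_le_Xb : S.C₀ * 15 ^ J * (1 + S.h * (S.s J : ℝ) ^ 2) ≤ S.Xb J := by
  have := S.sum_Xb_nonneg J; have : (0 : ℝ) ≤ S.s J := Nat.cast_nonneg _; unfold Xb; linarith

variable {J}

theorem seq_le_Xb {n : ℕ} (hn : n ≤ S.s J) : |S.γ n| ≤ S.Xb J ∧ |S.c n| * S.s J ≤ S.Xb J := by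
  have h1 : |S.γ n| + |S.c n| * S.s J ≤
      ∑ n ∈ range (S.s J + 1), (|S.γ n| + |S.c n| * S.s J) :=
    Finset.single_le_sum (f := fun n => |S.γ n| + |S.c n| * S.s J) (fun _ _ => by positivity)
      (Finset.mem_range.2 (by omega))
  have h2 := S.thick_nonneg J
  have h3 : 0 ≤ |S.c n| * S.s J := by positivity
  have h4 := abs_nonneg (S.γ n)
  have h5 : (0 : ℝ) ≤ S.s J := Nat.cast_nonneg _
  unfold Xb
  constructor <;> linarith

omit [NeZero Q] in
theorem four_mul_s_le {j : ℕ} (hj : j ≤ J) (hQ : 100 * S.Xb J ≤ Q) : 4 * S.s j ≤ Q := by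
  have h1 := S.s_le_Xb J
  have h2 : (S.s j : ℝ) ≤ S.s J := by exact_mod_cast S.s_mono hj
  have h3 : (0 : ℝ) ≤ S.s j := Nat.cast_nonneg _
  have : (4 * S.s j : ℝ) ≤ Q := by linarith
  exact_mod_cast this

end Xb

theorem s_sub_mul {i j : ℕ} (hij : i ≤ j) : S.s i * S.K ^ (j - i) = S.s j := by
  unfold s; rw [mul_assoc, ← pow_add, Nat.add_sub_cancel' hij]

theorem mem_idx {j a i a' : ℕ} (hij : i ≤ j) (h : a' ∈ S.idx j a i) :
    S.s j * a ≤ S.s i * a' ∧ S.s i * a' + S.s i ≤ S.s j * a + S.s j := by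
  simp only [idx, Finset.mem_Ico] at h
  have h1 := Nat.mul_le_mul_left (S.s i) h.1
  have h2 := Nat.mul_le_mul_left (S.s i) (Nat.succ_le_of_lt h.2)
  rw [← S.s_sub_mul hij]
  constructor <;> nlinarith

theorem abs_c_sub_le {j a i a' : ℕ} (hij : i ≤ j) (h : a' ∈ S.idx j a i) :
    |S.c (S.s i * a') - S.c (S.s j * a)| ≤ S.C₀ * S.h * S.s j := by
  obtain ⟨h1, h2⟩ := S.mem_idx hij h
  have h3 := S.c_mono h1
  rw [abs_of_nonneg (by linarith)]
  refine (S.c_sub_le_mul h1).trans (mul_le_mul_of_nonneg_left ?_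
    (mul_pos S.C₀_pos S.h_pos).le)
  have h5 : S.s i * a' ≤ S.s j * a + S.s j := by omega
  have h6 : ((S.s i * a' : ℕ) : ℝ) ≤ ((S.s j * a + S.s j : ℕ) : ℝ) := by exact_mod_cast h5
  push_cast at h6 ⊢
  linarith

/-- Thickness of the spectra at level `i` relative to the slope of an ancestor of level `j`. -/
noncomputable def W (j i : ℕ) : ℝ := S.C₀ * 15 ^ i * S.h * S.s j * S.s i

theorem W_pos (j i : ℕ) : 0 < S.W j i := by
  have := S.C₀_pos; have := S.h_pos
  have : (0 : ℝ) < S.s j := by exact_mod_cast S.s_pos j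
  have : (0 : ℝ) < S.s i := by exact_mod_cast S.s_pos i
  unfold W; positivity

theorem W_succ (j i : ℕ) : S.W j (i + 1) = 15 * S.K * S.W j i := by
  unfold W; rw [s_succ]; push_cast; ring

theorem Yt_le_W {j i : ℕ} (hij : i ≤ j) (hj : 1 ≤ S.h * S.s j) : S.Yt i ≤ 2 * S.W j i := by
  have hC := S.C₀_pos
  have hs : (1 : ℝ) ≤ S.s i := by exact_mod_cast S.s_pos i
  have hs' : (S.s i : ℝ) ≤ S.s j := by exact_mod_cast S.s_mono hij
  have h1 : 1 + S.h * (S.s i : ℝ) ^ 2 ≤ 2 * (S.h * S.s j * S.s i) := by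
    have h2 : 1 ≤ S.h * S.s j * S.s i := by nlinarith
    have h3 : S.h * (S.s i : ℝ) ^ 2 ≤ S.h * S.s j * S.s i := by
      rw [sq, ← mul_assoc]
      exact mul_le_mul_of_nonneg_right (mul_le_mul_of_nonneg_left hs' S.h_pos.le) (by linarith)
    linarith
  unfold Yt W
  calc _ ≤ S.C₀ * 15 ^ i * (2 * (S.h * S.s j * S.s i)) := by gcongr
    _ = _ := by ring

theorem slope_le_W (j i : ℕ) : S.C₀ * S.h * S.s j * S.s i ≤ S.W j i := by
  have h1 : (1 : ℝ) ≤ 15 ^ i := one_le_pow₀ (by norm_num)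
  have h2 : 0 ≤ S.C₀ * S.h * S.s j * S.s i := by
    have := S.C₀_pos; have := S.h_pos; positivity
  unfold W
  nlinarith

variable (Q B) in
/-- Wave packets in the coordinates of an ancestor. -/
theorem ft_mem_box {j a i a' : ℕ} (hij : i ≤ j) (hj : 1 ≤ S.h * S.s j) (ha : a' ∈ S.idx j a i)
    (hQ : 4 * S.s i ≤ Q) : S.ft Q B i a' ∈ spec Q (box ((S.s i * a' : ℕ) : ℝ) (S.γ (S.s i * a'))
      (S.c (S.s j * a)) (5 / 4 * S.s i) (4 * S.W j i)) := by
  refine spec_mono (box_change (by simp) ?_) (S.ft_mem_spec i a' hQ)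
  have h1 := S.abs_c_sub_le hij ha
  have h2 := S.Yt_le_W hij hj
  have h3 := S.slope_le_W j i
  have hW := S.W_pos j i
  have h4 := mul_le_mul_of_nonneg_right h1 (by positivity : (0 : ℝ) ≤ 5 / 4 * S.s i)
  simp only [sub_self, mul_zero, abs_zero]
  linarith

variable (Q B) in
theorem T_mem_box {j a i : ℕ} (hij : i ≤ j) (hj : 1 ≤ S.h * S.s j) (hQ : 4 * S.s i ≤ Q) :
    (fun z => (S.T Q B j a i z : ℂ)) ∈ spec Q (box 0 0 (S.c (S.s j * a)) (S.K ^ i : ℕ)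
      (5 * S.W j i)) := by
  have h0 : (fun z => (S.T Q B j a i z : ℂ)) =
      ∑ a' ∈ S.idx j a i, fun z => (S.v Q B i a' z : ℂ) := by
    funext z; simp [T]
  rw [h0]
  refine Submodule.sum_mem _ fun a' ha => spec_mono (box_change (by simp) ?_) (S.v_mem_spec i a' hQ)
  have h1 := S.abs_c_sub_le hij ha
  have h2 := S.Yt_le_W hij hj
  have h3 := S.slope_le_W j i
  have hW := S.W_pos j i
  have h5 : ((S.K ^ i : ℕ) : ℝ) ≤ S.s i := by exact_mod_cast S.pow_le_s i
  have h4 := mul_le_mul h1 h5 (by positivity) ((abs_nonneg _).trans h1)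
  simp only [sub_self, mul_zero, abs_zero]
  linarith

variable (Q B) in
theorem ω_mem_box {j a i : ℕ} (hij : i ≤ j) (hj : 1 ≤ S.h * S.s j) (hQ : 4 * S.s i ≤ Q) :
    (fun z => (S.ω Q B j a i z : ℂ)) ∈ spec Q (box 0 0 (S.c (S.s j * a)) (S.K * S.K ^ i : ℕ)
      (5 * S.K * S.W j i)) := by
  induction i with
  | zero =>
    have := S.W_pos j 0
    have h0 : (fun z => (S.ω Q B j a 0 z : ℂ)) = 1 := by funext z; simp [ω]
    rw [h0]
    exact one_mem_box (by positivity) (by positivity)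
  | succ i ih =>
    have hQ' : 4 * S.s i ≤ Q := (Nat.mul_le_mul_left 4 (S.s_mono (Nat.le_succ i))).trans hQ
    have h1 := ih (by omega) hQ'
    have h2 := S.T_mem_box Q B (a := a) hij hj hQ
    have hW := S.W_pos j i
    have hW' := S.W_pos j (i + 1)
    have h3 := mul_mem_box_zero h1 h2
    have h4 : (1 - ((9 * S.K * 36 ^ i * S.m j a : ℝ) : ℂ)⁻¹ •
        ((fun z => (S.ω Q B j a i z : ℂ)) * fun z => (S.T Q B j a (i + 1) z : ℂ))) ∈
        spec Q (box 0 0 (S.c (S.s j * a)) (2 * S.K ^ (i + 1) : ℕ) (10 * S.W j (i + 1))) := by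
      refine Submodule.sub_mem _ (one_mem_box (by positivity) (by positivity))
        (Submodule.smul_mem _ _ (spec_mono (box_mono (le_of_eq ?_) ?_) h3))
      · push_cast; ring
      · rw [W_succ]
        have : 0 ≤ S.K * S.W j i := by positivity
        linarith
    have h5 := mul_mem_box_zero h1 (pow_mem_box_zero h4 S.k)
    have h6 : (fun z => (S.ω Q B j a (i + 1) z : ℂ)) = (fun z => (S.ω Q B j a i z : ℂ)) *
        (1 - ((9 * S.K * 36 ^ i * S.m j a : ℝ) : ℂ)⁻¹ •
        ((fun z => (S.ω Q B j a i z : ℂ)) * fun z => (S.T Q B j a (i + 1) z : ℂ))) ^ S.k := by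
      funext z
      simp only [ω, Pi.mul_apply, Pi.pow_apply, Pi.sub_apply, Pi.one_apply, Pi.smul_apply,
        smul_eq_mul]
      push_cast
      rw [div_eq_inv_mul]
    rw [h6]
    have hk : (1 : ℝ) ≤ S.k := by exact_mod_cast S.k_pos
    have hK : (S.K : ℝ) = 4 * S.k := by unfold K; push_cast; ring
    refine spec_mono (box_mono ?_ ?_) h5
    · push_cast
      have : (0 : ℝ) < (S.K : ℝ) ^ i := by have := S.K_pos; positivity
      have h7 : (S.K : ℝ) ^ (i + 1) = S.K * S.K ^ i := pow_succ' _ _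
      have h8 : 0 < (S.K : ℝ) ^ (i + 1) := by have := S.K_pos; positivity
      rw [h7] at *
      have h9 : (1 + 2 * (S.k : ℝ)) * (S.K * S.K ^ i) ≤ S.K * (S.K * S.K ^ i) :=
        mul_le_mul_of_nonneg_right (by linarith) h8.le
      linarith
    · have h7 := S.W_succ j i
      have h8 : (1 + 10 * (S.k : ℝ)) * S.W j (i + 1) ≤ 5 * S.K * S.W j (i + 1) :=
        mul_le_mul_of_nonneg_right (by linarith) hW'.le
      have : 0 ≤ S.K * S.W j i := by positivity
      linarith

variable (Q B) in
theorem norm_ft_sq_mem_box {i : ℕ} (a' : ℕ) (hQ : 4 * S.s i ≤ Q) :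
    (fun z => ((‖S.ft Q B i a' z‖ ^ 2 : ℝ) : ℂ)) ∈
      spec Q (box 0 0 (S.c (S.s i * a')) (5 / 2 * S.s i) (2 * S.Yt i)) := by
  have h1 := norm_sq_mem_spec (S.ft_mem_spec (B := B) i a' hQ)
  refine spec_mono (fun ζ hζ => ?_) h1
  have h2 := box_sub _ _ _ _ _ _ _ _ _ hζ
  rw [sub_self, sub_self] at h2
  exact box_mono (by linarith) (by linarith) h2

variable (Q B) in
theorem H_mem_box {j a i : ℕ} (hij : i + 1 ≤ j) (hj : 1 ≤ S.h * S.s j)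
    (hQ : 4 * S.s (i + 1) ≤ Q) : (fun z => (S.H Q B j a i z : ℂ)) ∈
      spec Q (box 0 0 (S.c (S.s j * a)) (5 / 2 * S.s (i + 1)) (7 * S.W j (i + 1))) := by
  have hW := S.W_pos j (i + 1)
  have h0 : (fun z => (S.H Q B j a i z : ℂ)) = (fun z => (S.T Q B j a (i + 1) z : ℂ)) -
      fun z => (rsm (S.K ^ i) (S.Sq Q B j a (i + 1)) z : ℂ) := by
    funext z; simp [H]
  rw [h0]
  refine Submodule.sub_mem _ (spec_mono (box_mono ?_ ?_) (S.T_mem_box Q B hij hj hQ)) ?_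
  · have h5 : ((S.K ^ (i + 1) : ℕ) : ℝ) ≤ S.s (i + 1) := by exact_mod_cast S.pow_le_s (i + 1)
    have : (0 : ℝ) ≤ S.s (i + 1) := Nat.cast_nonneg _
    linarith
  · linarith
  · refine spec_mono (Set.sep_subset _ _) (rsm_mem_spec (A := box 0 0 (S.c (S.s j * a))
      (5 / 2 * S.s (i + 1)) (7 * S.W j (i + 1))) ?_)
    have h1 : (fun z => (S.Sq Q B j a (i + 1) z : ℂ)) =
        ∑ a' ∈ S.idx j a (i + 1), fun z => ((‖S.ft Q B (i + 1) a' z‖ ^ 2 : ℝ) : ℂ) := by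
      funext z; simp [Sq]
    rw [h1]
    refine Submodule.sum_mem _ fun a' ha =>
      spec_mono (box_change (by simp) ?_) (S.norm_ft_sq_mem_box Q B a' hQ)
    have h1 := S.abs_c_sub_le hij ha
    have h2 := S.Yt_le_W hij hj
    have h3 := S.slope_le_W j (i + 1)
    have h4 := mul_le_mul_of_nonneg_right h1 (by positivity : (0 : ℝ) ≤ 5 / 2 * S.s (i + 1))
    simp only [sub_self, mul_zero, abs_zero]
    linarith

end Setup

theorem card_near_le (s : Finset ℕ) (a : ℕ) {M : ℝ} (hM : 0 ≤ M) :
    ((s.filter fun b : ℕ => |(a : ℝ) - b| ≤ M).card : ℝ) ≤ 2 * M + 1 := by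
  have h1 : (s.filter fun b : ℕ => |(a : ℝ) - b| ≤ M).card ≤
      (Finset.Icc ((a : ℤ) - ⌊M⌋₊) (a + ⌊M⌋₊)).card := by
    refine Finset.card_le_card_of_injOn (fun b : ℕ => (b : ℤ)) ?_ Nat.cast_injective.injOn
    intro b hb
    simp only [Finset.coe_filter, Set.mem_ofPred_eq, Finset.coe_Icc, Set.mem_Icc] at hb ⊢
    have h2 : |(a : ℤ) - b| ≤ (⌊M⌋₊ : ℤ) := by
      have h3 : ((|(a : ℤ) - b|.toNat : ℕ) : ℝ) ≤ M := by
        have : (((|(a : ℤ) - b|.toNat : ℕ) : ℤ) : ℝ) = |(a : ℝ) - b| := by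
          rw [Int.toNat_of_nonneg (abs_nonneg _)]; push_cast; rfl
        rw [Int.cast_natCast] at this
        rw [this]
        exact hb.2
      have h4 := Nat.le_floor h3
      omega
    rw [abs_le] at h2
    omega
  have h2 : (Finset.Icc ((a : ℤ) - ⌊M⌋₊) (a + ⌊M⌋₊)).card = 2 * ⌊M⌋₊ + 1 := by
    rw [Int.card_Icc]; omega
  rw [h2] at h1
  have h3 := Nat.floor_le hM
  have h4 : ((s.filter fun b : ℕ => |(a : ℝ) - b| ≤ M).card : ℝ) ≤ ((2 * ⌊M⌋₊ + 1 : ℕ) : ℝ) := by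
    exact_mod_cast h1
  push_cast at h4
  linarith

namespace Setup

variable (S : Setup) {Q : ℕ} [NeZero Q] {B : ℝ}

theorem Yt_le_Xb {i J : ℕ} (h : i ≤ J) : S.Yt i ≤ S.Xb J := by
  refine le_trans ?_ (S.thick_le_Xb J)
  have hC := S.C₀_pos
  have hh := S.h_pos
  have hs : (S.s i : ℝ) ≤ S.s J := by exact_mod_cast S.s_mono h
  unfold Yt
  have h2 : (15 : ℝ) ^ i ≤ 15 ^ J := pow_le_pow_right₀ (by norm_num) h
  gcongr

theorem W_le_Xb {i j J : ℕ} (h : i ≤ j) (hj : j ≤ J) : S.W j i ≤ S.Xb J := by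
  refine le_trans ?_ (S.thick_le_Xb J)
  have hC := S.C₀_pos
  have hh := S.h_pos
  have hs : (S.s i : ℝ) ≤ S.s J := by exact_mod_cast S.s_mono (h.trans hj)
  have hs' : (S.s j : ℝ) ≤ S.s J := by exact_mod_cast S.s_mono hj
  have h2 : (15 : ℝ) ^ i ≤ 15 ^ J := pow_le_pow_right₀ (by norm_num) (h.trans hj)
  unfold W
  calc S.C₀ * 15 ^ i * S.h * S.s j * S.s i = S.C₀ * 15 ^ i * (S.h * (S.s j * S.s i)) := by ring
    _ ≤ S.C₀ * 15 ^ J * (S.h * (S.s J * S.s J)) := by gcongr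
    _ ≤ _ := by
      rw [← sq]; gcongr; linarith

theorem Xb_pos (J : ℕ) : 0 < S.Xb J := by
  have := S.s_le_Xb J
  have : (0 : ℝ) < S.s J := by exact_mod_cast S.s_pos J
  linarith

/-- High-frequency estimate at a single frequency. -/
theorem sum_conv_H_sq_le {j a i J : ℕ} (hij : i + 1 ≤ j) (hjJ : j ≤ J)
    (ha : S.s j * a + S.s j ≤ S.s J) (hQ : 100 * S.Xb J ≤ Q) (ξ : ZMod Q) :
    ∑ z, ‖conv (pker ξ) (fun z => (S.H Q B j a i z : ℂ)) z‖ ^ 2 ≤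
      (1 + 8 * S.Yt (i + 1) / (S.h * S.s (i + 1) * (S.K ^ i : ℕ))) *
        ∑ a' ∈ S.idx j a (i + 1), ∑ z,
          ‖conv (pker ξ) (fun z => ((‖S.ft Q B (i + 1) a' z‖ ^ 2 : ℝ) : ℂ)) z‖ ^ 2 := by
  classical
  have hXb := S.Xb_pos J
  have hQ4 : 4 * S.s (i + 1) ≤ Q := S.four_mul_s_le (hij.trans hjJ) hQ
  set g : ℕ → ZMod Q × ZMod Q → ℂ := fun a' z => ((‖S.ft Q B (i + 1) a' z‖ ^ 2 : ℝ) : ℂ) with hg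
  have hgs : ∀ a', g a' ∈ spec Q (box 0 0 (S.c (S.s (i + 1) * a')) (5 / 2 * S.s (i + 1))
      (2 * S.Yt (i + 1))) := fun a' => S.norm_ft_sq_mem_box Q B a' hQ4
  have hSq : (fun z => (S.Sq Q B j a (i + 1) z : ℂ)) = ∑ a' ∈ S.idx j a (i + 1), g a' := by
    funext z; simp [Sq, hg]
  have hH : (fun z => (S.H Q B j a i z : ℂ)) =
      conv (fun u => (fejer Q (S.K ^ (i + 1)) u : ℂ)) (∑ a' ∈ S.idx j a (i + 1), g a') +
      (-1 : ℂ) • conv (fun u => (fejer Q (S.K ^ i) u : ℂ)) (∑ a' ∈ S.idx j a (i + 1), g a') := by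
    funext z
    simp only [H, T_eq_rsm, Complex.ofReal_sub, ofReal_rsm, hSq, Pi.add_apply, Pi.smul_apply,
      smul_eq_mul]
    ring
  have hconv : ∀ z, conv (pker ξ) (fun z => (S.H Q B j a i z : ℂ)) z =
      ((lam Q (S.K ^ (i + 1)) ξ - lam Q (S.K ^ i) ξ : ℝ) : ℂ) *
        ∑ a' ∈ S.idx j a (i + 1), conv (pker ξ) (g a') z := by
    intro z
    rw [hH, conv_add, conv_smul, conv_conv_pker, conv_conv_pker, fcoef_fejer, fcoef_fejer, conv_sum]
    simp only [Pi.add_apply, Pi.smul_apply, smul_eq_mul, Finset.sum_apply]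
    push_cast; ring
  have hs : (0 : ℝ) < S.s (i + 1) := by exact_mod_cast S.s_pos (i + 1)
  have hl : (0 : ℝ) < (S.K ^ i : ℕ) := by exact_mod_cast pow_pos S.K_pos i
  have hh := S.h_pos
  have hY := S.Yt_pos (i + 1)
  have hR : 0 ≤ ∑ a' ∈ S.idx j a (i + 1), ∑ z, ‖conv (pker ξ) (g a') z‖ ^ 2 := by positivity
  by_cases hx : ∃ x₀ : ℤ, |(x₀ : ℝ)| ≤ 5 / 2 * S.s (i + 1) ∧ (x₀ : ZMod Q) = ξ
  swap
  · have h0 : ∀ a', conv (pker ξ) (g a') = 0 := fun a' => by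
      refine conv_eq_zero _ (hgs a') fun ζ hζ => ?_
      rw [fcoef_pker, if_neg]
      intro h
      exact hx ⟨ζ.1, by simpa using hζ.1, h⟩
    refine le_trans (le_of_eq ?_) (mul_nonneg (by positivity) hR)
    simp only [hconv, h0]
    simp
  obtain ⟨x₀, hx₀, rfl⟩ := hx
  have hQs : (400 : ℝ) * S.s (i + 1) ≤ 4 * Q := by
    have h1 := S.s_le_Xb J
    have h2 : (S.s (i + 1) : ℝ) ≤ S.s J := by exact_mod_cast S.s_mono (hij.trans hjJ)
    linarith
  have hspec : ∀ a', conv (pker (x₀ : ZMod Q)) (g a') ∈ spec Q {ζ : ℤ × ℤ | ζ.1 = x₀ ∧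
      |(ζ.2 : ℝ) - S.c (S.s (i + 1) * a') * x₀| ≤ 2 * S.Yt (i + 1)} := by
    intro a'
    refine spec_mono ?_ (conv_mem_spec _ (hgs a'))
    rintro ζ ⟨hζ, hne⟩
    have h1 : (ζ.1 : ZMod Q) = x₀ := by
      by_contra hcon
      exact hne (by rw [fcoef_pker, if_neg hcon])
    have h2 : ζ.1 = x₀ := by
      refine int_eq_of_cast_eq h1 ?_
      have h3 : |(ζ.1 : ℝ) - x₀| < Q := by
        have h4 := hζ.1
        rw [sub_zero] at h4
        have h5 := abs_sub (ζ.1 : ℝ) x₀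
        linarith
      exact_mod_cast h3
    refine ⟨h2, ?_⟩
    have := hζ.2
    rw [h2] at this
    simpa using this
  simp only [hconv, norm_mul, mul_pow, ← Finset.mul_sum]
  rw [Complex.norm_real, Real.norm_eq_abs, sq_abs]
  set μ := lam Q (S.K ^ (i + 1)) (x₀ : ZMod Q) - lam Q (S.K ^ i) (x₀ : ZMod Q) with hμ
  have hlQ : S.K ^ (i + 1) ≤ Q := by have := S.pow_le_s (i + 1); omega
  have hlQ' : S.K ^ i ≤ Q := (Nat.pow_le_pow_right S.K_pos (Nat.le_succ i)).trans hlQ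
  by_cases hx0 : x₀ = 0
  · have : μ = 0 := by
      rw [hμ, hx0, Int.cast_zero, lam_zero (pow_pos S.K_pos _) hlQ,
        lam_zero (pow_pos S.K_pos _) hlQ', sub_self]
    rw [this]
    have : 0 ≤ 8 * S.Yt (i + 1) / (S.h * S.s (i + 1) * (S.K ^ i : ℕ)) := by positivity
    simp only [ne_eq, OfNat.ofNat_ne_zero, not_false_eq_true, zero_pow, zero_mul]
    positivity
  have hxp : 0 < |(x₀ : ℝ)| := by rw [abs_pos]; exact_mod_cast hx0
  have hμ1 : |μ| ≤ 1 := by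
    have h1 := lam_nonneg (Q := Q) (S.K ^ (i + 1)) x₀
    have h2 := lam_nonneg (Q := Q) (S.K ^ i) x₀
    have h3 := lam_le_one hlQ (x₀ : ZMod Q)
    have h4 := lam_le_one hlQ' (x₀ : ZMod Q)
    rw [abs_le]; constructor <;> linarith
  have hμ2 : |μ| ≤ |(x₀ : ℝ)| / (S.K ^ i : ℕ) := by
    have h1 := one_sub_lam_le (Q := Q) (pow_pos S.K_pos (i + 1)) x₀
    have h2 := one_sub_lam_le (Q := Q) (pow_pos S.K_pos i) x₀
    have h3 := lam_le_one hlQ (x₀ : ZMod Q)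
    have h4 := lam_le_one hlQ' (x₀ : ZMod Q)
    have h5 : |(x₀ : ℝ)| / (S.K ^ (i + 1) : ℕ) ≤ |(x₀ : ℝ)| / (S.K ^ i : ℕ) := by
      refine div_le_div_of_nonneg_left hxp.le hl ?_
      exact_mod_cast Nat.pow_le_pow_right S.K_pos (Nat.le_succ i)
    rw [abs_le]; constructor <;> linarith
  set M := 4 * S.Yt (i + 1) / (S.h * S.s (i + 1) * |(x₀ : ℝ)|) with hM
  have hM0 : 0 ≤ M := by positivity
  have hND := sum_norm_sq_le_of_nearly_orthogonal (S.idx j a (i + 1)) (fun _ => 1)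
    (fun _ => zero_le_one) (fun a' => conv (pker (x₀ : ZMod Q)) (g a'))
    (fun a b => |(a : ℝ) - b| ≤ M) (fun a _ b _ h => by rwa [abs_sub_comm] at h)
    (2 * M + 1) (fun a _ => card_near_le _ a hM0) ?_
  · simp only [one_mul] at hND
    refine (mul_le_mul_of_nonneg_left hND (sq_nonneg _)).trans ?_
    rw [← mul_assoc]
    refine mul_le_mul_of_nonneg_right ?_ hR
    have h1 : μ ^ 2 ≤ |μ| := by
      rw [← sq_abs]; nlinarith [abs_nonneg μ]
    have h2 : μ ^ 2 * M ≤ |(x₀ : ℝ)| / (S.K ^ i : ℕ) * M :=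
      mul_le_mul_of_nonneg_right (h1.trans hμ2) hM0
    have h3 : |(x₀ : ℝ)| / (S.K ^ i : ℕ) * M =
        4 * S.Yt (i + 1) / (S.h * S.s (i + 1) * (S.K ^ i : ℕ)) := by
      rw [hM]; field_simp
    have h4 : 8 * S.Yt (i + 1) / (S.h * S.s (i + 1) * (S.K ^ i : ℕ)) =
        2 * (4 * S.Yt (i + 1) / (S.h * S.s (i + 1) * (S.K ^ i : ℕ))) := by ring
    rw [h3] at h2
    rw [h4]
    linarith
  · intro a₁ ha₁ a₂ ha₂ hne
    have h1 := mul_mem_spec (hspec a₁) (conj_mem_spec (hspec a₂))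
    simp only [Complex.ofReal_one, one_mul]
    refine sum_eq_zero_of_mem_spec h1 ?_
    rintro ζ ⟨u, hu, v, hv, rfl⟩ ⟨-, h2⟩
    obtain ⟨hu1, hu2⟩ := hu
    obtain ⟨hv1, hv2⟩ := hv
    simp only [Prod.fst_neg, Prod.snd_neg] at hv1 hv2
    have hc : ∀ a' ∈ S.idx j a (i + 1), |S.c (S.s (i + 1) * a') * x₀| ≤ 3 * S.Xb J := by
      intro a' ha'
      obtain ⟨-, h3⟩ := S.mem_idx hij ha'
      have h4 := (S.seq_le_Xb (by omega : S.s (i + 1) * a' ≤ S.s J)).2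
      rw [abs_mul]
      have h5 : (S.s (i + 1) : ℝ) ≤ S.s J := by exact_mod_cast S.s_mono (hij.trans hjJ)
      have h6 := mul_le_mul_of_nonneg_left (hx₀.trans
        (mul_le_mul_of_nonneg_left h5 (by norm_num))) (abs_nonneg (S.c (S.s (i + 1) * a')))
      linarith
    have hYX := S.Yt_le_Xb (hij.trans hjJ)
    have h3 : u.2 + v.2 = 0 := by
      refine int_eq_zero_of_cast h2 ?_
      have e1 := hc a₁ ha₁
      have e2 := hc a₂ ha₂
      push_cast at hv2 ⊢
      rw [abs_le] at hu2 hv2 e1 e2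
      rw [abs_lt]
      constructor <;> linarith [hu2.1, hu2.2, hv2.1, hv2.2, e1.1, e1.2, e2.1, e2.2]
    have h4 : |S.c (S.s (i + 1) * a₁) - S.c (S.s (i + 1) * a₂)| * |(x₀ : ℝ)| ≤
        4 * S.Yt (i + 1) := by
      have h5 : (u.2 : ℝ) + v.2 = 0 := by exact_mod_cast h3
      rw [← abs_mul]
      push_cast at hv2
      rw [abs_le] at hu2 hv2 ⊢
      constructor <;> linarith [hu2.1, hu2.2, hv2.1, hv2.2]
    apply hne
    rw [hM, le_div_iff₀ (by positivity)]
    have h5 : S.h * (S.s (i + 1) * |(a₁ : ℝ) - a₂|) ≤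
        |S.c (S.s (i + 1) * a₁) - S.c (S.s (i + 1) * a₂)| := by
      rcases le_total a₁ a₂ with h | h
      · have h6 := S.h_mul_le_c_sub (Nat.mul_le_mul_left (S.s (i + 1)) h)
        have h7 : (a₁ : ℝ) ≤ a₂ := by exact_mod_cast h
        rw [abs_sub_comm, abs_of_nonneg (by linarith), abs_sub_comm]
        refine le_trans (le_of_eq ?_) (h6.trans (le_abs_self _))
        push_cast; ring
      · have h6 := S.h_mul_le_c_sub (Nat.mul_le_mul_left (S.s (i + 1)) h)
        have h7 : (a₂ : ℝ) ≤ a₁ := by exact_mod_cast h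
        rw [abs_of_nonneg (by linarith)]
        refine le_trans (le_of_eq ?_) (h6.trans (le_abs_self _))
        push_cast; ring
    have h6 := mul_le_mul_of_nonneg_right h5 hxp.le
    linarith

/-- High-frequency estimate. -/
theorem sum_H_sq_le {j a i J : ℕ} (hij : i + 1 ≤ j) (hjJ : j ≤ J)
    (ha : S.s j * a + S.s j ≤ S.s J) (hQ : 100 * S.Xb J ≤ Q) :
    ∑ z, S.H Q B j a i z ^ 2 ≤
      (1 + 8 * S.Yt (i + 1) / (S.h * S.s (i + 1) * (S.K ^ i : ℕ))) *
        ∑ a' ∈ S.idx j a (i + 1), ∑ z, ‖S.ft Q B (i + 1) a' z‖ ^ 4 := by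
  have h1 := parseval_conv (fun z => (S.H Q B j a i z : ℂ))
  simp only [Complex.norm_real, Real.norm_eq_abs, sq_abs] at h1
  rw [← h1]
  refine (Finset.sum_le_sum fun ξ _ => S.sum_conv_H_sq_le hij hjJ ha hQ ξ).trans ?_
  rw [← Finset.mul_sum, Finset.sum_comm]
  refine le_of_eq ?_
  congr 1
  refine Finset.sum_congr rfl fun a' _ => ?_
  rw [parseval_conv]
  refine Finset.sum_congr rfl fun z _ => ?_
  rw [Complex.norm_real, Real.norm_eq_abs, sq_abs, ← pow_mul]

end Setup

namespace Setup

variable (S : Setup) {Q : ℕ} [NeZero Q] {B : ℝ}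

set_option maxHeartbeats 1000000 in
/-- Bilinear estimate for two separated blocks. -/
theorem sum_bilinear_le {j a i r₁ r₂ J : ℕ} (hij : i + 1 ≤ j) (hjJ : j + 1 ≤ J)
    (hj : 1 ≤ S.h * S.s (j + 1)) (hr₁ : r₁ + 2 ≤ r₂) (hr₂ : r₂ < S.K)
    (ha : S.s (j + 1) * a + S.s (j + 1) ≤ S.s J) (hQ : 100 * S.Xb J ≤ Q) :
    ∑ z, (S.ω Q B (j + 1) a i z * S.H Q B (j + 1) a i z) ^ 2 *
        ‖S.F Q B j (S.K * a + r₁) (i + 1) z * S.F Q B j (S.K * a + r₂) (i + 1) z‖ ^ 2 ≤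
      (200 * S.C₀ * 15 ^ (i + 1) * S.K) ^ 2 *
        ∑ z, (S.ω Q B (j + 1) a i z * S.H Q B (j + 1) a i z) ^ 2 *
          S.Sq Q B (j + 1) a (i + 1) z ^ 2 := by
  classical
  have hij' : i + 1 ≤ j + 1 := by omega
  have hQ4 : 4 * S.s (i + 1) ≤ Q := S.four_mul_s_le (hij.trans (by omega)) hQ
  have hQ4' : 4 * S.s i ≤ Q := S.four_mul_s_le (by omega) hQ
  set t₁ := S.K * a + r₁ with ht₁
  set t₂ := S.K * a + r₂ with ht₂
  set cs := S.c (S.s (j + 1) * a) with hcs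
  set n : ℕ → ℕ := fun x => S.s (i + 1) * x with hn
  have hsub : ∀ r < S.K, S.idx j (S.K * a + r) (i + 1) ⊆ S.idx (j + 1) a (i + 1) := by
    intro r hr x hx
    simp only [idx, Finset.mem_Ico] at hx ⊢
    have e : j + 1 - (i + 1) = (j - (i + 1)) + 1 := by omega
    rw [e, pow_succ]
    constructor
    · nlinarith [hx.1, Nat.zero_le (r * S.K ^ (j - (i + 1)))]
    · have : (S.K * a + r + 1) * S.K ^ (j - (i + 1)) ≤ (S.K * a + S.K) * S.K ^ (j - (i + 1)) :=
        Nat.mul_le_mul_right _ (by omega)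
      nlinarith [hx.2]
  have hC := S.one_le_C₀
  have hK : (4 : ℝ) ≤ S.K := by exact_mod_cast S.four_le_K
  have hh := S.h_pos
  have hs : (0 : ℝ) < S.s (i + 1) := by exact_mod_cast S.s_pos (i + 1)
  have hsj : (0 : ℝ) < S.s j := by exact_mod_cast S.s_pos j
  have hW := S.W_pos (j + 1) (i + 1)
  have hXb := S.Xb_pos J
  have h15 : (1 : ℝ) ≤ 15 ^ (i + 1) := one_le_pow₀ (by norm_num)
  set M := 61 * S.C₀ * 15 ^ (i + 1) * S.K with hM
  have hM244 : 244 ≤ M := by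
    have h1 : 1 ≤ S.C₀ * 15 ^ (i + 1) := by nlinarith
    rw [hM]; nlinarith
  set g : ℕ × ℕ → ZMod Q × ZMod Q → ℂ := fun p z =>
    S.ft Q B (i + 1) p.1 z * S.ft Q B (i + 1) p.2 z with hg
  set s := S.idx j t₁ (i + 1) ×ˢ S.idx j t₂ (i + 1) with hsdef
  have hND := sum_norm_sq_le_of_nearly_orthogonal s
    (fun z => (S.ω Q B (j + 1) a i z * S.H Q B (j + 1) a i z) ^ 2) (fun _ => sq_nonneg _) g
    (fun p p' => |(p.1 : ℝ) - p'.1| ≤ M + 13 ∧ |(p.2 : ℝ) - p'.2| ≤ M + 13)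
    (fun p _ p' _ h => by rwa [abs_sub_comm, abs_sub_comm (p'.2 : ℝ)])
    ((200 * S.C₀ * 15 ^ (i + 1) * S.K) ^ 2) ?_ ?_
  · refine (le_of_eq ?_).trans (hND.trans (mul_le_mul_of_nonneg_left ?_ (sq_nonneg _)))
    · refine Finset.sum_congr rfl fun z _ => ?_
      rw [hsdef, Finset.sum_product, F, F, Finset.sum_mul_sum]
    · rw [Finset.sum_comm]
      refine Finset.sum_le_sum fun z _ => ?_
      rw [← Finset.mul_sum]
      refine mul_le_mul_of_nonneg_left ?_ (sq_nonneg _)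
      simp only [hg, norm_mul, mul_pow, hsdef, Finset.sum_product]
      rw [← Finset.sum_mul_sum, sq (S.Sq Q B (j + 1) a (i + 1) z)]
      refine mul_le_mul ?_ ?_ (by positivity) (S.Sq_nonneg _ _ _ _)
      · exact Finset.sum_le_sum_of_subset_of_nonneg (hsub r₁ (by omega))
          fun _ _ _ => sq_nonneg _
      · exact Finset.sum_le_sum_of_subset_of_nonneg (hsub r₂ hr₂) fun _ _ _ => sq_nonneg _
  · intro p _
    have h1 : s.filter (fun p' => |(p.1 : ℝ) - p'.1| ≤ M + 13 ∧ |(p.2 : ℝ) - p'.2| ≤ M + 13) ⊆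
        ((S.idx j t₁ (i + 1)).filter fun b : ℕ => |(p.1 : ℝ) - b| ≤ M + 13) ×ˢ
        ((S.idx j t₂ (i + 1)).filter fun b : ℕ => |(p.2 : ℝ) - b| ≤ M + 13) := by
      intro x hx
      simp only [hsdef, Finset.mem_filter, Finset.mem_product] at hx ⊢
      tauto
    have h2 := Finset.card_le_card h1
    rw [Finset.card_product] at h2
    have h3 := card_near_le (S.idx j t₁ (i + 1)) p.1 (by linarith : 0 ≤ M + 13)
    have h4 := card_near_le (S.idx j t₂ (i + 1)) p.2 (by linarith : 0 ≤ M + 13)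
    have h5 : 2 * (M + 13) + 1 ≤ 200 * S.C₀ * 15 ^ (i + 1) * S.K := by
      have : 200 * S.C₀ * 15 ^ (i + 1) * S.K = 200 / 61 * M := by rw [hM]; ring
      rw [this]; linarith
    refine (Nat.cast_le.2 h2).trans ?_
    rw [Nat.cast_mul, sq]
    exact mul_le_mul (h3.trans h5) (h4.trans h5) (Nat.cast_nonneg _) (by positivity)
  · rintro ⟨a₁, a₂⟩ hp ⟨a₃, a₄⟩ hp' hne
    simp only [hsdef, Finset.mem_product] at hp hp'
    have hm1 := hsub r₁ (by omega) hp.1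
    have hm2 := hsub r₂ hr₂ hp.2
    have hm3 := hsub r₁ (by omega) hp'.1
    have hm4 := hsub r₂ hr₂ hp'.2
    have b1 := S.ft_mem_box Q B hij' hj hm1 hQ4
    have b2 := S.ft_mem_box Q B hij' hj hm2 hQ4
    have b3 := conj_mem_box (S.ft_mem_box Q B hij' hj hm3 hQ4)
    have b4 := conj_mem_box (S.ft_mem_box Q B hij' hj hm4 hQ4)
    have bω := S.ω_mem_box Q B (a := a) (by omega : i ≤ j + 1) hj hQ4'
    have bH := S.H_mem_box Q B (a := a) hij' hj hQ4
    have bw := pow_mem_box_zero (mul_mem_box_zero bω bH) 2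
    have bb := mul_mem_box bw (mul_mem_box (mul_mem_box b1 b2) (mul_mem_box b3 b4))
    rw [← hcs] at bb
    have hWs := S.W_succ (j + 1) i
    have hKl : ((S.K * S.K ^ i : ℕ) : ℝ) ≤ S.s (i + 1) := by
      have := S.pow_le_s (i + 1)
      rw [pow_succ'] at this
      exact_mod_cast this
    set n₀ : ℝ := (n a₁ : ℝ) + n a₂ - n a₃ - n a₄ with hn₀
    set y₀ : ℝ := S.γ (n a₁) + S.γ (n a₂) - S.γ (n a₃) - S.γ (n a₄) with hy₀
    have bb' : (fun z => (((S.ω Q B (j + 1) a i z * S.H Q B (j + 1) a i z) ^ 2 : ℝ) : ℂ) *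
        (g (a₁, a₂) z * conj (g (a₃, a₄) z))) ∈
        spec Q (box n₀ y₀ cs (13 * S.s (i + 1)) (48 * S.W (j + 1) (i + 1))) := by
      have e1 : (fun z => (((S.ω Q B (j + 1) a i z * S.H Q B (j + 1) a i z) ^ 2 : ℝ) : ℂ) *
          (g (a₁, a₂) z * conj (g (a₃, a₄) z))) = ((fun z => (S.ω Q B (j + 1) a i z : ℂ)) *
          fun z => (S.H Q B (j + 1) a i z : ℂ)) ^ 2 *
          (S.ft Q B (i + 1) a₁ * S.ft Q B (i + 1) a₂ *
          ((fun z => conj (S.ft Q B (i + 1) a₃ z)) * fun z => conj (S.ft Q B (i + 1) a₄ z))) := by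
        funext z
        simp only [hg, Pi.mul_apply, Pi.pow_apply, map_mul]
        push_cast; ring
      rw [e1]
      refine spec_mono (box_change ?_ ?_) bb
      · rw [hn₀]
        have : (0 : ℝ) + ((S.s (i + 1) * a₁ : ℕ) + (S.s (i + 1) * a₂ : ℕ) +
            (-(S.s (i + 1) * a₃ : ℕ) + -(S.s (i + 1) * a₄ : ℕ))) -
            ((n a₁ : ℝ) + n a₂ - n a₃ - n a₄) = 0 := by rw [hn]; ring
        rw [this, abs_zero]
        push_cast at hKl ⊢
        linarith
      · have e2 : (0 : ℝ) + ((S.s (i + 1) * a₁ : ℕ) + (S.s (i + 1) * a₂ : ℕ) +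
            (-(S.s (i + 1) * a₃ : ℕ) + -(S.s (i + 1) * a₄ : ℕ))) - n₀ = 0 := by
          rw [hn₀, hn]; ring
        have e3 : (0 : ℝ) + (S.γ (S.s (i + 1) * a₁) + S.γ (S.s (i + 1) * a₂) +
            (-S.γ (S.s (i + 1) * a₃) + -S.γ (S.s (i + 1) * a₄))) - y₀ = 0 := by
          rw [hy₀, hn]; ring
        rw [e2, e3]
        simp only [sub_self, mul_zero, abs_zero, zero_mul]
        push_cast
        linarith
    by_contra hcon
    have hXW := S.W_le_Xb (by omega : i + 1 ≤ j + 1) hjJ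
    have hle : ∀ x ∈ S.idx (j + 1) a (i + 1), n x ≤ S.s J := fun x hx => by
      obtain ⟨-, h⟩ := S.mem_idx hij' hx
      simp only [hn]; omega
    have hsJ := S.s_le_Xb J
    have hsi : (S.s (i + 1) : ℝ) ≤ S.s J := by exact_mod_cast S.s_mono (by omega : i + 1 ≤ J)
    have hnr : ∀ x ∈ S.idx (j + 1) a (i + 1), (n x : ℝ) ≤ S.Xb J := fun x hx => by
      have : (n x : ℝ) ≤ S.s J := by exact_mod_cast hle x hx
      linarith
    have hcsX : |cs| * S.s J ≤ S.Xb J := (S.seq_le_Xb (by omega)).2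
    have hkey : |n₀| ≤ 13 * S.s (i + 1) ∧ |y₀ - cs * n₀| ≤ 48 * S.W (j + 1) (i + 1) := by
      by_contra hcon2
      refine hcon (sum_eq_zero_of_mem_box bb' ?_ ?_ hcon2)
      · have h1 := hnr a₁ hm1
        have h2 := hnr a₂ hm2
        have h3 := hnr a₃ hm3
        have h4 := hnr a₄ hm4
        have : |n₀| ≤ 2 * S.Xb J := by
          rw [abs_le]
          constructor <;> linarith [Nat.cast_nonneg (α := ℝ) (n a₁),
            Nat.cast_nonneg (α := ℝ) (n a₂), Nat.cast_nonneg (α := ℝ) (n a₃),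
            Nat.cast_nonneg (α := ℝ) (n a₄)]
        linarith
      · have h1 := (S.seq_le_Xb (hle a₁ hm1)).1
        have h2 := (S.seq_le_Xb (hle a₂ hm2)).1
        have h3 := (S.seq_le_Xb (hle a₃ hm3)).1
        have h4 := (S.seq_le_Xb (hle a₄ hm4)).1
        have : |y₀| ≤ 4 * S.Xb J := by
          rw [abs_le] at *
          constructor <;> linarith [h1.1, h1.2, h2.1, h2.2, h3.1, h3.2, h4.1, h4.2]
        have h6 := mul_le_mul_of_nonneg_left hsi (abs_nonneg cs)
        linarith
    obtain ⟨hk1, hk2⟩ := hkey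
    have hsp1 : ∀ x ∈ S.idx j t₁ (i + 1), S.s j * t₁ ≤ n x ∧ n x ≤ S.s j * t₁ + S.s j := by
      intro x hx
      obtain ⟨h1, h2⟩ := S.mem_idx hij hx
      simp only [hn]; omega
    have hsp2 : ∀ x ∈ S.idx j t₂ (i + 1), S.s j * t₂ ≤ n x ∧ n x ≤ S.s j * t₂ + S.s j := by
      intro x hx
      obtain ⟨h1, h2⟩ := S.mem_idx hij hx
      simp only [hn]; omega
    obtain ⟨μ₁, hμ1, -, hμ1'⟩ := S.exists_slope (hsp1 a₁ hp.1).1 (hsp1 a₃ hp'.1).1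
      (hsp1 a₁ hp.1).2 (hsp1 a₃ hp'.1).2
    obtain ⟨μ₂, hμ2, hμ2', hμ2''⟩ := S.exists_slope (hsp2 a₂ hp.2).1 (hsp2 a₄ hp'.2).1
      (hsp2 a₂ hp.2).2 (hsp2 a₄ hp'.2).2
    have hgap : S.h * S.s j ≤ μ₂ - μ₁ := by
      have h1 : S.s j * t₁ + S.s j + S.s j ≤ S.s j * t₂ := by
        have : S.s j * (t₁ + 2) ≤ S.s j * t₂ := Nat.mul_le_mul_left _ (by omega)
        linarith
      have h2 := S.h_mul_le_c_sub (by omega : S.s j * t₁ + S.s j ≤ S.s j * t₂)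
      have h3 : (S.s j : ℝ) ≤ ((S.s j * t₂ : ℕ) : ℝ) - ((S.s j * t₁ + S.s j : ℕ) : ℝ) := by
        have : ((S.s j * t₁ + S.s j + S.s j : ℕ) : ℝ) ≤ ((S.s j * t₂ : ℕ) : ℝ) := by
          exact_mod_cast h1
        push_cast at this ⊢
        linarith
      have h4 := mul_le_mul_of_nonneg_left h3 hh.le
      linarith
    have hμ2c : |μ₂ - cs| ≤ S.C₀ * S.h * S.s (j + 1) := by
      have h1 : S.s (j + 1) * a ≤ S.s j * t₂ := by
        rw [s_succ, ht₂]; nlinarith [Nat.zero_le (S.s j * r₂)]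
      have h2 : S.s j * t₂ + S.s j ≤ S.s (j + 1) * a + S.s (j + 1) := by
        rw [s_succ, ht₂]
        have := Nat.mul_le_mul_left (S.s j) (Nat.succ_le_of_lt hr₂)
        rw [Nat.mul_succ] at this
        linarith
      have h3 := S.c_mono h1
      have h4 := S.c_mono h2
      have h5 := (S.c_add (S.s (j + 1) * a) (S.s (j + 1))).2
      rw [abs_of_nonneg (by linarith)]
      linarith
    set kk := (n a₁ : ℝ) - n a₃ with hkk
    have hid : (μ₂ - μ₁) * kk = (μ₂ - cs) * n₀ - (y₀ - cs * n₀) := by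
      rw [hy₀, hn₀, hkk]
      linear_combination hμ1 + hμ2
    have hkkb : S.h * S.s j * |kk| ≤ 61 * S.W (j + 1) (i + 1) := by
      have h1 : S.h * S.s j * |kk| ≤ |(μ₂ - μ₁) * kk| := by
        rw [abs_mul]
        exact mul_le_mul_of_nonneg_right (hgap.trans (le_abs_self _)) (abs_nonneg _)
      have h2 := abs_sub ((μ₂ - cs) * n₀) (y₀ - cs * n₀)
      rw [← hid, abs_mul (μ₂ - cs)] at h2
      have h3 := mul_le_mul hμ2c hk1 (abs_nonneg _) ((abs_nonneg _).trans hμ2c)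
      have h4 := S.slope_le_W (j + 1) (i + 1)
      linarith
    have hWe : S.W (j + 1) (i + 1) = S.C₀ * 15 ^ (i + 1) * S.K * (S.h * S.s j * S.s (i + 1)) := by
      rw [W, s_succ S j]; push_cast; ring
    have hsne : (0 : ℝ) < S.h * S.s j * S.s (i + 1) := by positivity
    have hd1 : |(a₁ : ℝ) - a₃| ≤ M := by
      have e : |kk| = S.s (i + 1) * |(a₁ : ℝ) - a₃| := by
        rw [hkk, hn]
        push_cast
        rw [← mul_sub, abs_mul, abs_of_pos hs]
      rw [e, hWe] at hkkb
      refine le_of_mul_le_mul_right (a := S.h * S.s j * S.s (i + 1)) ?_ hsne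
      rw [hM]
      linarith
    have hd12 : |((a₁ : ℝ) - a₃) + ((a₂ : ℝ) - a₄)| ≤ 13 := by
      have e : n₀ = S.s (i + 1) * (((a₁ : ℝ) - a₃) + ((a₂ : ℝ) - a₄)) := by
        rw [hn₀, hn]; push_cast; ring
      rw [e, abs_mul, abs_of_pos hs, mul_comm] at hk1
      exact le_of_mul_le_mul_right hk1 hs
    refine hne ⟨by linarith, ?_⟩
    rw [abs_le] at *
    constructor <;> linarith [hd1.1, hd1.2, hd12.1, hd12.2]

end Setup

section Schur

variable {Q : ℕ} [NeZero Q]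

theorem sum_chr_mul_conj (ζ ζ' : ℤ × ℤ) :
    ∑ z, chr Q ζ z * conj (chr Q ζ' z) =
      if (ζ.1 : ZMod Q) = ζ'.1 ∧ (ζ.2 : ZMod Q) = ζ'.2 then (Q : ℂ) ^ 2 else 0 := by
  have h : ∀ z, chr Q ζ z * conj (chr Q ζ' z) = chr Q (ζ - ζ') z := fun z => by
    rw [conj_chr, sub_eq_add_neg, chr_add, Pi.mul_apply]
  simp only [h, sum_chr, Prod.fst_sub, Prod.snd_sub, Int.cast_sub, sub_eq_zero]

/-- Schur test for sums of characters. -/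
theorem sum_norm_sq_le_of_count {ι : Type*} (s : Finset ι) (β : ι → ℂ) (ζ : ι → ℤ × ℤ) :
    ∑ z, ‖∑ p ∈ s, β p * chr Q (ζ p) z‖ ^ 2 ≤
      (Q : ℝ) ^ 2 * ∑ p ∈ s, ‖β p‖ ^ 2 * ((s.filter fun p' =>
        ((ζ p).1 : ZMod Q) = (ζ p').1 ∧ ((ζ p).2 : ZMod Q) = (ζ p').2).card : ℝ) := by
  classical
  set r : ι → ι → Prop := fun p p' =>
    ((ζ p).1 : ZMod Q) = (ζ p').1 ∧ ((ζ p).2 : ZMod Q) = (ζ p').2 with hr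
  have hsymm : ∀ p p', r p p' ↔ r p' p := fun p p' => by simp only [hr, eq_comm]
  have h1 : ((∑ z, ‖∑ p ∈ s, β p * chr Q (ζ p) z‖ ^ 2 : ℝ) : ℂ) =
      ∑ p ∈ s, ∑ p' ∈ s, β p * conj (β p') * (if r p p' then (Q : ℂ) ^ 2 else 0) := by
    have h2 : ∀ z, ((‖∑ p ∈ s, β p * chr Q (ζ p) z‖ ^ 2 : ℝ) : ℂ) =
        ∑ p ∈ s, ∑ p' ∈ s, β p * conj (β p') * (chr Q (ζ p) z * conj (chr Q (ζ p') z)) := by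
      intro z
      rw [Complex.ofReal_pow, ← Complex.mul_conj', map_sum, Finset.sum_mul_sum]
      refine Finset.sum_congr rfl fun p _ => Finset.sum_congr rfl fun p' _ => ?_
      rw [map_mul]; ring
    rw [Complex.ofReal_sum]
    simp only [h2]
    rw [Finset.sum_comm]
    refine Finset.sum_congr rfl fun p _ => ?_
    rw [Finset.sum_comm]
    refine Finset.sum_congr rfl fun p' _ => ?_
    rw [← Finset.mul_sum, sum_chr_mul_conj]
  have h3 : ∑ z, ‖∑ p ∈ s, β p * chr Q (ζ p) z‖ ^ 2 ≤
      ∑ p ∈ s, ∑ p' ∈ s, if r p p' then (Q : ℝ) ^ 2 * ((‖β p‖ ^ 2 + ‖β p'‖ ^ 2) / 2) else 0 := by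
    have h4 : ∑ z, ‖∑ p ∈ s, β p * chr Q (ζ p) z‖ ^ 2 =
        ‖((∑ z, ‖∑ p ∈ s, β p * chr Q (ζ p) z‖ ^ 2 : ℝ) : ℂ)‖ := by
      rw [Complex.norm_real, Real.norm_of_nonneg (Finset.sum_nonneg fun _ _ => sq_nonneg _)]
    rw [h4, h1]
    refine (norm_sum_le _ _).trans (Finset.sum_le_sum fun p _ => (norm_sum_le _ _).trans
      (Finset.sum_le_sum fun p' _ => ?_))
    split_ifs
    · rw [norm_mul, norm_mul, RCLike.norm_conj, norm_pow, Complex.norm_natCast, mul_comm]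
      refine mul_le_mul_of_nonneg_left ?_ (sq_nonneg _)
      nlinarith [sq_nonneg (‖β p‖ - ‖β p'‖)]
    · simp
  refine h3.trans (le_of_eq ?_)
  have h5 : ∀ p ∈ s, ∑ p' ∈ s, (if r p p' then ‖β p‖ ^ 2 else 0) =
      ‖β p‖ ^ 2 * ((s.filter (r p)).card : ℝ) := fun p _ => by
    rw [← Finset.sum_filter, Finset.sum_const, nsmul_eq_mul, mul_comm]
  have h6 : ∑ p ∈ s, ∑ p' ∈ s, (if r p p' then ‖β p'‖ ^ 2 else 0) =
      ∑ p ∈ s, ∑ p' ∈ s, (if r p p' then ‖β p‖ ^ 2 else 0) := by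
    rw [Finset.sum_comm]
    simp only [hsymm]
  rw [← Finset.sum_congr rfl h5]
  have h7 : ∀ p p', (if r p p' then (Q : ℝ) ^ 2 * ((‖β p‖ ^ 2 + ‖β p'‖ ^ 2) / 2) else 0) =
      (Q : ℝ) ^ 2 / 2 * (if r p p' then ‖β p‖ ^ 2 else 0) +
      (Q : ℝ) ^ 2 / 2 * (if r p p' then ‖β p'‖ ^ 2 else 0) := fun p p' => by
    split_ifs <;> ring
  simp only [h7, Finset.sum_add_distrib, ← Finset.mul_sum, h6]
  ring

end Schur

theorem sum_inv_dist_le {p L n : ℕ} (hn : n ∈ Ico p (p + L)) :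
    ∑ n' ∈ Ico p (p + L), |(n : ℝ) - n'|⁻¹ ≤ 2 * (1 + Real.log L) := by
  rw [Finset.mem_Ico] at hn
  have hL : 0 < L := by omega
  have key : ∀ k : ℕ, k ≤ L → ∑ i ∈ range k, ((i : ℝ) + 1)⁻¹ ≤ 1 + Real.log L := by
    intro k hk
    rcases Nat.eq_zero_or_pos k with rfl | hk0
    · have := Real.log_nonneg (by exact_mod_cast hL : (1 : ℝ) ≤ L)
      simp; linarith
    have h1 := harmonic_le_one_add_log k
    have h2 : Real.log k ≤ Real.log L :=
      Real.log_le_log (by exact_mod_cast hk0) (by exact_mod_cast hk)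
    have h3 : ((harmonic k : ℚ) : ℝ) = ∑ i ∈ range k, ((i : ℝ) + 1)⁻¹ := by
      rw [harmonic]; push_cast; rfl
    linarith
  rw [← Finset.sum_Ico_consecutive _ hn.1 hn.2.le, Finset.sum_eq_sum_Ico_succ_bot hn.2]
  have e1 : ∑ i ∈ Ico p n, |(n : ℝ) - i|⁻¹ = ∑ i ∈ range (n - p), ((i : ℝ) + 1)⁻¹ := by
    rw [Finset.sum_Ico_eq_sum_range, ← Finset.sum_range_reflect]
    refine Finset.sum_congr rfl fun i hi => ?_
    rw [Finset.mem_range] at hi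
    have : (n : ℝ) - ((p + (n - p - 1 - i) : ℕ) : ℝ) = i + 1 := by
      rw [show p + (n - p - 1 - i) = n - 1 - i by omega, Nat.cast_sub (by omega),
        Nat.cast_sub (by omega)]
      push_cast; ring
    rw [this, abs_of_nonneg (by positivity)]
  have e2 : ∑ i ∈ Ico (n + 1) (p + L), |(n : ℝ) - i|⁻¹ =
      ∑ i ∈ range (p + L - (n + 1)), ((i : ℝ) + 1)⁻¹ := by
    rw [Finset.sum_Ico_eq_sum_range]
    refine Finset.sum_congr rfl fun i hi => ?_
    have : (n : ℝ) - ((n + 1 + i : ℕ) : ℝ) = -(i + 1) := by push_cast; ring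
    rw [this, abs_neg, abs_of_nonneg (by positivity)]
  rw [e1, e2, sub_self, abs_zero, inv_zero]
  have h1 := key (n - p) (by omega)
  have h2 := key (p + L - (n + 1)) (by omega)
  linarith

namespace Setup

variable (S : Setup) {Q : ℕ} [NeZero Q] {B : ℝ}

/-- Exponential sum over an interval, without pruning. -/
noncomputable def f (Q : ℕ) [NeZero Q] (s : Finset ℕ) (z : ZMod Q × ZMod Q) : ℂ :=
  ∑ n ∈ s, S.b n * chr Q ((n : ℤ), S.G n) z

theorem h_mul_le_γ_diff (l n r : ℕ) :
    S.h * l * r ≤ (S.γ (n + r + l) - S.γ (n + r)) - (S.γ (n + l) - S.γ n) := by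
  induction l with
  | zero => simp
  | succ l ih =>
    have h1 := (S.c_add (n + l) r).1
    have h2 : S.γ (n + r + (l + 1)) = S.γ (n + r + l) + S.c (n + r + l) := by
      rw [c]; ring_nf
    have h3 : S.γ (n + (l + 1)) = S.γ (n + l) + S.c (n + l) := by rw [c]; ring_nf
    rw [h2, h3]
    rw [show n + l + r = n + r + l by ring] at h1
    push_cast
    linarith

theorem abs_γ_diff_ge {n n' m m' : ℕ} (h : (n : ℤ) - n' = m - m') :
    S.h * |(n : ℝ) - n'| * |(n : ℝ) - m| ≤ |(S.γ n - S.γ n') - (S.γ m - S.γ m')| := by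
  wlog h1 : n' ≤ n generalizing n n' m m'
  · have := this (n := n') (n' := n) (m := m') (m' := m) (by omega) (by omega)
    have e1 : |(n' : ℝ) - m'| = |(n : ℝ) - m| := by
      have : (n : ℝ) - n' = m - m' := by exact_mod_cast h
      congr 1; linarith
    have e2 : S.γ n' - S.γ n - (S.γ m' - S.γ m) = -(S.γ n - S.γ n' - (S.γ m - S.γ m')) := by ring
    rw [e1, e2, abs_neg, abs_sub_comm (n' : ℝ)] at this
    exact this
  wlog h2 : n ≤ m generalizing n n' m m'
  · have := this (n := m) (n' := m') (m := n) (m' := n') (by omega) (by omega) (by omega)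
    have e0 : (n : ℝ) - n' = m - m' := by exact_mod_cast h
    rw [abs_sub_comm (m : ℝ) n, ← e0, abs_sub_comm (S.γ m - S.γ m')] at this
    exact this
  obtain ⟨l, rfl⟩ := Nat.exists_eq_add_of_le h1
  obtain ⟨r, rfl⟩ := Nat.exists_eq_add_of_le h2
  have hm' : m' = n' + r := by omega
  subst hm'
  have h3 := S.h_mul_le_γ_diff l n' r
  rw [abs_sub_comm (S.γ (n' + l) - S.γ n')]
  refine le_trans (le_of_eq ?_) (h3.trans (le_trans (le_of_eq ?_) (le_abs_self _)))
  · rw [abs_sub_comm ((n' + l : ℕ) : ℝ) ((n' + l + r : ℕ) : ℝ)]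
    push_cast
    rw [add_sub_cancel_left, add_sub_cancel_left, abs_of_nonneg (Nat.cast_nonneg (α := ℝ) l),
      abs_of_nonneg (Nat.cast_nonneg (α := ℝ) r)]
  · rw [show n' + r + l = n' + l + r by ring]

variable {J : ℕ}

omit [NeZero Q] in
theorem natCast_inj_of_le_s {n m : ℕ} (hn : n ≤ S.s J) (hm : m ≤ S.s J) (hQ : 100 * S.Xb J ≤ Q)
    (h : (((n : ℤ)) : ZMod Q) = ((m : ℤ) : ZMod Q)) : n = m := by
  have h1 : ((n : ℝ)) ≤ S.s J := by exact_mod_cast hn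
  have h2 : ((m : ℝ)) ≤ S.s J := by exact_mod_cast hm
  have h3 := S.s_le_Xb J
  have h4 := S.Xb_pos J
  have h5 : (((n : ℤ) - m : ℤ) : ZMod Q) = 0 := by rw [Int.cast_sub, h, sub_self]
  have h6 := int_eq_zero_of_cast h5 (by
    push_cast
    rw [abs_lt]
    constructor <;> linarith [Nat.cast_nonneg (α := ℝ) n, Nat.cast_nonneg (α := ℝ) m])
  omega

theorem sum_norm_f_sq_le {s : Finset ℕ} (hs : ∀ n ∈ s, n ≤ S.s J) (hQ : 100 * S.Xb J ≤ Q) :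
    ∑ z, ‖S.f Q s z‖ ^ 2 ≤ (Q : ℝ) ^ 2 * ∑ n ∈ s, ‖S.b n‖ ^ 2 := by
  classical
  refine (sum_norm_sq_le_of_count s S.b fun n => ((n : ℤ), S.G n)).trans ?_
  refine mul_le_mul_of_nonneg_left (Finset.sum_le_sum fun n hn => ?_) (sq_nonneg _)
  have : (s.filter fun p' : ℕ => (((n : ℤ), S.G n).1 : ZMod Q) = (((p' : ℤ), S.G p').1 : ZMod Q) ∧
      (((n : ℤ), S.G n).2 : ZMod Q) = (((p' : ℤ), S.G p').2 : ZMod Q)).card ≤ 1 := by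
    rw [Finset.card_le_one]
    intro x hx y hy
    rw [Finset.mem_filter] at hx hy
    exact (S.natCast_inj_of_le_s (hs n hn) (hs x hx.1) hQ hx.2.1).symm.trans
      (S.natCast_inj_of_le_s (hs n hn) (hs y hy.1) hQ hy.2.1)
  refine (mul_le_mul_of_nonneg_left (Nat.cast_le.2 this) (sq_nonneg _)).trans (by simp)

omit [NeZero Q] in
theorem card_filter_pairs_le {s : Finset ℕ} (hs : ∀ n ∈ s, n ≤ S.s J) (hQ : 100 * S.Xb J ≤ Q)
    {n n' : ℕ} (hn : n ∈ s) (hn' : n' ∈ s) :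
    (((s ×ˢ s).filter fun p : ℕ × ℕ =>
      (((n : ℤ) - n' : ℤ) : ZMod Q) = ((p.1 - p.2 : ℤ) : ZMod Q) ∧
      ((S.G n - S.G n' : ℤ) : ZMod Q) = ((S.G p.1 - S.G p.2 : ℤ) : ZMod Q)).card : ℝ) ≤
      if n = n' then (s.card : ℝ) else 1 + 8 / S.h * |(n : ℝ) - n'|⁻¹ := by
  classical
  have hX := S.s_le_Xb J
  have hX0 := S.Xb_pos J
  have hr : ∀ x ∈ s, (x : ℝ) ≤ S.Xb J := fun x hx =>
    (by exact_mod_cast hs x hx : (x : ℝ) ≤ S.s J).trans hX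
  have hg : ∀ x ∈ s, |(S.G x : ℝ)| ≤ S.Xb J + 1 := fun x hx => by
    have h1 := (S.seq_le_Xb (hs x hx)).1
    have h2 := S.abs_G_sub_le x
    rw [abs_le] at *
    constructor <;> linarith [h1.1, h1.2, h2.1, h2.2]
  have hX1 : 1 ≤ S.Xb J := le_trans (by exact_mod_cast S.s_pos J) hX
  have hinterval : ∀ p : ℕ × ℕ, p.1 ∈ s → p.2 ∈ s →
      (((n : ℤ) - n' : ℤ) : ZMod Q) = ((p.1 - p.2 : ℤ) : ZMod Q) →
      ((S.G n - S.G n' : ℤ) : ZMod Q) = ((S.G p.1 - S.G p.2 : ℤ) : ZMod Q) →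
      (n : ℤ) - n' = p.1 - p.2 ∧ S.G n - S.G n' = S.G p.1 - S.G p.2 := by
    intro p h1 h2 h3 h4
    constructor
    · have := int_eq_zero_of_cast (Q := Q) (a := ((n : ℤ) - n') - (p.1 - p.2))
        (by rw [Int.cast_sub, h3, sub_self]) (by
          push_cast
          have a1 := hr n hn; have a2 := hr n' hn'; have a3 := hr _ h1; have a4 := hr _ h2
          rw [abs_lt]
          constructor <;> linarith [Nat.cast_nonneg (α := ℝ) n, Nat.cast_nonneg (α := ℝ) n',
            Nat.cast_nonneg (α := ℝ) p.1, Nat.cast_nonneg (α := ℝ) p.2])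
      omega
    · have := int_eq_zero_of_cast (Q := Q) (a := (S.G n - S.G n') - (S.G p.1 - S.G p.2))
        (by rw [Int.cast_sub, h4, sub_self]) (by
          push_cast
          have a1 := hg n hn; have a2 := hg n' hn'; have a3 := hg _ h1; have a4 := hg _ h2
          rw [abs_le] at a1 a2 a3 a4
          rw [abs_lt]
          constructor <;> linarith [a1.1, a1.2, a2.1, a2.2, a3.1, a3.2, a4.1, a4.2])
      omega
  split_ifs with hnn
  · subst hnn
    refine Nat.cast_le.2 (Finset.card_le_card_of_injOn Prod.fst ?_ ?_)
    · intro p hp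
      simp only [Finset.coe_filter, Finset.mem_product, Set.mem_ofPred_eq] at hp
      exact hp.1.1
    · rintro p hp p' hp' he
      simp only [Finset.coe_filter, Finset.mem_product, Set.mem_ofPred_eq] at hp hp'
      obtain ⟨h1, -⟩ := hinterval p hp.1.1 hp.1.2 hp.2.1 hp.2.2
      obtain ⟨h2, -⟩ := hinterval p' hp'.1.1 hp'.1.2 hp'.2.1 hp'.2.2
      refine Prod.ext he ?_
      omega
  have hpos : 0 < |(n : ℝ) - n'| := abs_pos.2 (sub_ne_zero.2 (by exact_mod_cast hnn))
  have hh := S.h_pos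
  have h1 := card_near_le s n (M := 4 / (S.h * |(n : ℝ) - n'|)) (by positivity)
  refine le_trans (Nat.cast_le.2 (Finset.card_le_card_of_injOn Prod.fst ?_ ?_))
    (h1.trans (le_of_eq (by field_simp; ring)))
  · intro p hp
    simp only [Finset.coe_filter, Finset.mem_product, Set.mem_ofPred_eq] at hp ⊢
    refine ⟨hp.1.1, ?_⟩
    obtain ⟨h2, h3⟩ := hinterval p hp.1.1 hp.1.2 hp.2.1 hp.2.2
    have h4 := S.abs_γ_diff_ge h2
    have h5 : (S.G n : ℝ) - S.G n' = S.G p.1 - S.G p.2 := by exact_mod_cast h3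
    have b1 := S.abs_G_sub_le n
    have b2 := S.abs_G_sub_le n'
    have b3 := S.abs_G_sub_le p.1
    have b4 := S.abs_G_sub_le p.2
    have h6 : |S.γ n - S.γ n' - (S.γ p.1 - S.γ p.2)| ≤ 4 := by
      rw [abs_le] at *
      constructor <;> linarith [b1.1, b1.2, b2.1, b2.2, b3.1, b3.2, b4.1, b4.2]
    rw [le_div_iff₀ (by positivity), mul_comm]
    exact h4.trans h6
  · rintro p hp p' hp' he
    simp only [Finset.coe_filter, Finset.mem_product, Set.mem_ofPred_eq] at hp hp'
    obtain ⟨h1, -⟩ := hinterval p hp.1.1 hp.1.2 hp.2.1 hp.2.2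
    obtain ⟨h2, -⟩ := hinterval p' hp'.1.1 hp'.1.2 hp'.2.1 hp'.2.2
    refine Prod.ext he ?_
    omega

/-- Fourth moment of a short block. -/
theorem sum_norm_f_pow_four_le {p L : ℕ} (hL : 1 ≤ L) (hpL : p + L ≤ S.s J)
    (hQ : 100 * S.Xb J ≤ Q) :
    ∑ z, ‖S.f Q (Ico p (p + L)) z‖ ^ 4 ≤
      (Q : ℝ) ^ 2 * ((2 * L + 16 / S.h * (1 + Real.log L)) * ∑ n ∈ Ico p (p + L), ‖S.b n‖ ^ 2) := by
  classical
  set s := Ico p (p + L) with hs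
  have hsJ : ∀ n ∈ s, n ≤ S.s J := fun n hn => by
    rw [hs, Finset.mem_Ico] at hn; omega
  have hh := S.h_pos
  have e1 : ∀ z, ‖S.f Q s z‖ ^ 4 = ‖∑ q ∈ s ×ˢ s, (S.b q.1 * conj (S.b q.2)) *
      chr Q ((q.1 : ℤ) - q.2, S.G q.1 - S.G q.2) z‖ ^ 2 := by
    intro z
    have : ∑ q ∈ s ×ˢ s, (S.b q.1 * conj (S.b q.2)) *
        chr Q ((q.1 : ℤ) - q.2, S.G q.1 - S.G q.2) z = S.f Q s z * conj (S.f Q s z) := by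
      rw [f, map_sum, Finset.sum_mul_sum, Finset.sum_product]
      refine Finset.sum_congr rfl fun x _ => Finset.sum_congr rfl fun y _ => ?_
      have : (((x : ℤ) - y, S.G x - S.G y) : ℤ × ℤ) = ((x : ℤ), S.G x) + -((y : ℤ), S.G y) := by
        ext <;> simp [sub_eq_add_neg]
      rw [this, chr_add, Pi.mul_apply, map_mul, conj_chr]; ring
    rw [this, norm_mul, RCLike.norm_conj]; ring
  simp only [e1]
  refine (sum_norm_sq_le_of_count (s ×ˢ s) _ _).trans
    (mul_le_mul_of_nonneg_left ?_ (sq_nonneg _))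
  rw [Finset.sum_product, Finset.mul_sum]
  refine Finset.sum_le_sum fun n hn => ?_
  have h1 : ∀ n' ∈ s, ‖S.b n * conj (S.b n')‖ ^ 2 *
      (((s ×ˢ s).filter fun p : ℕ × ℕ =>
      (((n : ℤ) - n' : ℤ) : ZMod Q) = ((p.1 - p.2 : ℤ) : ZMod Q) ∧
      ((S.G n - S.G n' : ℤ) : ZMod Q) = ((S.G p.1 - S.G p.2 : ℤ) : ZMod Q)).card : ℝ) ≤
      ‖S.b n‖ ^ 2 * ((if n = n' then (L : ℝ) else 0) + (1 + 8 / S.h * |(n : ℝ) - n'|⁻¹)) := by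
    intro n' hn'
    have h2 := S.card_filter_pairs_le hsJ hQ hn hn'
    rw [norm_mul, RCLike.norm_conj, mul_pow, mul_assoc]
    refine mul_le_mul_of_nonneg_left ?_ (sq_nonneg _)
    refine (mul_le_of_le_one_left (Nat.cast_nonneg _)
      (pow_le_one₀ (norm_nonneg _) (S.norm_b_le n'))).trans (h2.trans ?_)
    have hc : s.card = L := by rw [hs, Nat.card_Ico]; omega
    rw [hc]
    split_ifs with h
    · have : 0 ≤ 8 / S.h * |(n : ℝ) - n'|⁻¹ := by positivity
      linarith
    · linarith
  refine (Finset.sum_le_sum h1).trans ?_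
  rw [← Finset.mul_sum, mul_comm]
  refine mul_le_mul_of_nonneg_right ?_ (sq_nonneg _)
  rw [Finset.sum_add_distrib, Finset.sum_add_distrib, Finset.sum_ite_eq, if_pos hn,
    ← Finset.mul_sum, Finset.sum_const, hs, Nat.card_Ico]
  have h3 := sum_inv_dist_le hn
  have h4 := mul_le_mul_of_nonneg_left h3 (by positivity : 0 ≤ 8 / S.h)
  rw [add_tsub_cancel_left, nsmul_eq_mul, mul_one]
  calc _ ≤ (L : ℝ) + (L + 8 / S.h * (2 * (1 + Real.log L))) := by linarith
    _ = _ := by ring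

end Setup

namespace Setup

variable (S : Setup) {Q : ℕ} [NeZero Q] {B : ℝ}

/-- Blocks of length `s j`. -/
def I (j a : ℕ) : Finset ℕ := Ico (S.s j * a) (S.s j * a + S.s j)

theorem sum_I {M : Type*} [AddCommMonoid M] (j a : ℕ) (g : ℕ → M) :
    ∑ n ∈ S.I j a, g n = ∑ a' ∈ S.idx j a 0, ∑ r ∈ range S.D, g (S.D * a' + r) := by
  rw [idx, ← sum_Ico_mul_eq, I]
  congr 1
  rw [Nat.sub_zero, s]
  congr 1 <;> ring

theorem m_eq (j a : ℕ) : S.m j a = ∑ n ∈ S.I j a, ‖S.b n‖ ^ 2 := (S.sum_I j a fun n => ‖S.b n‖ ^ 2).symm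

theorem F_zero_eq (j a : ℕ) : S.F Q B j a 0 = S.f Q (S.I j a) := by
  funext z
  rw [f, S.sum_I]
  simp only [F, ft]

theorem f_succ (j a : ℕ) (z : ZMod Q × ZMod Q) :
    S.f Q (S.I (j + 1) a) z = ∑ r ∈ range S.K, S.f Q (S.I j (S.K * a + r)) z := by
  simp only [f, sum_I]
  exact S.sum_idx_children a (Nat.zero_le j) _

theorem m_succ (j a : ℕ) : S.m (j + 1) a = ∑ r ∈ range S.K, S.m j (S.K * a + r) :=
  S.sum_idx_children a (Nat.zero_le j) _

theorem T_child_le {j i : ℕ} (a : ℕ) {r : ℕ} (hr : r < S.K) (hij : i ≤ j)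
    (z : ZMod Q × ZMod Q) : S.T Q B j (S.K * a + r) i z ≤ S.T Q B (j + 1) a i z := by
  have : S.T Q B (j + 1) a i z = ∑ r ∈ range S.K, S.T Q B j (S.K * a + r) i z :=
    S.sum_idx_children a hij _
  rw [this]
  exact Finset.single_le_sum (f := fun r => S.T Q B j (S.K * a + r) i z)
    (fun r _ => S.T_nonneg _ _ _ _) (Finset.mem_range.2 hr)

theorem m_child_le (j a : ℕ) {r : ℕ} (hr : r < S.K) : S.m j (S.K * a + r) ≤ S.m (j + 1) a := by
  rw [m_succ]
  exact Finset.single_le_sum (f := fun r => S.m j (S.K * a + r))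
    (fun r _ => S.m_nonneg _ _) (Finset.mem_range.2 hr)

theorem child_le {j a r : ℕ} (hr : r < S.K) :
    S.s j * (S.K * a + r) + S.s j ≤ S.s (j + 1) * a + S.s (j + 1) := by
  rw [s_succ]
  have := Nat.mul_le_mul_left (S.s j) (Nat.succ_le_of_lt hr)
  rw [Nat.mul_succ] at this
  calc _ = S.s j * S.K * a + (S.s j * r + S.s j) := by ring
    _ ≤ S.s j * S.K * a + S.s j * S.K := by omega
    _ = _ := by ring

set_option maxHeartbeats 1000000 in
/-- Second moment of the high part. -/
theorem sum_H_sq_le' (hB : 0 < B) (hDB : (S.D : ℝ) ^ 2 ≤ S.h * B ^ 2) {j a i J : ℕ}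
    (hij : i + 1 ≤ j) (hjJ : j ≤ J) (ha : S.s j * a + S.s j ≤ S.s J) (hQ : 100 * S.Xb J ≤ Q) :
    ∑ z, S.H Q B j a i z ^ 2 ≤
      (1 + 16 * S.C₀ * 15 ^ (i + 1) * S.D * S.K * (1 + S.K ^ 2)) * B ^ 2 *
        (9 ^ (i + 1) * (Q ^ 2 * S.m j a)) := by
  have hQ4 : 4 * S.s (i + 1) ≤ Q := S.four_mul_s_le (hij.trans hjJ) hQ
  have hC := S.one_le_C₀
  have hK : (4 : ℝ) ≤ S.K := by exact_mod_cast S.four_le_K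
  have hh := S.h_pos
  have hh1 := S.h_le_one
  have hs : (0 : ℝ) < S.s (i + 1) := by exact_mod_cast S.s_pos (i + 1)
  have hs0 : (0 : ℝ) < S.s i := by exact_mod_cast S.s_pos i
  have hsi : (S.s (i + 1) : ℝ) = S.K * S.s i := by rw [s_succ]; push_cast; ring
  have hsK : (S.s i : ℝ) = S.D * (S.K ^ i : ℕ) := by rw [s]; push_cast; ring
  have hD : (81 : ℝ) ≤ S.D := by rw [D_eq']; nlinarith
  have h15 : (1 : ℝ) ≤ 15 ^ (i + 1) := one_le_pow₀ (by norm_num)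
  have hl : (0 : ℝ) < (S.K ^ i : ℕ) := by exact_mod_cast pow_pos S.K_pos i
  have hC15 : 1 ≤ S.C₀ * 15 ^ (i + 1) := by nlinarith
  have hE : ∀ M : ℝ, (∀ a' z, ‖S.ft Q B (i + 1) a' z‖ ^ 2 ≤ M) →
      ∑ a' ∈ S.idx j a (i + 1), ∑ z, ‖S.ft Q B (i + 1) a' z‖ ^ 4 ≤
        M * (9 ^ (i + 1) * (Q ^ 2 * S.m j a)) := by
    intro M hM
    have hM0 : 0 ≤ M := (sq_nonneg _).trans (hM 0 0)
    refine le_trans ?_ (mul_le_mul_of_nonneg_left (S.sum_T_le hB hDB a hij hQ4) hM0)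
    rw [S.sum_T_eq j a hQ4, Finset.sum_comm, Finset.mul_sum]
    refine Finset.sum_le_sum fun z _ => ?_
    rw [Sq, Finset.mul_sum]
    refine Finset.sum_le_sum fun a' _ => ?_
    have := mul_le_mul_of_nonneg_right (hM a' z) (sq_nonneg ‖S.ft Q B (i + 1) a' z‖)
    linarith [this, show ‖S.ft Q B (i + 1) a' z‖ ^ 4 =
      ‖S.ft Q B (i + 1) a' z‖ ^ 2 * ‖S.ft Q B (i + 1) a' z‖ ^ 2 by ring]
  have hnn : 0 ≤ 9 ^ (i + 1) * ((Q : ℝ) ^ 2 * S.m j a) := by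
    have := S.m_nonneg j a; positivity
  have hpre0 : 0 ≤ 1 + 8 * S.Yt (i + 1) / (S.h * S.s (i + 1) * (S.K ^ i : ℕ)) := by
    have := S.Yt_pos (i + 1); positivity
  have key : ∀ M : ℝ, (∀ a' z, ‖S.ft Q B (i + 1) a' z‖ ^ 2 ≤ M) →
      (1 + 8 * S.Yt (i + 1) / (S.h * S.s (i + 1) * (S.K ^ i : ℕ))) * M ≤
        (1 + 16 * S.C₀ * 15 ^ (i + 1) * S.D * S.K * (1 + S.K ^ 2)) * B ^ 2 →
      ∑ z, S.H Q B j a i z ^ 2 ≤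
      (1 + 16 * S.C₀ * 15 ^ (i + 1) * S.D * S.K * (1 + S.K ^ 2)) * B ^ 2 *
        (9 ^ (i + 1) * (Q ^ 2 * S.m j a)) := by
    intro M h1 h2
    refine (S.sum_H_sq_le hij hjJ ha hQ).trans
      ((mul_le_mul_of_nonneg_left (hE M h1) hpre0).trans ?_)
    rw [← mul_assoc]
    exact mul_le_mul_of_nonneg_right h2 hnn
  have hB2 : 1 / S.h ≤ B ^ 2 := by
    rw [div_le_iff₀ hh, mul_comm]
    nlinarith
  set A := S.C₀ * 15 ^ (i + 1) with hA
  have hAle : 16 * S.C₀ * 15 ^ (i + 1) * S.D * S.K * (1 + S.K ^ 2) =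
      16 * A * S.D * S.K * (1 + S.K ^ 2) := by rw [hA]; ring
  rw [hAle] at key ⊢
  have hYt : S.Yt (i + 1) = A * (1 + S.h * (S.s (i + 1)) ^ 2) := by rw [Yt, hA]
  have hADK : 0 < A * S.D * S.K := by positivity
  have hden : S.s (i + 1) / ((S.K ^ i : ℕ) : ℝ) = S.D * S.K := by
    rw [hsi, hsK]; field_simp
  by_cases hc : 1 ≤ S.h * (S.s i : ℝ) ^ 2
  · refine key (B ^ 2) (fun a' z =>
      pow_le_pow_left₀ (norm_nonneg _) ((S.norm_ft_le hB hDB (i + 1) a' hQ4).1 z) 2) ?_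
    refine mul_le_mul_of_nonneg_right ?_ (sq_nonneg B)
    have h1 : 1 ≤ S.h * (S.s (i + 1) : ℝ) ^ 2 := by
      rw [hsi, mul_pow]
      have hK2 : (1 : ℝ) ≤ S.K ^ 2 := by nlinarith
      linarith [mul_le_mul hK2 hc (by norm_num) (by positivity)]
    have h2 : 8 * S.Yt (i + 1) / (S.h * S.s (i + 1) * (S.K ^ i : ℕ)) ≤
        16 * A * (S.s (i + 1) / ((S.K ^ i : ℕ) : ℝ)) := by
      rw [hYt, div_le_iff₀ (by positivity)]
      have e : 16 * A * (S.s (i + 1) / ((S.K ^ i : ℕ) : ℝ)) *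
          (S.h * S.s (i + 1) * (S.K ^ i : ℕ)) = 16 * A * (S.h * S.s (i + 1) ^ 2) := by
        field_simp
      rw [e]
      linarith [mul_le_mul_of_nonneg_left h1 (by positivity : 0 ≤ 8 * A)]
    rw [hden] at h2
    linarith [mul_nonneg hADK.le (sq_nonneg (S.K : ℝ))]
  · push Not at hc
    refine key ((S.s (i + 1) : ℝ) ^ 2) (fun a' z => pow_le_pow_left₀ (norm_nonneg _)
      ((S.norm_ft_le hB hDB (i + 1) a' hQ4).2 (Or.inr ⟨i, rfl, hc⟩) z) 2) ?_
    have h1 : S.h * (S.s (i + 1) : ℝ) ^ 2 ≤ S.K ^ 2 := by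
      rw [hsi, mul_pow]
      linarith [mul_le_mul_of_nonneg_left hc.le (sq_nonneg (S.K : ℝ))]
    have h3 : (S.s (i + 1) : ℝ) ^ 2 ≤ S.K ^ 2 * B ^ 2 := by
      have : (S.s (i + 1) : ℝ) ^ 2 ≤ S.K ^ 2 * (1 / S.h) := by
        rw [mul_one_div, le_div_iff₀ hh]; linarith
      exact this.trans (mul_le_mul_of_nonneg_left hB2 (sq_nonneg _))
    have h2 : 8 * S.Yt (i + 1) / (S.h * S.s (i + 1) * (S.K ^ i : ℕ)) * (S.s (i + 1) : ℝ) ^ 2 ≤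
        8 * A * (S.D * S.K) * (1 + S.K ^ 2) * B ^ 2 := by
      have e : 8 * S.Yt (i + 1) / (S.h * S.s (i + 1) * (S.K ^ i : ℕ)) * (S.s (i + 1) : ℝ) ^ 2 =
          8 * A * (S.s (i + 1) / ((S.K ^ i : ℕ) : ℝ)) * (1 + S.h * S.s (i + 1) ^ 2) *
            (1 / S.h) := by
        rw [hYt]; field_simp
      rw [e, hden]
      refine mul_le_mul ?_ hB2 (by positivity) (by positivity)
      refine mul_le_mul_of_nonneg_left (by linarith) (by positivity)
    rw [add_mul, one_mul, add_mul, one_mul]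
    have h4 : (S.K : ℝ) ^ 2 ≤ 8 * A * (S.D * S.K) * (1 + S.K ^ 2) := by
      have hDK : 1 ≤ (S.D : ℝ) * S.K := by nlinarith
      have : 1 ≤ A * (S.D * S.K) := one_le_mul_of_one_le_of_one_le hC15 hDK
      have h6 := mul_le_mul_of_nonneg_right this (by positivity : (0 : ℝ) ≤ 1 + S.K ^ 2)
      have h7 : 0 ≤ A * (S.D * S.K) * (1 + S.K ^ 2) := by positivity
      linarith
    have h5 := mul_le_mul_of_nonneg_right h4 (sq_nonneg B)
    have h6 := sq_nonneg B
    linarith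

/-- Points where the square function first becomes large at level `i + 1`. -/
theorem card_broad_le (hB : 0 < B) (hDB : (S.D : ℝ) ^ 2 ≤ S.h * B ^ 2) {j a i r₁ r₂ J : ℕ}
    (hij : i + 1 ≤ j) (hjJ : j + 1 ≤ J) (hj : 1 ≤ S.h * S.s (j + 1)) (hr₁ : r₁ + 2 ≤ r₂)
    (hr₂ : r₂ < S.K) (ha : S.s (j + 1) * a + S.s (j + 1) ≤ S.s J) (hQ : 100 * S.Xb J ≤ Q)
    (hm : 0 < S.m (j + 1) a) {μ : ℝ} (hμ : 0 ≤ μ) (U : Finset (ZMod Q × ZMod Q))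
    (hT : ∀ z ∈ U, ∀ l ≤ i, S.T Q B (j + 1) a l z ≤ 18 ^ l * S.m (j + 1) a)
    (hT' : ∀ z ∈ U, 18 ^ (i + 1) * S.m (j + 1) a < S.T Q B (j + 1) a (i + 1) z)
    (h1 : ∀ z ∈ U, μ ≤ ‖S.F Q B j (S.K * a + r₁) (i + 1) z‖)
    (h2 : ∀ z ∈ U, μ ≤ ‖S.F Q B j (S.K * a + r₂) (i + 1) z‖) :
    μ ^ 4 * (U.card : ℝ) ≤ 4 ^ i * (200 * S.C₀ * 15 ^ (i + 1) * S.K) ^ 2 *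
      (45 * S.D * S.K * 36 ^ i) ^ 2 * ∑ z, S.H Q B (j + 1) a i z ^ 2 := by
  have hQ4 : 4 * S.s (i + 1) ≤ Q := S.four_mul_s_le (hij.trans (by omega)) hQ
  have hQ4' : 4 * S.s i ≤ Q := S.four_mul_s_le (by omega) hQ
  set m := S.m (j + 1) a with hmdef
  set w : ZMod Q × ZMod Q → ℝ := fun z => S.ω Q B (j + 1) a i z * S.H Q B (j + 1) a i z with hw
  have hlow : (U.card : ℝ) * ((1 / 2) ^ i * m) ^ 2 * μ ^ 4 ≤
      ∑ z, w z ^ 2 * ‖S.F Q B j (S.K * a + r₁) (i + 1) z *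
        S.F Q B j (S.K * a + r₂) (i + 1) z‖ ^ 2 := by
    have : (U.card : ℝ) * ((1 / 2) ^ i * m) ^ 2 * μ ^ 4 =
        ∑ z ∈ U, ((1 / 2) ^ i * m) ^ 2 * μ ^ 4 := by
      rw [Finset.sum_const, nsmul_eq_mul, mul_assoc]
    rw [this]
    refine (Finset.sum_le_sum fun z hz => ?_).trans
      (Finset.sum_le_sum_of_subset_of_nonneg (Finset.subset_univ U) fun z _ _ => by positivity)
    have a1 := S.ω_ge hB hDB a (by omega : i ≤ j + 1) hQ4' hm z (hT z hz)
    have a2 := S.H_ge hB hDB a (by omega : i + 1 ≤ j + 1) hQ4 z (hT z hz i le_rfl) (hT' z hz)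
    have a3 : (1 / 2) ^ i * m ≤ w z :=
      mul_le_mul a1 a2 hm.le ((by positivity : (0 : ℝ) ≤ (1 / 2) ^ i).trans a1)
    have a4 : μ ^ 4 ≤ ‖S.F Q B j (S.K * a + r₁) (i + 1) z *
        S.F Q B j (S.K * a + r₂) (i + 1) z‖ ^ 2 := by
      rw [norm_mul]
      have := mul_le_mul (h1 z hz) (h2 z hz) hμ (norm_nonneg _)
      calc μ ^ 4 = (μ * μ) ^ 2 := by ring
        _ ≤ _ := pow_le_pow_left₀ (by positivity) this 2
    exact mul_le_mul (pow_le_pow_left₀ (by positivity) a3 2) a4 (by positivity) (sq_nonneg _)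
  have hbil := S.sum_bilinear_le (Q := Q) (B := B) hij hjJ hj hr₁ hr₂ ha hQ
  have hup : ∑ z, w z ^ 2 * S.Sq Q B (j + 1) a (i + 1) z ^ 2 ≤
      (45 * S.D * S.K * 36 ^ i * m) ^ 2 * ∑ z, S.H Q B (j + 1) a i z ^ 2 := by
    rw [Finset.mul_sum]
    refine Finset.sum_le_sum fun z _ => ?_
    have a1 := S.ω_bounds hB hDB a (by omega : i ≤ j + 1) hQ4' hm z
    have a2 := S.Sq_le (B := B) (j + 1) a (i + 1) hQ4 z
    have a3 := S.T_succ_le hB hDB a (by omega : i + 1 ≤ j + 1) hQ4 z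
    have a4 : S.ω Q B (j + 1) a i z * S.Sq Q B (j + 1) a (i + 1) z ≤
        45 * S.D * S.K * 36 ^ i * m := by
      calc _ ≤ S.ω Q B (j + 1) a i z * (5 * S.D * (9 * S.K * S.T Q B (j + 1) a i z)) := by
            refine mul_le_mul_of_nonneg_left (a2.trans ?_) a1.1
            exact mul_le_mul_of_nonneg_left a3 (by positivity)
        _ = 45 * S.D * S.K * (S.ω Q B (j + 1) a i z * S.T Q B (j + 1) a i z) := by ring
        _ ≤ 45 * S.D * S.K * (36 ^ i * m) := mul_le_mul_of_nonneg_left a1.2.2 (by positivity)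
        _ = _ := by ring
    have a5 := pow_le_pow_left₀ (mul_nonneg a1.1 (S.Sq_nonneg (B := B) (j + 1) a (i + 1) z)) a4 2
    calc _ = (S.ω Q B (j + 1) a i z * S.Sq Q B (j + 1) a (i + 1) z) ^ 2 *
          S.H Q B (j + 1) a i z ^ 2 := by rw [hw]; ring
      _ ≤ _ := mul_le_mul_of_nonneg_right a5 (sq_nonneg _)
  have h3 := hlow.trans (hbil.trans (mul_le_mul_of_nonneg_left hup (sq_nonneg _)))
  have hm2 : 0 < m ^ 2 := pow_pos hm 2
  have h4 : ((1 / 2 : ℝ) ^ i) ^ 2 * 4 ^ i = 1 := by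
    rw [← pow_mul, mul_comm i 2, pow_mul, ← mul_pow]; norm_num
  refine le_of_mul_le_mul_right (a := m ^ 2) ?_ hm2
  have h5 := mul_le_mul_of_nonneg_left h3 (by positivity : (0 : ℝ) ≤ 4 ^ i)
  calc μ ^ 4 * (U.card : ℝ) * m ^ 2 = (((1 / 2 : ℝ) ^ i) ^ 2 * 4 ^ i) * (μ ^ 4 * U.card * m ^ 2) := by
        rw [h4, one_mul]
    _ = 4 ^ i * ((U.card : ℝ) * ((1 / 2) ^ i * m) ^ 2 * μ ^ 4) := by ring
    _ ≤ _ := h5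
    _ = _ := by ring

end Setup

namespace Setup

variable (S : Setup) {Q : ℕ} [NeZero Q] {B : ℝ}

/-- Constant absorbing all losses up to level `J`. -/
noncomputable def Z (J : ℕ) : ℝ := 1000 * S.C₀ * 36 ^ J * S.D

variable (J : ℕ)

theorem four_le_K_real : (4 : ℝ) ≤ S.K := by exact_mod_cast S.four_le_K

theorem twenty_K_le : 20 * (S.K : ℝ) ≤ S.D := by
  have := S.four_le_K_real
  rw [D_eq']; nlinarith

theorem one_le_D : (1 : ℝ) ≤ S.D := by exact_mod_cast S.D_pos

theorem mul_le_Z {x y : ℝ} (hx : 0 ≤ x) (hx' : x ≤ S.C₀ * 36 ^ J) (hy : 0 ≤ y) (hy' : y ≤ S.D) :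
    1000 * (x * y) ≤ S.Z J := by
  have : x * y ≤ S.C₀ * 36 ^ J * S.D := mul_le_mul hx' hy' hy (hx.trans hx')
  unfold Z
  linarith

theorem one_le_C₀_mul : 1 ≤ S.C₀ * 36 ^ J :=
  one_le_mul_of_one_le_of_one_le S.one_le_C₀ (one_le_pow₀ (by norm_num))

theorem pow_le_C₀_mul {x : ℝ} {i : ℕ} (hx : 0 ≤ x) (hx' : x ≤ 36) (hi : i ≤ J) :
    x ^ i ≤ S.C₀ * 36 ^ J := by
  have h1 : x ^ i ≤ 36 ^ i := pow_le_pow_left₀ hx hx' i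
  have h2 : (36 : ℝ) ^ i ≤ 36 ^ J := pow_le_pow_right₀ (by norm_num) hi
  have h3 : (36 : ℝ) ^ J ≤ S.C₀ * 36 ^ J :=
    le_mul_of_one_le_left (by positivity) S.one_le_C₀
  linarith

theorem D_le_Z : 1000 * (S.D : ℝ) ≤ S.Z J := by
  have := S.mul_le_Z J zero_le_one (S.one_le_C₀_mul J) (Nat.cast_nonneg S.D) le_rfl
  linarith

theorem one_le_Z : 1000 ≤ S.Z J := by
  have := S.D_le_Z J
  have := S.one_le_D
  linarith

theorem pow_le_Z {x : ℝ} {i : ℕ} (hx : 0 ≤ x) (hx' : x ≤ 36) (hi : i ≤ J) :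
    1000 * (x ^ i * S.D) ≤ S.Z J :=
  S.mul_le_Z J (pow_nonneg hx i) (S.pow_le_C₀_mul J hx hx' hi) (Nat.cast_nonneg S.D) le_rfl

theorem natCast_le_Z : (J : ℝ) ≤ S.Z J := by
  have h1 : (J : ℝ) ≤ 36 ^ J := by
    exact_mod_cast (Nat.lt_pow_self (by norm_num : 1 < 36)).le
  have h2 := S.pow_le_Z J (by norm_num : (0 : ℝ) ≤ 36) le_rfl (le_refl J)
  have h3 := S.one_le_D
  have h4 : (36 : ℝ) ^ J ≤ 36 ^ J * S.D := le_mul_of_one_le_right (by positivity) h3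
  have : (0 : ℝ) ≤ 36 ^ J := by positivity
  linarith

variable {J}

theorem broad_const_le {i : ℕ} (hi : i + 1 ≤ J) {W : ℝ} (hW : 0 ≤ W) :
    (20 * S.K : ℝ) ^ 4 * (4 ^ i * (200 * S.C₀ * 15 ^ (i + 1) * S.K) ^ 2 *
      (45 * S.D * S.K * 36 ^ i) ^ 2 *
      ((1 + 16 * S.C₀ * 15 ^ (i + 1) * S.D * S.K * (1 + S.K ^ 2)) * (2 * S.Z J ^ 6 * W) *
        9 ^ (i + 1))) ≤ S.Z J ^ 23 * W := by
  have hK := S.four_le_K_real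
  have hK0 : (0 : ℝ) ≤ S.K := by linarith
  have hC := S.C₀_pos
  have hKD := S.twenty_K_le
  have hZ1 := S.one_le_Z J
  have hDZ := S.D_le_Z J
  have hD := S.one_le_D
  have hD' := S.D_eq'
  have hCi : S.C₀ * 15 ^ (i + 1) ≤ S.C₀ * 36 ^ J := by
    refine mul_le_mul_of_nonneg_left ?_ hC.le
    exact (pow_le_pow_left₀ (by norm_num) (by norm_num) _).trans
      (pow_le_pow_right₀ (by norm_num) hi)
  have z1 : 20 * (S.K : ℝ) ≤ S.Z J := by linarith
  have z2 : (4 : ℝ) ^ i ≤ S.Z J := by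
    have := S.pow_le_Z J (by norm_num : (0 : ℝ) ≤ 4) (by norm_num) (by omega : i ≤ J)
    have h4 : (4 : ℝ) ^ i ≤ 4 ^ i * S.D := le_mul_of_one_le_right (by positivity) hD
    have : (0 : ℝ) ≤ 4 ^ i := by positivity
    linarith
  have z3 : 200 * S.C₀ * 15 ^ (i + 1) * S.K ≤ S.Z J := by
    have := S.mul_le_Z J (by positivity) hCi hK0 (by linarith)
    have h0 : 0 ≤ S.C₀ * 15 ^ (i + 1) * S.K := by positivity
    linarith
  have z4 : 45 * S.D * S.K * 36 ^ i ≤ S.Z J ^ 2 := by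
    have := S.pow_le_Z J (by norm_num : (0 : ℝ) ≤ 36) le_rfl (by omega : i ≤ J)
    have h0 : (0 : ℝ) ≤ 36 ^ i * S.D := by positivity
    calc 45 * (S.D : ℝ) * S.K * 36 ^ i = (45 * (36 ^ i * S.D)) * S.K := by ring
      _ ≤ S.Z J * S.Z J := mul_le_mul (by linarith) (by linarith) hK0 (by linarith)
      _ = _ := by ring
  have z5 : 1 + 16 * S.C₀ * 15 ^ (i + 1) * S.D * S.K * (1 + S.K ^ 2) ≤ S.Z J ^ 4 := by
    have := S.mul_le_Z J (by positivity) hCi (Nat.cast_nonneg S.D) le_rfl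
    have h0 : 0 ≤ S.C₀ * 15 ^ (i + 1) * S.D := by positivity
    have h1 : (16 * (S.C₀ * 15 ^ (i + 1) * S.D)) * (S.K * (1 + S.K ^ 2)) ≤
        S.Z J * (S.Z J * S.Z J) := by
      refine mul_le_mul (by linarith) ?_ (by positivity) (by linarith)
      refine mul_le_mul (by linarith) ?_ (by positivity) (by linarith)
      nlinarith
    have h2 : 1 ≤ S.Z J ^ 3 := one_le_pow₀ (by linarith)
    nlinarith
  have z6 : (9 : ℝ) ^ (i + 1) ≤ S.Z J := by
    have := S.pow_le_Z J (by norm_num : (0 : ℝ) ≤ 9) (by norm_num) hi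
    have h4 : (9 : ℝ) ^ (i + 1) ≤ 9 ^ (i + 1) * S.D := le_mul_of_one_le_right (by positivity) hD
    have : (0 : ℝ) ≤ 9 ^ (i + 1) := by positivity
    linarith
  have hZ0 : 0 ≤ S.Z J := by linarith
  calc _ ≤ (S.Z J) ^ 4 * (S.Z J * (S.Z J) ^ 2 * (S.Z J ^ 2) ^ 2 *
        (S.Z J ^ 4 * (S.Z J * S.Z J ^ 6 * W) * S.Z J)) := by
        have hpos : 0 ≤ 1 + 16 * S.C₀ * 15 ^ (i + 1) * S.D * S.K * (1 + (S.K : ℝ) ^ 2) := by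
          positivity
        have h2Z : 2 * S.Z J ^ 6 * W ≤ S.Z J * S.Z J ^ 6 * W := by
          gcongr; linarith
        gcongr
    _ = S.Z J ^ 23 * W := by ring

theorem card_mul_sq_le {s : Finset ℕ} (hs : ∀ n ∈ s, n ≤ S.s J) (hQ : 100 * S.Xb J ≤ Q)
    (U : Finset (ZMod Q × ZMod Q)) {μ : ℝ} (hμ : 0 ≤ μ) (hU : ∀ z ∈ U, μ ≤ ‖S.f Q s z‖) :
    (U.card : ℝ) * μ ^ 2 ≤ Q ^ 2 * ∑ n ∈ s, ‖S.b n‖ ^ 2 := by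
  refine le_trans ?_ (S.sum_norm_f_sq_le hs hQ)
  rw [← nsmul_eq_mul]
  refine (Finset.card_nsmul_le_sum U (fun z => ‖S.f Q s z‖ ^ 2) _ fun z hz =>
    pow_le_pow_left₀ hμ (hU z hz) 2).trans ?_
  exact Finset.sum_le_sum_of_subset_of_nonneg (Finset.subset_univ U) fun z _ _ => by positivity

theorem le_s_of_mem_I {j a n : ℕ} (ha : S.s j * a + S.s j ≤ S.s J) (hn : n ∈ S.I j a) :
    n ≤ S.s J := by
  rw [I, Finset.mem_Ico] at hn; omega

set_option maxHeartbeats 1000000 in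
/-- The two-children case when the height is large compared to the `L²` norm. -/
theorem card_pair_le_of_high {j a r₁ r₂ : ℕ} (hjJ : j + 1 ≤ J)
    (hj : 1 ≤ S.h * S.s (j + 1)) (hr₁ : r₁ + 2 ≤ r₂)
    (hr₂ : r₂ < S.K) (ha : S.s (j + 1) * a + S.s (j + 1) ≤ S.s J) (hQ : 100 * S.Xb J ≤ Q)
    {t : ℝ} (ht : 0 < t) (hm : 0 < S.m (j + 1) a) (htm : S.Z J ^ 2 * S.m (j + 1) a < t ^ 2)
    (U : Finset (ZMod Q × ZMod Q))
    (h1 : ∀ z ∈ U, t / (10 * S.K) ≤ ‖S.f Q (S.I j (S.K * a + r₁)) z‖)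
    (h2 : ∀ z ∈ U, t / (10 * S.K) ≤ ‖S.f Q (S.I j (S.K * a + r₂)) z‖) :
    t ^ 4 * (U.card : ℝ) ≤ S.Z J ^ 24 * (Q ^ 2 *
      (S.m (j + 1) a / S.h + S.m (j + 1) a ^ 3 / t ^ 2)) := by
  classical
  have hK := S.four_le_K_real
  have hK0 : (0 : ℝ) < S.K := by linarith
  have hKD := S.twenty_K_le
  have hZ1 := S.one_le_Z J
  have hZ0 : 0 < S.Z J := by linarith
  have hDZ := S.D_le_Z J
  have hD := S.one_le_D
  have hh := S.h_pos
  set m := S.m (j + 1) a with hmdef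
  set B : ℝ := S.Z J ^ 3 * (m / t + 1 / Real.sqrt S.h) with hBdef
  have hsq : 0 < Real.sqrt S.h := Real.sqrt_pos.2 hh
  have hB : 0 < B := by positivity
  have hDB : (S.D : ℝ) ^ 2 ≤ S.h * B ^ 2 := by
    have e1 : S.D * (1 / Real.sqrt S.h) ≤ B := by
      rw [hBdef]
      have : (S.D : ℝ) ≤ S.Z J ^ 3 := by
        have : S.Z J ≤ S.Z J ^ 3 := le_self_pow₀ (by linarith) (by norm_num)
        linarith
      refine mul_le_mul this ?_ (by positivity) (by positivity)
      have : 0 < m / t := by positivity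
      linarith
    have e2 := pow_le_pow_left₀ (by positivity) e1 2
    have e3 : S.h * (S.D * (1 / Real.sqrt S.h)) ^ 2 = (S.D : ℝ) ^ 2 := by
      rw [mul_pow, div_pow, Real.sq_sqrt hh.le]; field_simp
    rw [← e3]
    exact mul_le_mul_of_nonneg_left e2 hh.le
  have hB2 : B ^ 2 ≤ 2 * S.Z J ^ 6 * (m ^ 2 / t ^ 2 + 1 / S.h) := by
    have e1 : (m / t + 1 / Real.sqrt S.h) ^ 2 ≤ 2 * (m ^ 2 / t ^ 2 + 1 / S.h) := by
      have e2 : m ^ 2 / t ^ 2 = (m / t) ^ 2 := by rw [div_pow]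
      have e3 : 1 / S.h = (1 / Real.sqrt S.h) ^ 2 := by rw [div_pow, Real.sq_sqrt hh.le, one_pow]
      rw [e2, e3]
      nlinarith [sq_nonneg (m / t - 1 / Real.sqrt S.h)]
    rw [hBdef, mul_pow, ← pow_mul]
    have := mul_le_mul_of_nonneg_left e1 (by positivity : (0 : ℝ) ≤ S.Z J ^ (3 * 2))
    calc _ ≤ _ := this
      _ = _ := by ring
  have hmB : m / B ≤ t / S.Z J ^ 3 := by
    rw [div_le_div_iff₀ hB (by positivity)]
    have : S.Z J ^ 3 * (m / t) ≤ B := by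
      rw [hBdef]
      refine mul_le_mul_of_nonneg_left ?_ (by positivity)
      have : 0 < 1 / Real.sqrt S.h := by positivity
      linarith
    have e := mul_le_mul_of_nonneg_left this ht.le
    have e2 : t * (S.Z J ^ 3 * (m / t)) = m * S.Z J ^ 3 := by field_simp
    linarith
  have h4s : ∀ l ≤ j, 4 * S.s l ≤ Q := fun l hl => S.four_mul_s_le (by omega) hQ
  have hprune : ∀ r < S.K, ∀ i ≤ j, ∀ z,
      (∀ l < i, S.T Q B (j + 1) a l z ≤ 18 ^ l * m) →
      t / (10 * S.K) ≤ ‖S.f Q (S.I j (S.K * a + r)) z‖ →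
      t / (20 * S.K) + t / (40 * S.K) ≤ ‖S.F Q B j (S.K * a + r) i z‖ := by
    intro r hr i hi z hT hf
    have e1 := S.norm_F_sub_le hB hDB (S.K * a + r) hi (h4s i hi) hm.le z
      (fun l hl => (S.T_child_le a hr (by omega) z).trans (hT l hl))
    rw [F_zero_eq] at e1
    have e2 := norm_sub_norm_le (S.f Q (S.I j (S.K * a + r)) z) (S.F Q B j (S.K * a + r) i z)
    have e3 : 18 ^ i * ((S.D : ℝ) ^ 2 * m / B) ≤ t / (40 * S.K) := by
      have q1 := S.pow_le_Z J (by norm_num : (0 : ℝ) ≤ 18) (by norm_num) (by omega : i ≤ J)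
      have q0 : (0 : ℝ) ≤ 18 ^ i * S.D := by positivity
      have q2 : 18 ^ i * (S.D : ℝ) ^ 2 * (40 * S.K) ≤ S.Z J ^ 3 := by
        calc 18 ^ i * (S.D : ℝ) ^ 2 * (40 * S.K) = (40 * (18 ^ i * S.D)) * S.D * S.K := by ring
          _ ≤ S.Z J * S.Z J * S.Z J := by
              refine mul_le_mul (mul_le_mul ?_ ?_ (by positivity) hZ0.le) ?_ hK0.le (by positivity)
              all_goals linarith
          _ = _ := by ring
      calc _ = 18 ^ i * (S.D : ℝ) ^ 2 * (m / B) := by ring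
        _ ≤ 18 ^ i * (S.D : ℝ) ^ 2 * (t / S.Z J ^ 3) :=
            mul_le_mul_of_nonneg_left hmB (by positivity)
        _ ≤ t / (40 * S.K) := by
            rw [mul_div_assoc', div_le_div_iff₀ (by positivity) (by positivity)]
            have := mul_le_mul_of_nonneg_left q2 ht.le
            linarith
    have e4 : t / (10 * S.K) = t / (20 * S.K) + t / (40 * S.K) + t / (40 * S.K) := by
      field_simp; norm_num
    linarith
  set P : ℕ → ZMod Q × ZMod Q → Prop := fun i z =>
    (∀ l ≤ i, S.T Q B (j + 1) a l z ≤ 18 ^ l * m) ∧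
      18 ^ (i + 1) * m < S.T Q B (j + 1) a (i + 1) z with hP
  have hcover : ∀ z ∈ U, ∃ i < j, P i z := by
    intro z hz
    by_contra hno
    push Not at hno
    have hall : ∀ i ≤ j, ∀ l ≤ i, S.T Q B (j + 1) a l z ≤ 18 ^ l * m := by
      intro i
      induction i with
      | zero =>
        intro _ l hl
        obtain rfl : l = 0 := by omega
        simpa using S.T_zero_le (B := B) (j + 1) a (h4s 0 (Nat.zero_le j)) z
      | succ i ih =>
        intro hi l hl
        rcases Nat.lt_or_ge l (i + 1) with h | h
        · exact ih (by omega) l (by omega)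
        · obtain rfl : l = i + 1 := by omega
          by_contra hc
          exact hno i (by omega) ⟨ih (by omega), not_le.1 hc⟩
    have e1 := hprune r₁ (by omega) j le_rfl z (fun l hl => hall j le_rfl l hl.le) (h1 z hz)
    have e2 : ‖S.F Q B j (S.K * a + r₁) j z‖ ^ 2 ≤ 5 * S.D * (18 ^ j * m) := by
      have q1 : S.Sq Q B j (S.K * a + r₁) j z = ‖S.F Q B j (S.K * a + r₁) j z‖ ^ 2 := by
        rw [Sq, F, idx_self, Finset.sum_singleton, Finset.sum_singleton]
      rw [← q1]
      refine (S.Sq_le j _ j (h4s j le_rfl) z).trans (mul_le_mul_of_nonneg_left ?_ (by positivity))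
      exact (S.T_child_le a (by omega) le_rfl z).trans (hall j le_rfl j le_rfl)
    have e3 : (t / (20 * S.K)) ^ 2 ≤ 5 * S.D * (18 ^ j * m) := by
      refine le_trans (pow_le_pow_left₀ (by positivity) ?_ 2) e2
      have : 0 < t / (40 * S.K) := by positivity
      linarith
    rw [div_pow, div_le_iff₀ (by positivity)] at e3
    have q1 := S.pow_le_Z J (by norm_num : (0 : ℝ) ≤ 18) (by norm_num) (by omega : j ≤ J)
    have q0 : (0 : ℝ) ≤ 18 ^ j * S.D := by positivity
    have q2 : 5 * (18 ^ j * (S.D : ℝ)) * (20 * S.K) ^ 2 ≤ S.Z J * S.Z J := by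
      refine mul_le_mul (by linarith) ?_ (by positivity) hZ0.le
      have := S.D_eq'
      nlinarith
    have q3 := mul_le_mul_of_nonneg_right q2 hm.le
    nlinarith
  have hcard : (U.card : ℝ) ≤ ∑ i ∈ range j, ((U.filter (P i)).card : ℝ) := by
    have e1 : U ⊆ (range j).biUnion fun i => U.filter (P i) := by
      intro z hz
      obtain ⟨i, hi, hPi⟩ := hcover z hz
      rw [Finset.mem_biUnion]
      exact ⟨i, Finset.mem_range.2 hi, Finset.mem_filter.2 ⟨hz, hPi⟩⟩
    exact_mod_cast (Finset.card_le_card e1).trans Finset.card_biUnion_le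
  have hterm : ∀ i ∈ range j, t ^ 4 * ((U.filter (P i)).card : ℝ) ≤
      S.Z J ^ 23 * (Q ^ 2 * (m / S.h + m ^ 3 / t ^ 2)) := by
    intro i hi
    rw [Finset.mem_range] at hi
    have e1 := S.card_broad_le hB hDB (by omega : i + 1 ≤ j) hjJ hj hr₁ hr₂ ha hQ hm
      (μ := t / (20 * S.K)) (by positivity) (U.filter (P i))
      (fun z hz => (Finset.mem_filter.1 hz).2.1) (fun z hz => (Finset.mem_filter.1 hz).2.2)
      (fun z hz => by
        have := hprune r₁ (by omega) (i + 1) (by omega) z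
          (fun l hl => (Finset.mem_filter.1 hz).2.1 l (by omega)) (h1 z (Finset.mem_filter.1 hz).1)
        have : 0 < t / (40 * S.K) := by positivity
        linarith)
      (fun z hz => by
        have := hprune r₂ hr₂ (i + 1) (by omega) z
          (fun l hl => (Finset.mem_filter.1 hz).2.1 l (by omega)) (h2 z (Finset.mem_filter.1 hz).1)
        have : 0 < t / (40 * S.K) := by positivity
        linarith)
    have e2 := S.sum_H_sq_le' hB hDB (by omega : i + 1 ≤ j + 1) hjJ ha hQ
    set W : ℝ := Q ^ 2 * (m / S.h + m ^ 3 / t ^ 2) with hW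
    have hW0 : 0 ≤ W := by positivity
    set X : ℝ := 1 + 16 * S.C₀ * 15 ^ (i + 1) * S.D * S.K * (1 + S.K ^ 2) with hX
    have hX0 : 0 ≤ X := by have := S.C₀_pos; positivity
    have e3 : ∑ z, S.H Q B (j + 1) a i z ^ 2 ≤ X * (2 * S.Z J ^ 6 * W) * 9 ^ (i + 1) := by
      refine e2.trans ?_
      have : X * B ^ 2 * (9 ^ (i + 1) * ((Q : ℝ) ^ 2 * m)) ≤
          X * (2 * S.Z J ^ 6 * (m ^ 2 / t ^ 2 + 1 / S.h)) * (9 ^ (i + 1) * ((Q : ℝ) ^ 2 * m)) := by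
        refine mul_le_mul_of_nonneg_right (mul_le_mul_of_nonneg_left hB2 hX0) (by positivity)
      refine this.trans (le_of_eq ?_)
      rw [hW]; ring
    have e4 := S.broad_const_le (by omega : i + 1 ≤ J) hW0
    refine le_trans ?_ e4
    have e5 : t ^ 4 * ((U.filter (P i)).card : ℝ) =
        (20 * S.K : ℝ) ^ 4 * ((t / (20 * S.K)) ^ 4 * ((U.filter (P i)).card : ℝ)) := by
      rw [div_pow]; field_simp
    rw [e5]
    refine mul_le_mul_of_nonneg_left (e1.trans (mul_le_mul_of_nonneg_left e3 ?_)) (by positivity)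
    have := S.C₀_pos
    positivity
  have hfin := mul_le_mul_of_nonneg_left hcard (by positivity : 0 ≤ t ^ 4)
  rw [Finset.mul_sum] at hfin
  refine hfin.trans ((Finset.sum_le_sum hterm).trans ?_)
  rw [Finset.sum_const, Finset.card_range, nsmul_eq_mul, pow_succ' _ 23, mul_assoc (S.Z J)]
  refine mul_le_mul_of_nonneg_right ?_ (by positivity)
  have h5 := S.natCast_le_Z J
  have : (j : ℝ) ≤ J := by exact_mod_cast (by omega : j ≤ J)
  linarith

theorem card_pair_le {j a r₁ r₂ : ℕ} (hjJ : j + 1 ≤ J)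
    (hj : 1 ≤ S.h * S.s (j + 1)) (hr₁ : r₁ + 2 ≤ r₂)
    (hr₂ : r₂ < S.K) (ha : S.s (j + 1) * a + S.s (j + 1) ≤ S.s J) (hQ : 100 * S.Xb J ≤ Q)
    {t : ℝ} (ht : 0 < t) (U : Finset (ZMod Q × ZMod Q))
    (h1 : ∀ z ∈ U, t / (10 * S.K) ≤ ‖S.f Q (S.I j (S.K * a + r₁)) z‖)
    (h2 : ∀ z ∈ U, t / (10 * S.K) ≤ ‖S.f Q (S.I j (S.K * a + r₂)) z‖) :
    t ^ 4 * (U.card : ℝ) ≤ S.Z J ^ 24 * (Q ^ 2 *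
      (S.m (j + 1) a / S.h + S.m (j + 1) a ^ 3 / t ^ 2)) := by
  have hK := S.four_le_K_real
  have hK0 : (0 : ℝ) < S.K := by linarith
  have hZ1 := S.one_le_Z J
  have hZ0 : 0 < S.Z J := by linarith
  have hDZ := S.D_le_Z J
  have hh := S.h_pos
  have hm0 := S.m_nonneg (j + 1) a
  have hL := S.card_mul_sq_le (fun n hn => S.le_s_of_mem_I
    ((S.child_le (j := j) (a := a) (r := r₁) (by omega)).trans ha) hn) hQ U (by positivity) h1
  rw [← m_eq] at hL
  have hL' : (U.card : ℝ) * (t / (10 * S.K)) ^ 2 ≤ Q ^ 2 * S.m (j + 1) a :=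
    hL.trans (mul_le_mul_of_nonneg_left (S.m_child_le j a (by omega)) (sq_nonneg _))
  rcases le_or_gt (t ^ 2) (S.Z J ^ 2 * S.m (j + 1) a) with h | h
  · set m := S.m (j + 1) a with hm
    have e1 : t ^ 4 * (U.card : ℝ) =
        100 * S.K ^ 2 * t ^ 2 * ((U.card : ℝ) * (t / (10 * S.K)) ^ 2) := by
      rw [div_pow]; field_simp; ring
    have e2 : t ^ 2 * m ≤ S.Z J ^ 4 * (m ^ 3 / t ^ 2) := by
      rw [mul_div_assoc', le_div_iff₀ (by positivity)]
      have := mul_le_mul h h (by positivity) (by positivity)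
      have := mul_le_mul_of_nonneg_right this hm0
      linarith
    have e3 : 100 * (S.K : ℝ) ^ 2 ≤ S.Z J := by
      have := S.D_eq'
      linarith
    rw [e1]
    calc _ ≤ 100 * S.K ^ 2 * t ^ 2 * (Q ^ 2 * m) :=
          mul_le_mul_of_nonneg_left hL' (by positivity)
      _ = 100 * S.K ^ 2 * (Q ^ 2 * (t ^ 2 * m)) := by ring
      _ ≤ S.Z J * (Q ^ 2 * (S.Z J ^ 4 * (m ^ 3 / t ^ 2))) := by gcongr
      _ = S.Z J ^ 5 * (Q ^ 2 * (m ^ 3 / t ^ 2)) := by ring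
      _ ≤ S.Z J ^ 24 * (Q ^ 2 * (m / S.h + m ^ 3 / t ^ 2)) := by
          refine mul_le_mul (pow_le_pow_right₀ (by linarith) (by norm_num)) ?_ (by positivity)
            (by positivity)
          refine mul_le_mul_of_nonneg_left ?_ (sq_nonneg _)
          have : 0 ≤ m / S.h := by positivity
          linarith
  · rcases hm0.lt_or_eq with hm | hm
    · exact S.card_pair_le_of_high hjJ hj hr₁ hr₂ ha hQ ht hm h U h1 h2
    · rw [← hm, mul_zero] at hL'
      have : (U.card : ℝ) = 0 := by
        have h5 : 0 < (t / (10 * S.K)) ^ 2 := by positivity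
        nlinarith [Nat.cast_nonneg (α := ℝ) U.card]
      rw [this, mul_zero]
      positivity

end Setup

/-- Broad-narrow dichotomy for nonnegative summands. -/
theorem exists_large_or_separated {K : ℕ} (hK : 0 < K) {x : ℕ → ℝ} {t : ℝ} (ht : 0 < t)
    (hx : t ≤ ∑ r ∈ range K, x r) :
    (∃ r < K, t / 4 ≤ x r) ∨
      ∃ r₁ r₂, r₁ + 2 ≤ r₂ ∧ r₂ < K ∧ t / (10 * K) ≤ x r₁ ∧ t / (10 * K) ≤ x r₂ := by
  by_contra hno
  push Not at hno
  obtain ⟨hsmall, hpair⟩ := hno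
  have hK0 : (0 : ℝ) < K := by exact_mod_cast hK
  set V := (range K).filter fun r : ℕ => t / (10 * K) ≤ x r with hV
  have hV2 : V.card ≤ 2 := by
    rcases V.eq_empty_or_nonempty with h | h
    · simp [h]
    · have hsub : V ⊆ {V.min' h, V.min' h + 1} := by
        intro r hr
        have hle := V.min'_le r hr
        have hmem := V.min'_mem h
        replace hr := Finset.mem_filter.1 hr
        replace hmem := Finset.mem_filter.1 hmem
        rw [Finset.mem_range] at hr hmem
        by_contra hc
        rw [Finset.mem_insert, Finset.mem_singleton, not_or] at hc
        exact absurd hr.2 (not_le.2 (hpair _ r (by omega) hr.1 hmem.2))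
      exact (Finset.card_le_card hsub).trans Finset.card_le_two
  have h1 : ∑ r ∈ V, x r ≤ 2 * (t / 4) := by
    have e1 : ∑ r ∈ V, x r ≤ V.card • (t / 4) := by
      refine Finset.sum_le_card_nsmul _ _ _ fun r hr => ?_
      rw [hV, Finset.mem_filter, Finset.mem_range] at hr
      exact (hsmall r hr.1).le
    rw [nsmul_eq_mul] at e1
    refine e1.trans (mul_le_mul_of_nonneg_right ?_ (by positivity))
    exact_mod_cast hV2
  have h2 : ∑ r ∈ (range K).filter (fun r : ℕ => ¬ t / (10 * K) ≤ x r), x r ≤ t / 10 := by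
    have e1 : ∑ r ∈ (range K).filter (fun r : ℕ => ¬ t / (10 * K) ≤ x r), x r ≤
        ((range K).filter (fun r : ℕ => ¬ t / (10 * K) ≤ x r)).card • (t / (10 * K)) := by
      refine Finset.sum_le_card_nsmul _ _ _ fun r hr => ?_
      rw [Finset.mem_filter] at hr
      exact (not_le.1 hr.2).le
    have e2 : (((range K).filter (fun r : ℕ => ¬ t / (10 * K) ≤ x r)).card : ℝ) ≤ K := by
      have := Finset.card_filter_le (range K) (fun r : ℕ => ¬ t / (10 * K) ≤ x r)
      rw [Finset.card_range] at this
      exact_mod_cast this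
    rw [nsmul_eq_mul] at e1
    refine e1.trans ((mul_le_mul_of_nonneg_right e2 (by positivity)).trans (le_of_eq ?_))
    field_simp
  rw [← Finset.sum_filter_add_sum_filter_not (range K) (fun r : ℕ => t / (10 * K) ≤ x r)] at hx
  linarith

theorem sum_pow_three_le {ι : Type*} (s : Finset ι) {x : ι → ℝ} (hx : ∀ i ∈ s, 0 ≤ x i) :
    ∑ i ∈ s, x i ^ 3 ≤ (∑ i ∈ s, x i) ^ 3 := by
  have h : ∀ i ∈ s, x i ^ 3 ≤ x i * (∑ i ∈ s, x i) ^ 2 := by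
    intro i hi
    have := Finset.single_le_sum hx hi
    rw [pow_succ' _ 2]
    exact mul_le_mul_of_nonneg_left (pow_le_pow_left₀ (hx i hi) this 2) (hx i hi)
  refine (Finset.sum_le_sum h).trans (le_of_eq ?_)
  rw [← Finset.sum_mul]; ring

namespace Setup

variable (S : Setup) {Q : ℕ} [NeZero Q] {J : ℕ}

theorem card_mul_pow_four_le {p L : ℕ} (hL : 1 ≤ L) (hpL : p + L ≤ S.s J)
    (hQ : 100 * S.Xb J ≤ Q) (U : Finset (ZMod Q × ZMod Q)) {t : ℝ} (ht : 0 ≤ t)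
    (hU : ∀ z ∈ U, t ≤ ‖S.f Q (Ico p (p + L)) z‖) :
    t ^ 4 * (U.card : ℝ) ≤ Q ^ 2 *
      ((2 * L + 16 / S.h * (1 + Real.log L)) * ∑ n ∈ Ico p (p + L), ‖S.b n‖ ^ 2) := by
  refine le_trans ?_ (S.sum_norm_f_pow_four_le hL hpL hQ)
  rw [mul_comm, ← nsmul_eq_mul]
  refine (Finset.card_nsmul_le_sum U (fun z => ‖S.f Q (Ico p (p + L)) z‖ ^ 4) _ fun z hz =>
    pow_le_pow_left₀ ht (hU z hz) 4).trans ?_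
  exact Finset.sum_le_sum_of_subset_of_nonneg (Finset.subset_univ U) fun z _ _ => by positivity

theorem norm_f_le_card (s : Finset ℕ) (z : ZMod Q × ZMod Q) : ‖S.f Q s z‖ ≤ s.card := by
  unfold f
  refine (norm_sum_le _ _).trans ?_
  refine (Finset.sum_le_card_nsmul _ _ 1 fun n _ => ?_).trans (by simp)
  rw [norm_mul, norm_chr, mul_one]
  exact S.norm_b_le n

theorem card_level_zero_le {a : ℕ} (ha : S.s 0 * a + S.s 0 ≤ S.s J) (hQ : 100 * S.Xb J ≤ Q)
    {t : ℝ} (ht : 0 < t) (U : Finset (ZMod Q × ZMod Q))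
    (hU : ∀ z ∈ U, t ≤ ‖S.f Q (S.I 0 a) z‖) :
    t ^ 4 * (U.card : ℝ) ≤ S.Z J ^ 2 * (Q ^ 2 * (S.m 0 a / S.h)) := by
  have hm := S.m_nonneg 0 a
  have hh := S.h_pos
  have hD := S.one_le_D
  have hDZ := S.D_le_Z J
  rcases U.eq_empty_or_nonempty with rfl | ⟨z, hz⟩
  · simp; positivity
  have htD : t ≤ S.D := by
    refine (hU z hz).trans ((S.norm_f_le_card _ z).trans (le_of_eq ?_))
    simp [I, s]
  have h1 := S.card_mul_sq_le (fun n hn => S.le_s_of_mem_I ha hn) hQ U ht.le hU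
  rw [← m_eq] at h1
  have h2 : S.m 0 a ≤ S.m 0 a / S.h := by
    rw [le_div_iff₀ hh]
    exact mul_le_of_le_one_right hm S.h_le_one
  calc t ^ 4 * (U.card : ℝ) = t ^ 2 * ((U.card : ℝ) * t ^ 2) := by ring
    _ ≤ S.Z J ^ 2 * (Q ^ 2 * (S.m 0 a / S.h)) := by
        refine mul_le_mul (pow_le_pow_left₀ ht.le (by linarith) 2) (h1.trans ?_) (by positivity)
          (by positivity)
        exact mul_le_mul_of_nonneg_left h2 (sq_nonneg _)

theorem log_s_le (j : ℕ) : Real.log (S.s j) ≤ (j + 1) * S.D := by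
  have hD := S.one_le_D
  have hK := S.four_le_K_real
  have hKD := S.twenty_K_le
  have h1 := Real.log_le_self (Nat.cast_nonneg (α := ℝ) S.D)
  have h2 := Real.log_le_self (Nat.cast_nonneg (α := ℝ) S.K)
  unfold s
  push_cast
  rw [Real.log_mul (by linarith) (pow_ne_zero _ (by linarith)), Real.log_pow]
  have : (j : ℝ) * Real.log S.K ≤ j * S.D :=
    mul_le_mul_of_nonneg_left (by linarith) (Nat.cast_nonneg j)
  linarith

theorem card_level_short_le {j a : ℕ} (hjJ : j ≤ J) (hj : S.h * S.s j ≤ 1)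
    (ha : S.s j * a + S.s j ≤ S.s J) (hQ : 100 * S.Xb J ≤ Q)
    {t : ℝ} (ht : 0 < t) (U : Finset (ZMod Q × ZMod Q))
    (hU : ∀ z ∈ U, t ≤ ‖S.f Q (S.I j a) z‖) :
    t ^ 4 * (U.card : ℝ) ≤ S.Z J ^ 3 * (Q ^ 2 * (S.m j a / S.h)) := by
  have hm := S.m_nonneg j a
  have hh := S.h_pos
  have hD := S.one_le_D
  have hDZ := S.D_le_Z J
  have hZ := S.one_le_Z J
  have hJZ := S.natCast_le_Z J
  have hj' : (j : ℝ) ≤ J := by exact_mod_cast hjJ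
  have h1 := S.card_mul_pow_four_le (S.s_pos j) ha hQ U ht.le hU
  have h2 := S.log_s_le j
  have h3 : (2 * (S.s j : ℝ) + 16 / S.h * (1 + Real.log (S.s j))) ≤ S.Z J ^ 3 / S.h := by
    have e1 : (S.s j : ℝ) ≤ 1 / S.h := by rw [le_div_iff₀ hh]; linarith
    have e2 : (j + 1) * (S.D : ℝ) ≤ (S.Z J + 1) * (S.Z J) :=
      mul_le_mul (by linarith) (by linarith) (by linarith) (by linarith)
    have e3 : 2 + 16 * (1 + Real.log (S.s j)) ≤ S.Z J ^ 3 := by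
      nlinarith [sq_nonneg (S.Z J)]
    have e4 : 2 * (1 / S.h) + 16 / S.h * (1 + Real.log (S.s j)) =
        (2 + 16 * (1 + Real.log (S.s j))) / S.h := by ring
    have e5 := div_le_div_of_nonneg_right e3 hh.le
    linarith
  refine h1.trans ?_
  have h4 := S.m_eq j a
  rw [I] at h4
  rw [← h4]
  calc _ ≤ (Q : ℝ) ^ 2 * (S.Z J ^ 3 / S.h * S.m j a) :=
        mul_le_mul_of_nonneg_left (mul_le_mul_of_nonneg_right h3 hm) (sq_nonneg _)
    _ = _ := by ring

/-- Level set estimate for blocks at level `j`. -/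
theorem card_level_le (hQ : 100 * S.Xb J ≤ Q) {j : ℕ} (hjJ : j ≤ J) (a : ℕ)
    (ha : S.s j * a + S.s j ≤ S.s J) {t : ℝ} (ht : 0 < t)
    (U : Finset (ZMod Q × ZMod Q)) (hU : ∀ z ∈ U, t ≤ ‖S.f Q (S.I j a) z‖) :
    t ^ 4 * (U.card : ℝ) ≤
      S.Z J ^ 25 * 5001 ^ j * (Q ^ 2 * (S.m j a / S.h + S.m j a ^ 3 / t ^ 2)) := by
  classical
  have hh := S.h_pos
  have hZ := S.one_le_Z J
  have hZ0 : 0 < S.Z J := by linarith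
  have hweak : ∀ (j' a' e : ℕ) (t : ℝ), e ≤ 25 → ∀ x : ℝ,
      x ≤ S.Z J ^ e * (Q ^ 2 * (S.m j' a' / S.h)) →
      x ≤ S.Z J ^ 25 * 5001 ^ j' * (Q ^ 2 * (S.m j' a' / S.h + S.m j' a' ^ 3 / t ^ 2)) := by
    intro j' a' e t he x hx
    have hm := S.m_nonneg j' a'
    refine hx.trans (mul_le_mul ?_ ?_ (by positivity) (by positivity))
    · exact (pow_le_pow_right₀ (by linarith) he).trans
        (le_mul_of_one_le_right (by positivity) (one_le_pow₀ (by norm_num)))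
    · refine mul_le_mul_of_nonneg_left ?_ (sq_nonneg _)
      have : 0 ≤ S.m j' a' ^ 3 / t ^ 2 := by positivity
      linarith
  induction j generalizing a t U with
  | zero => exact hweak 0 a 2 t (by norm_num) _ (S.card_level_zero_le ha hQ ht U hU)
  | succ j ih =>
    rcases le_or_gt (S.h * S.s (j + 1)) 1 with hs | hs
    · exact hweak (j + 1) a 3 t (by norm_num) _ (S.card_level_short_le hjJ hs ha hQ ht U hU)
    set m := S.m (j + 1) a with hmdef
    have hm : 0 ≤ m := S.m_nonneg (j + 1) a
    set N : ℕ → Finset (ZMod Q × ZMod Q) := fun r =>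
      U.filter fun z => t / 4 ≤ ‖S.f Q (S.I j (S.K * a + r)) z‖ with hN
    set P : ℕ × ℕ → Finset (ZMod Q × ZMod Q) := fun r =>
      U.filter fun z => r.1 + 2 ≤ r.2 ∧ t / (10 * S.K) ≤ ‖S.f Q (S.I j (S.K * a + r.1)) z‖ ∧
        t / (10 * S.K) ≤ ‖S.f Q (S.I j (S.K * a + r.2)) z‖ with hP
    have hcover : U ⊆ (range S.K).biUnion N ∪ (range S.K ×ˢ range S.K).biUnion P := by
      intro z hz
      have hz' := hU z hz
      rw [f_succ] at hz'
      rw [Finset.mem_union, Finset.mem_biUnion, Finset.mem_biUnion]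
      rcases exists_large_or_separated S.K_pos ht (hz'.trans (norm_sum_le _ _)) with
        ⟨r, hr, h⟩ | ⟨r₁, r₂, h12, hr₂, h1, h2⟩
      · exact Or.inl ⟨r, Finset.mem_range.2 hr, Finset.mem_filter.2 ⟨hz, h⟩⟩
      · refine Or.inr ⟨(r₁, r₂), Finset.mem_product.2 ⟨Finset.mem_range.2 ?_,
          Finset.mem_range.2 hr₂⟩, Finset.mem_filter.2 ⟨hz, h12, h1, h2⟩⟩
        dsimp only
        omega
    have hcard : (U.card : ℝ) ≤ ∑ r ∈ range S.K, ((N r).card : ℝ) +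
        ∑ r ∈ range S.K ×ˢ range S.K, ((P r).card : ℝ) := by
      have := (Finset.card_le_card hcover).trans ((Finset.card_union_le _ _).trans
        (add_le_add Finset.card_biUnion_le Finset.card_biUnion_le))
      exact_mod_cast this
    set W : ℝ := Q ^ 2 * (m / S.h + m ^ 3 / t ^ 2) with hW
    have hW0 : 0 ≤ W := by positivity
    have hnarrow : ∑ r ∈ range S.K, t ^ 4 * ((N r).card : ℝ) ≤
        4096 * (S.Z J ^ 25 * 5001 ^ j) * W := by
      have e1 : ∀ r ∈ range S.K, t ^ 4 * ((N r).card : ℝ) ≤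
          256 * (S.Z J ^ 25 * 5001 ^ j) * Q ^ 2 *
            (S.m j (S.K * a + r) / S.h + 16 / t ^ 2 * S.m j (S.K * a + r) ^ 3) := by
        intro r hr
        rw [Finset.mem_range] at hr
        have := ih (by omega) (S.K * a + r) ((S.child_le hr).trans ha) (t := t / 4)
          (by positivity) (N r) (fun z hz => (Finset.mem_filter.1 hz).2)
        have e2 : t ^ 4 * ((N r).card : ℝ) = 256 * ((t / 4) ^ 4 * ((N r).card : ℝ)) := by ring
        rw [e2]
        refine (mul_le_mul_of_nonneg_left this (by norm_num)).trans (le_of_eq ?_)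
        rw [div_pow]
        field_simp
        ring
      refine (Finset.sum_le_sum e1).trans ?_
      rw [← Finset.mul_sum, Finset.sum_add_distrib, ← Finset.sum_div, ← Finset.mul_sum, ← m_succ]
      have e3 := sum_pow_three_le (range S.K) (x := fun r => S.m j (S.K * a + r))
        (fun r _ => S.m_nonneg _ _)
      rw [← m_succ] at e3
      have e4 : m / S.h + 16 / t ^ 2 * ∑ r ∈ range S.K, S.m j (S.K * a + r) ^ 3 ≤
          16 * (m / S.h + m ^ 3 / t ^ 2) := by
        have e5 := mul_le_mul_of_nonneg_left e3 (by positivity : 0 ≤ 16 / t ^ 2)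
        have e6 : 16 / t ^ 2 * m ^ 3 = 16 * (m ^ 3 / t ^ 2) := by ring
        have : 0 ≤ m / S.h := by positivity
        linarith
      refine (mul_le_mul_of_nonneg_left e4 (by positivity)).trans (le_of_eq ?_)
      rw [hW]; ring
    have hbroad : ∑ r ∈ range S.K ×ˢ range S.K, t ^ 4 * ((P r).card : ℝ) ≤ S.Z J ^ 25 * W := by
      have e1 : ∀ r ∈ range S.K ×ˢ range S.K, t ^ 4 * ((P r).card : ℝ) ≤ S.Z J ^ 24 * W := by
        rintro ⟨r₁, r₂⟩ hr
        rw [Finset.mem_product, Finset.mem_range, Finset.mem_range] at hr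
        by_cases h12 : r₁ + 2 ≤ r₂
        · exact S.card_pair_le hjJ hs.le h12 hr.2 ha hQ ht _
            (fun z hz => (Finset.mem_filter.1 hz).2.2.1) (fun z hz => (Finset.mem_filter.1 hz).2.2.2)
        · have : P (r₁, r₂) = ∅ := by
            rw [hP]; simp [h12]
          rw [this]
          simp only [Finset.card_empty, Nat.cast_zero, mul_zero]
          positivity
      refine (Finset.sum_le_card_nsmul _ _ _ e1).trans ?_
      rw [Finset.card_product, Finset.card_range, nsmul_eq_mul, pow_succ' _ 24, mul_assoc (S.Z J)]
      refine mul_le_mul_of_nonneg_right ?_ (by positivity)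
      push_cast
      have := S.D_le_Z J
      have := S.D_eq'
      nlinarith [sq_nonneg (S.K : ℝ)]
    have hfin := mul_le_mul_of_nonneg_left hcard (by positivity : 0 ≤ t ^ 4)
    rw [mul_add, Finset.mul_sum, Finset.mul_sum] at hfin
    refine hfin.trans ((add_le_add hnarrow hbroad).trans ?_)
    have e1 : S.Z J ^ 25 * W ≤ 5 * (S.Z J ^ 25 * 5001 ^ j) * W := by
      refine mul_le_mul_of_nonneg_right ?_ hW0
      have : (1 : ℝ) ≤ 5001 ^ j := one_le_pow₀ (by norm_num)
      have := le_mul_of_one_le_right (by positivity : 0 ≤ S.Z J ^ 25) this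
      have : 0 < S.Z J ^ 25 := by positivity
      linarith
    have e2 : 0 ≤ S.Z J ^ 25 * 5001 ^ j * W := by positivity
    rw [pow_succ 5001 j]
    linarith

end Setup

/-- Layer-cake bound for a quantity in `[0, n]`. -/
theorem rpow_le_layers {p : ℝ} (hp : 4 ≤ p) {n : ℕ} (hn : 1 ≤ n) {y : ℝ} (hy : 0 ≤ y)
    (hyn : y ≤ n) :
    y ^ p ≤ (n : ℝ) ^ (p / 2 - 1) * y ^ 2 +
      ∑ k ∈ range (Nat.log 2 n + 1), if (2 : ℝ) ^ k * √n ≤ y then (2 * ((2 : ℝ) ^ k * √n)) ^ p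
        else 0 := by
  have hn' : (1 : ℝ) ≤ n := by exact_mod_cast hn
  have hs : 1 ≤ √(n : ℝ) := Real.one_le_sqrt.2 hn'
  have hsum : ∀ k ∈ range (Nat.log 2 n + 1), (0 : ℝ) ≤
      if (2 : ℝ) ^ k * √n ≤ y then (2 * ((2 : ℝ) ^ k * √n)) ^ p else 0 := by
    intro k _
    split_ifs
    · positivity
    · exact le_rfl
  rcases lt_or_ge y (√n) with h | h
  · have h0 := Finset.sum_nonneg hsum
    have h1 : y ^ p ≤ (n : ℝ) ^ (p / 2 - 1) * y ^ 2 := by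
      rcases hy.eq_or_lt with rfl | hy
      · rw [Real.zero_rpow (by linarith)]; positivity
      · have e1 : y ^ p = y ^ (p - 2) * y ^ 2 := by
          rw [← Real.rpow_natCast y 2, ← Real.rpow_add hy]; norm_num
        have e2 : (n : ℝ) ^ (p / 2 - 1) = √n ^ (p - 2) := by
          rw [Real.sqrt_eq_rpow, ← Real.rpow_mul (by positivity)]
          congr 1; ring
        rw [e1, e2]
        exact mul_le_mul_of_nonneg_right (Real.rpow_le_rpow hy.le h.le (by linarith)) (by positivity)
    linarith
  · have hs0 : 0 < √(n : ℝ) := by linarith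
    have hy1 : 1 ≤ y / √n := by rwa [one_le_div hs0]
    have hyl : y / √n ≤ n := (div_le_self hy hs).trans hyn
    obtain ⟨k, hk1, hk2⟩ := exists_nat_pow_near hy1 (by norm_num : (1 : ℝ) < 2)
    have hkn : k < Nat.log 2 n + 1 := by
      have : 2 ^ k ≤ n := by exact_mod_cast hk1.trans hyl
      have := Nat.le_log_of_pow_le (by norm_num) this
      omega
    have h1 : (2 : ℝ) ^ k * √n ≤ y := by rwa [le_div_iff₀ hs0] at hk1
    have h2 : y ≤ 2 * ((2 : ℝ) ^ k * √n) := by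
      rw [div_lt_iff₀ hs0, pow_succ] at hk2
      linarith
    have h3 := Finset.single_le_sum hsum (Finset.mem_range.2 hkn)
    rw [if_pos h1] at h3
    have h4 : 0 ≤ (n : ℝ) ^ (p / 2 - 1) * y ^ 2 := by positivity
    have h5 := Real.rpow_le_rpow hy h2 (by linarith : 0 ≤ p)
    linarith

theorem mul_rpow_layer_le {p : ℝ} (hp : 4 ≤ p) {n t h : ℝ} (hn : 1 ≤ n) (hh : 0 < h) (hh1 : h ≤ 1)
    (ht1 : √n ≤ t) (ht2 : t ≤ n) :
    t ^ (p - 4) * (n / h + n ^ 3 / t ^ 2) ≤ 2 * (n ^ (p - 3) / h + n ^ (p / 2)) := by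
  have hn0 : 0 < n := by linarith
  have hs : 1 ≤ √n := Real.one_le_sqrt.2 hn
  have ht0 : 0 < t := by linarith
  have hA : 0 ≤ n ^ (p - 3) := by positivity
  have hAh : n ^ (p - 3) ≤ n ^ (p - 3) / h := by
    rw [le_div_iff₀ hh]; exact mul_le_of_le_one_right hA hh1
  have hB : 0 ≤ n ^ (p / 2) := by positivity
  have e1 : t ^ (p - 4) * (n / h) ≤ n ^ (p - 3) / h := by
    rw [mul_div_assoc']
    refine div_le_div_of_nonneg_right ?_ hh.le
    have : n ^ (p - 3) = n ^ (p - 4) * n := by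
      rw [← Real.rpow_add_one hn0.ne']; congr 1; ring
    rw [this]
    exact mul_le_mul_of_nonneg_right (Real.rpow_le_rpow ht0.le ht2 (by linarith)) hn0.le
  have e2 : t ^ (p - 4) * (n ^ 3 / t ^ 2) ≤ n ^ (p - 3) / h + n ^ (p / 2) := by
    have e3 : t ^ (p - 4) * (n ^ 3 / t ^ 2) = n ^ 3 * t ^ (p - 6) := by
      have : t ^ (p - 4) = t ^ (p - 6) * t ^ 2 := by
        rw [← Real.rpow_natCast t 2, ← Real.rpow_add ht0]; congr 1; push_cast; ring
      rw [this]; field_simp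
    rw [e3]
    rcases le_total 6 p with h6 | h6
    · have e4 : n ^ 3 * t ^ (p - 6) ≤ n ^ (p - 3) := by
        have : n ^ (p - 3) = n ^ 3 * n ^ (p - 6) := by
          rw [← Real.rpow_natCast n 3, ← Real.rpow_add hn0]; congr 1; push_cast; ring
        rw [this]
        exact mul_le_mul_of_nonneg_left (Real.rpow_le_rpow ht0.le ht2 (by linarith)) (by positivity)
      linarith
    · have e4 : n ^ 3 * t ^ (p - 6) ≤ n ^ (p / 2) := by
        have : n ^ (p / 2) = n ^ 3 * √n ^ (p - 6) := by
          rw [← Real.rpow_natCast n 3, Real.sqrt_eq_rpow, ← Real.rpow_mul hn0.le,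
            ← Real.rpow_add hn0]
          congr 1; push_cast; ring
        rw [this]
        exact mul_le_mul_of_nonneg_left
          (Real.rpow_le_rpow_of_nonpos (by linarith) ht1 (by linarith)) (by positivity)
      linarith
  rw [mul_add]
  linarith

namespace Setup

variable (S : Setup) {Q : ℕ} [NeZero Q] {J : ℕ}

/-- `L^p` estimate when the coefficients are supported on `A`. -/
theorem sum_norm_f_rpow_le {p : ℝ} (hp : 4 ≤ p) (hQ : 100 * S.Xb J ≤ Q) {A : Finset ℕ}
    (hA : A.Nonempty) (hb : ∀ n ∉ A, S.b n = 0) :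
    ∑ z, ‖S.f Q (S.I J 0) z‖ ^ p ≤
      2 ^ (p + 1) * (S.Z J ^ 25 * 5001 ^ J) * (Nat.log 2 A.card + 2) *
        (Q ^ 2 * ((A.card : ℝ) ^ (p - 3) / S.h + (A.card : ℝ) ^ (p / 2))) := by
  classical
  set n := A.card with hn
  have hn1 : 1 ≤ n := Finset.card_pos.2 hA
  have hn1' : (1 : ℝ) ≤ n := by exact_mod_cast hn1
  have hn0 : (0 : ℝ) < n := by linarith
  have hh := S.h_pos
  have hZ := S.one_le_Z J
  set C : ℝ := S.Z J ^ 25 * 5001 ^ J with hC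
  have hC1 : 1 ≤ C :=
    one_le_mul_of_one_le_of_one_le (one_le_pow₀ (by linarith)) (one_le_pow₀ (by norm_num))
  set V : ℝ := (n : ℝ) ^ (p - 3) / S.h + (n : ℝ) ^ (p / 2) with hV
  have hV0 : 0 ≤ V := by positivity
  have hmem : S.s J * 0 + S.s J ≤ S.s J := by omega
  have hsub : ∀ g : ℕ → ℝ, (∀ i ∉ A, g i = 0) → (∀ i, g i ≤ 1) → (∀ i, 0 ≤ g i) →
      ∀ s : Finset ℕ, ∑ i ∈ s, g i ≤ n := by
    intro g hg hg1 hg0 s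
    calc ∑ i ∈ s, g i = ∑ i ∈ s.filter (· ∈ A), g i := by
          rw [Finset.sum_filter_of_ne]
          intro i _ hi
          by_contra hc
          exact hi (hg i hc)
      _ ≤ (s.filter (· ∈ A)).card • (1 : ℝ) := Finset.sum_le_card_nsmul _ _ _ fun i _ => hg1 i
      _ ≤ n := by
          rw [nsmul_eq_mul, mul_one]
          exact_mod_cast Finset.card_le_card fun i hi => (Finset.mem_filter.1 hi).2
  have hm : S.m J 0 ≤ n := by
    rw [m_eq]
    exact hsub _ (fun i hi => by simp [hb i hi])
      (fun i => pow_le_one₀ (norm_nonneg _) (S.norm_b_le i)) (fun i => by positivity) _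
  have hm0 := S.m_nonneg J 0
  have hfn : ∀ z, ‖S.f Q (S.I J 0) z‖ ≤ n := by
    intro z
    unfold f
    refine (norm_sum_le _ _).trans ?_
    refine le_trans (le_of_eq ?_) (hsub (fun i => ‖S.b i‖) (fun i hi => by simp [hb i hi])
      (fun i => S.norm_b_le i) (fun i => norm_nonneg _) (S.I J 0))
    refine Finset.sum_congr rfl fun i _ => ?_
    rw [norm_mul, norm_chr, mul_one]
  have hlow : ∑ z, (n : ℝ) ^ (p / 2 - 1) * ‖S.f Q (S.I J 0) z‖ ^ 2 ≤ Q ^ 2 * V := by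
    rw [← Finset.mul_sum]
    have e1 := S.sum_norm_f_sq_le (fun i hi => S.le_s_of_mem_I hmem hi) hQ
    rw [← m_eq] at e1
    have e2 : (n : ℝ) ^ (p / 2) = (n : ℝ) ^ (p / 2 - 1) * n := by
      rw [← Real.rpow_add_one hn0.ne']; congr 1; ring
    calc _ ≤ (n : ℝ) ^ (p / 2 - 1) * (Q ^ 2 * n) :=
          mul_le_mul_of_nonneg_left (e1.trans (mul_le_mul_of_nonneg_left hm (sq_nonneg _)))
            (by positivity)
      _ = Q ^ 2 * (n : ℝ) ^ (p / 2) := by rw [e2]; ring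
      _ ≤ Q ^ 2 * V := by
          refine mul_le_mul_of_nonneg_left ?_ (sq_nonneg _)
          have : 0 ≤ (n : ℝ) ^ (p - 3) / S.h := by positivity
          linarith
  have hhigh : ∀ k ∈ range (Nat.log 2 n + 1), (∑ z, if (2 : ℝ) ^ k * √n ≤ ‖S.f Q (S.I J 0) z‖ then
      (2 * ((2 : ℝ) ^ k * √n)) ^ p else 0) ≤ 2 ^ (p + 1) * C * (Q ^ 2 * V) := by
    intro k _
    set t : ℝ := (2 : ℝ) ^ k * √n with ht
    have hs : 1 ≤ √(n : ℝ) := Real.one_le_sqrt.2 hn1'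
    have hst : √(n : ℝ) ≤ t := le_mul_of_one_le_left (by positivity) (one_le_pow₀ (by norm_num))
    have ht0 : 0 < t := by linarith
    rw [← Finset.sum_filter, Finset.sum_const, nsmul_eq_mul]
    set U := (univ : Finset (ZMod Q × ZMod Q)).filter fun z => t ≤ ‖S.f Q (S.I J 0) z‖ with hU
    rcases U.eq_empty_or_nonempty with h | ⟨z, hz⟩
    · rw [h, Finset.card_empty, Nat.cast_zero, zero_mul]; positivity
    have htn : t ≤ n := (Finset.mem_filter.1 hz).2.trans (hfn z)
    have e1 := S.card_level_le hQ le_rfl 0 hmem ht0 U (fun z hz => (Finset.mem_filter.1 hz).2)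
    have e2 := mul_rpow_layer_le hp hn1' hh S.h_le_one hst htn
    have e3 : S.m J 0 / S.h + S.m J 0 ^ 3 / t ^ 2 ≤ n / S.h + (n : ℝ) ^ 3 / t ^ 2 := by gcongr
    have e4 : (2 * t) ^ p = 2 ^ p * (t ^ (p - 4) * t ^ 4) := by
      rw [Real.mul_rpow (by norm_num) ht0.le, ← Real.rpow_natCast t 4, ← Real.rpow_add ht0]
      norm_num
    rw [e4]
    calc (U.card : ℝ) * (2 ^ p * (t ^ (p - 4) * t ^ 4))
        = 2 ^ p * t ^ (p - 4) * (t ^ 4 * U.card) := by ring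
      _ ≤ 2 ^ p * t ^ (p - 4) * (C * (Q ^ 2 * (n / S.h + (n : ℝ) ^ 3 / t ^ 2))) := by
          refine mul_le_mul_of_nonneg_left (e1.trans ?_) (by positivity)
          refine mul_le_mul_of_nonneg_left ?_ (by positivity)
          exact mul_le_mul_of_nonneg_left e3 (sq_nonneg _)
      _ = 2 ^ p * C * Q ^ 2 * (t ^ (p - 4) * (n / S.h + (n : ℝ) ^ 3 / t ^ 2)) := by ring
      _ ≤ 2 ^ p * C * Q ^ 2 * (2 * V) := mul_le_mul_of_nonneg_left e2 (by positivity)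
      _ = 2 ^ (p + 1) * C * (Q ^ 2 * V) := by
          rw [Real.rpow_add_one (by norm_num)]; ring
  have hpt : ∑ z, ‖S.f Q (S.I J 0) z‖ ^ p ≤ ∑ z, ((n : ℝ) ^ (p / 2 - 1) *
      ‖S.f Q (S.I J 0) z‖ ^ 2 + ∑ k ∈ range (Nat.log 2 n + 1),
        if (2 : ℝ) ^ k * √n ≤ ‖S.f Q (S.I J 0) z‖ then (2 * ((2 : ℝ) ^ k * √n)) ^ p else 0) :=
    Finset.sum_le_sum fun z _ => rpow_le_layers hp hn1 (norm_nonneg _) (hfn z)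
  rw [Finset.sum_add_distrib, Finset.sum_comm] at hpt
  have h3 := Finset.sum_le_sum hhigh
  rw [Finset.sum_const, Finset.card_range, nsmul_eq_mul] at h3
  push_cast at h3
  have h4 : Q ^ 2 * V ≤ 2 ^ (p + 1) * C * (Q ^ 2 * V) := by
    refine le_mul_of_one_le_left (by positivity) (one_le_mul_of_one_le_of_one_le ?_ hC1)
    exact Real.one_le_rpow (by norm_num) (by linarith)
  have h5 : 2 ^ (p + 1) * C * (Nat.log 2 n + 2) * (Q ^ 2 * V) =
    2 ^ (p + 1) * C * (Q ^ 2 * V) + (Nat.log 2 n + 1) * (2 ^ (p + 1) * C * (Q ^ 2 * V)) := by ring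
  rw [h5]
  linarith

end Setup

/-- Branching parameter `⌈M^{1/J}⌉`. -/
noncomputable def branching (M J : ℕ) : ℕ := ⌈(M : ℝ) ^ (1 / (J : ℝ))⌉₊

theorem le_branching_pow {M J : ℕ} (hJ : 1 ≤ J) : M ≤ branching M J ^ J := by
  have h : (M : ℝ) ^ (1 / (J : ℝ)) ≤ branching M J := Nat.le_ceil _
  have h2 := pow_le_pow_left₀ (by positivity) h J
  rw [← Real.rpow_natCast (_ ^ _) J, ← Real.rpow_mul (Nat.cast_nonneg M), one_div,
    inv_mul_cancel₀ (by positivity), Real.rpow_one] at h2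
  exact_mod_cast h2

theorem branching_pos {M J : ℕ} (hM : 1 ≤ M) : 0 < branching M J :=
  Nat.ceil_pos.2 (Real.rpow_pos_of_pos (by exact_mod_cast hM) _)

theorem branching_le {M J : ℕ} (hM : 1 ≤ M) : (branching M J : ℝ) ≤ 2 * (M : ℝ) ^ (1 / (J : ℝ)) := by
  have h1 : (1 : ℝ) ≤ (M : ℝ) ^ (1 / (J : ℝ)) :=
    Real.one_le_rpow (by exact_mod_cast hM) (by positivity)
  have := Nat.ceil_lt_add_one (by linarith : 0 ≤ (M : ℝ) ^ (1 / (J : ℝ)))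
  unfold branching
  linarith

/-- A bound on the level-set constant. -/
noncomputable def lossConst (C₀ : ℝ) (J : ℕ) : ℝ := (1000 * C₀ * 36 ^ J * 400) ^ 25 * 5001 ^ J

theorem Setup.loss_le (S : Setup) {M J : ℕ} (hM : 1 ≤ M) (hk : S.k = branching M J) :
    S.Z J ^ 25 * 5001 ^ J ≤ lossConst S.C₀ J * (M : ℝ) ^ (50 / (J : ℝ)) := by
  have hM' : (1 : ℝ) ≤ M := by exact_mod_cast hM
  have h1 := branching_le (J := J) hM
  have hx : (1 : ℝ) ≤ (M : ℝ) ^ (1 / (J : ℝ)) := Real.one_le_rpow hM' (by positivity)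
  set x := (M : ℝ) ^ (1 / (J : ℝ)) with hxdef
  have hC := S.C₀_pos
  have hD : (S.D : ℝ) ≤ 400 * x ^ 2 := by
    have : (S.D : ℝ) = 80 * (branching M J : ℝ) ^ 2 + 1 := by
      rw [← hk]; unfold Setup.D; push_cast; ring
    rw [this]
    have := pow_le_pow_left₀ (Nat.cast_nonneg _) h1 2
    nlinarith
  have hZ : S.Z J ≤ (1000 * S.C₀ * 36 ^ J * 400) * x ^ 2 := by
    unfold Setup.Z
    have := mul_le_mul_of_nonneg_left hD (by positivity : 0 ≤ 1000 * S.C₀ * 36 ^ J)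
    linarith
  have hZ0 := S.one_le_Z J
  have hx50 : (x ^ 2) ^ 25 = (M : ℝ) ^ (50 / (J : ℝ)) := by
    rw [hxdef, ← pow_mul, ← Real.rpow_natCast, ← Real.rpow_mul (by linarith)]
    congr 1; push_cast; ring
  have h2 := pow_le_pow_left₀ (by linarith) hZ 25
  rw [mul_pow, hx50] at h2
  calc _ ≤ ((1000 * S.C₀ * 36 ^ J * 400) ^ 25 * (M : ℝ) ^ (50 / (J : ℝ))) * 5001 ^ J :=
        mul_le_mul_of_nonneg_right h2 (by positivity)
    _ = _ := by unfold lossConst; ring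

/-- Uniform convexity with parameters `h` and `C₀`. -/
structure UniformlyConvex (γ : ℕ → ℝ) (h C₀ : ℝ) : Prop where
  pos : 0 < h
  le_one : h ≤ 1
  one_le : 1 ≤ C₀
  le_second_diff : ∀ n, h ≤ (γ (n + 2) - γ (n + 1)) - (γ (n + 1) - γ n)
  second_diff_le : ∀ n, (γ (n + 2) - γ (n + 1)) - (γ (n + 1) - γ n) ≤ C₀ * h

/-- The setup attached to a uniformly convex sequence. -/
noncomputable def mkSetup {γ : ℕ → ℝ} {h C₀ : ℝ} (hγ : UniformlyConvex γ h C₀) {M : ℕ} (hM : 1 ≤ M)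
    (J : ℕ) (G : ℕ → ℤ) (hG : ∀ n, |(G n : ℝ) - γ n| ≤ 1) (b : ℕ → ℂ) (hb : ∀ n, ‖b n‖ ≤ 1) :
    Setup where
  b := b
  G := G
  γ := γ
  h := h
  C₀ := C₀
  k := branching M J
  norm_b_le := hb
  abs_G_sub_le := hG
  h_pos := hγ.pos
  h_le_one := hγ.le_one
  one_le_C₀ := hγ.one_le
  k_pos := branching_pos hM
  le_second_diff := hγ.le_second_diff
  second_diff_le := hγ.second_diff_le

theorem abs_round_sub_le (x : ℝ) : |((round x : ℤ) : ℝ) - x| ≤ 1 := by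
  rw [abs_sub_comm]
  have := abs_sub_round x
  linarith

/-- A modulus beyond which there is no aliasing. -/
noncomputable def modulusBound {γ : ℕ → ℝ} {h C₀ : ℝ} (hγ : UniformlyConvex γ h C₀) {M : ℕ}
    (hM : 1 ≤ M) (J : ℕ) : ℝ :=
  100 * (mkSetup hγ hM J (fun n => round (γ n)) (fun n => abs_round_sub_le (γ n)) (fun _ => 0)
    (fun _ => by simp)).Xb J

theorem sum_rpow_le_of_class {p : ℝ} (hp : 4 ≤ p) {γ : ℕ → ℝ} {h C₀ : ℝ}
    (hγ : UniformlyConvex γ h C₀) {M : ℕ} (hM : 1 ≤ M) {J : ℕ} (hJ : 1 ≤ J) {Q : ℕ} [NeZero Q]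
    (hQ : modulusBound hγ hM J ≤ Q) {G : ℕ → ℤ} (hG : ∀ n, |(G n : ℝ) - γ n| ≤ 1)
    {b : ℕ → ℂ} (hb : ∀ n, ‖b n‖ ≤ 1) {A : Finset ℕ} (hA : A.Nonempty) (hAM : A ⊆ range M)
    (hbA : ∀ n ∉ A, b n = 0) :
    ∑ z, ‖∑ n ∈ A, b n * chr Q ((n : ℤ), G n) z‖ ^ p ≤
      2 ^ (p + 1) * (lossConst C₀ J * (M : ℝ) ^ (50 / (J : ℝ))) * (Nat.log 2 M + 2) *
        (Q ^ 2 * ((A.card : ℝ) ^ (p - 3) / h + (A.card : ℝ) ^ (p / 2))) := by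
  set S := mkSetup hγ hM J G hG b hb with hS
  have hQ' : 100 * S.Xb J ≤ Q := hQ
  have h1 := S.sum_norm_f_rpow_le hp hQ' hA hbA
  have hMs : M ≤ S.s J := by
    refine (le_branching_pow hJ).trans ((Nat.pow_le_pow_left ?_ J).trans (S.pow_le_s J))
    change S.k ≤ 4 * S.k
    omega
  have hf : ∀ z, S.f Q (S.I J 0) z = ∑ n ∈ A, b n * chr Q ((n : ℤ), G n) z := by
    intro z
    unfold Setup.f
    symm
    refine Finset.sum_subset ?_ fun n _ hn => by
      change b n * _ = 0
      rw [hbA n hn, zero_mul]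
    intro n hn
    have := Finset.mem_range.1 (hAM hn)
    rw [Setup.I, Finset.mem_Ico]
    omega
  simp only [hf] at h1
  refine h1.trans ?_
  have hh := hγ.pos
  have hCpos : 0 < C₀ := by have := hγ.one_le; linarith
  have hlog : ((Nat.log 2 A.card : ℕ) : ℝ) ≤ Nat.log 2 M := by
    have : A.card ≤ M := by simpa using Finset.card_le_card hAM
    exact_mod_cast Nat.log_mono_right this
  have hloss := S.loss_le hM rfl
  have hl0 : 0 ≤ lossConst C₀ J := by unfold lossConst; positivity
  have hZ := S.one_le_Z J
  refine mul_le_mul_of_nonneg_right ?_ (by change 0 ≤ (Q : ℝ) ^ 2 * (_ / h + _); positivity)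
  refine mul_le_mul ?_ (by linarith) (by positivity) (by positivity)
  exact mul_le_mul_of_nonneg_left hloss (by positivity)

theorem class_weight_le {p q : ℝ} (hp : 4 ≤ p) (hq : 1 ≤ q) (hpq : 1 / q + 3 / p ≤ 1)
    {n M h β s : ℝ} (hn : 1 ≤ n) (hnM : n ≤ M) (hh : 0 < h) (hh1 : h ≤ 1) (hβ : 0 ≤ β) (hs : 0 ≤ s)
    (hβs : β ≤ 2 * s * n ^ (-1 / q)) :
    β ^ p * (n ^ (p - 3) / h + n ^ (p / 2)) ≤
      2 ^ (p + 1) * s ^ p * (M ^ (p - 3 - p / q) / h + M ^ (p / 2 - p / q)) := by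
  have hn0 : 0 < n := by linarith
  have hM0 : 0 < M := by linarith
  have hM1 : 1 ≤ M := by linarith
  have hp0 : 0 < p := by linarith
  have hq0 : 0 < q := by linarith
  have hexp : 0 ≤ p - 3 - p / q := by
    have := mul_le_mul_of_nonneg_left hpq hp0.le
    have e : p * (1 / q + 3 / p) = p / q + 3 := by field_simp
    linarith
  have e1 : β ^ p ≤ 2 ^ p * s ^ p * n ^ (-(p / q)) := by
    refine (Real.rpow_le_rpow hβ hβs hp0.le).trans (le_of_eq ?_)
    rw [Real.mul_rpow (by positivity) (by positivity), Real.mul_rpow (by norm_num) hs,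
      ← Real.rpow_mul hn0.le]
    congr 2; ring
  have e2 : n ^ (-(p / q)) * n ^ (p - 3) ≤ M ^ (p - 3 - p / q) := by
    rw [← Real.rpow_add hn0, show -(p / q) + (p - 3) = p - 3 - p / q by ring]
    exact Real.rpow_le_rpow hn0.le hnM hexp
  have hMA : M ^ (p - 3 - p / q) ≤ M ^ (p - 3 - p / q) / h := by
    rw [le_div_iff₀ hh]
    exact mul_le_of_le_one_right (by positivity) hh1
  have e3 : n ^ (-(p / q)) * n ^ (p / 2) ≤ M ^ (p / 2 - p / q) + M ^ (p - 3 - p / q) / h := by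
    rw [← Real.rpow_add hn0, show -(p / q) + p / 2 = p / 2 - p / q by ring]
    rcases le_total 0 (p / 2 - p / q) with h0 | h0
    · have := Real.rpow_le_rpow hn0.le hnM h0
      have : 0 ≤ M ^ (p - 3 - p / q) / h := by positivity
      linarith
    · have h1 := Real.rpow_le_one_of_one_le_of_nonpos hn h0
      have h2 := Real.one_le_rpow hM1 hexp
      have : 0 ≤ M ^ (p / 2 - p / q) := by positivity
      linarith
  have e4 : n ^ (-(p / q)) * (n ^ (p - 3) / h + n ^ (p / 2)) ≤
      2 * (M ^ (p - 3 - p / q) / h + M ^ (p / 2 - p / q)) := by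
    have := div_le_div_of_nonneg_right e2 hh.le
    have h0 : 0 ≤ M ^ (p / 2 - p / q) := by positivity
    have e5 : n ^ (-(p / q)) * (n ^ (p - 3) / h + n ^ (p / 2)) =
      n ^ (-(p / q)) * n ^ (p - 3) / h + n ^ (-(p / q)) * n ^ (p / 2) := by ring
    linarith
  calc _ ≤ 2 ^ p * s ^ p * n ^ (-(p / q)) * (n ^ (p - 3) / h + n ^ (p / 2)) :=
        mul_le_mul_of_nonneg_right e1 (by positivity)
    _ = 2 ^ p * s ^ p * (n ^ (-(p / q)) * (n ^ (p - 3) / h + n ^ (p / 2))) := by ring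
    _ ≤ 2 ^ p * s ^ p * (2 * (M ^ (p - 3 - p / q) / h + M ^ (p / 2 - p / q))) :=
        mul_le_mul_of_nonneg_left e4 (by positivity)
    _ = _ := by rw [Real.rpow_add_one (by norm_num)]; ring

theorem natLog_add_two_le {M : ℕ} (hM : 1 ≤ M) {δ : ℝ} (hδ : 0 < δ) :
    (Nat.log 2 M + 2 : ℝ) ≤ (2 / δ + 2) * (M : ℝ) ^ δ := by
  have hM' : (1 : ℝ) ≤ M := by exact_mod_cast hM
  have h1 := Real.natLog_le_logb M 2
  have h2 : Real.logb 2 M ≤ 2 * Real.log M := by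
    rw [Real.logb, div_le_iff₀ (Real.log_pos (by norm_num))]
    have := Real.log_two_gt_d9
    have h0 := Real.log_nonneg hM'
    nlinarith
  have h3 := Real.log_le_rpow_div (by linarith : (0 : ℝ) ≤ M) hδ
  have h4 := Real.one_le_rpow hM' hδ.le
  push_cast at h1
  have h5 : (2 / δ + 2) * (M : ℝ) ^ δ = 2 * ((M : ℝ) ^ δ / δ) + 2 * (M : ℝ) ^ δ := by ring
  rw [h5]
  linarith

/-- Dyadic classes of coefficients. -/
theorem exists_dyadic_class {s y : ℝ} (hs : 0 < s) (hys : y ≤ s) (L : ℕ) :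
    ∃ j ∈ range (L + 1), (j < L → s / 2 ^ (j + 1) < y) ∧ y ≤ s / 2 ^ j := by
  rcases le_or_gt y (s / 2 ^ L) with h | h
  · exact ⟨L, by simp, by simp, h⟩
  · have hy0 : 0 < y := lt_of_le_of_lt (by positivity) h
    obtain ⟨j, hj1, hj2⟩ := exists_nat_pow_near ((one_le_div hy0).2 hys) (by norm_num : (1 : ℝ) < 2)
    have hjL : j < L := by
      rw [div_lt_iff₀ (by positivity), mul_comm, ← div_lt_iff₀ hy0] at h
      exact (pow_lt_pow_iff_right₀ (by norm_num : (1 : ℝ) < 2)).1 (hj1.trans_lt h)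
    refine ⟨j, by simp; omega, fun _ => ?_, ?_⟩
    · rw [div_lt_iff₀ hy0] at hj2
      rw [div_lt_iff₀ (by positivity)]
      linarith
    · rw [le_div_iff₀ hy0] at hj1
      rw [le_div_iff₀ (by positivity)]
      linarith

theorem norm_le_lq {M : ℕ} {q : ℝ} (hq : 1 ≤ q) (b : ℕ → ℂ) {n : ℕ} (hn : n ∈ range M) :
    ‖b n‖ ≤ (∑ n ∈ range M, ‖b n‖ ^ q) ^ (1 / q) := by
  have h1 := Finset.single_le_sum (f := fun n => ‖b n‖ ^ q) (fun n _ => by positivity) hn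
  have h2 := Real.rpow_le_rpow (by positivity) h1 (by positivity : 0 ≤ 1 / q)
  rwa [← Real.rpow_mul (norm_nonneg _), mul_one_div_cancel (by linarith), Real.rpow_one] at h2

section

variable {p q : ℝ} {γ : ℕ → ℝ} {h C₀ : ℝ} {M J Q : ℕ} [NeZero Q] {G : ℕ → ℤ} {b : ℕ → ℂ} {s : ℝ}
  {A : Finset ℕ}

theorem sum_rpow_dyadic_le (hp : 4 ≤ p) (hq : 1 ≤ q) (hpq : 1 / q + 3 / p ≤ 1)
    (hγ : UniformlyConvex γ h C₀) (hM : 1 ≤ M) (hJ : 1 ≤ J)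
    (hQ : modulusBound hγ hM J ≤ Q) (hG : ∀ n, |(G n : ℝ) - γ n| ≤ 1)
    (hs : 0 < s) (hsb : ∑ n ∈ range M, ‖b n‖ ^ q ≤ s ^ q) (hAM : A ⊆ range M) (j : ℕ)
    (hA1 : ∀ n ∈ A, s / 2 ^ (j + 1) < ‖b n‖) (hA2 : ∀ n ∈ A, ‖b n‖ ≤ s / 2 ^ j) :
    ∑ z, ‖∑ n ∈ A, b n * chr Q ((n : ℤ), G n) z‖ ^ p ≤
      4 ^ (p + 1) * (lossConst C₀ J * (M : ℝ) ^ (50 / (J : ℝ))) * (Nat.log 2 M + 2) *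
        (Q ^ 2 * ((M : ℝ) ^ (p - 3 - p / q) / h + (M : ℝ) ^ (p / 2 - p / q)) * s ^ p) := by
  classical
  have hh := hγ.pos
  have hC₀ : 0 < C₀ := by have := hγ.one_le; linarith
  have hl0 : 0 ≤ lossConst C₀ J := by unfold lossConst; positivity
  have hq0 : 0 < q := by linarith
  rcases A.eq_empty_or_nonempty with rfl | hA
  · simp only [Finset.sum_empty, norm_zero, Real.zero_rpow (by linarith : p ≠ 0),
      Finset.sum_const_zero]
    positivity
  set β : ℝ := s / 2 ^ j with hβ
  have hβ0 : 0 < β := by positivity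
  have hn1 : (1 : ℝ) ≤ A.card := by exact_mod_cast Finset.card_pos.2 hA
  have hn0 : (0 : ℝ) < A.card := by linarith
  have hnM : (A.card : ℝ) ≤ M := by
    have := Finset.card_le_card hAM
    rw [Finset.card_range] at this
    exact_mod_cast this
  set b' : ℕ → ℂ := fun n => if n ∈ A then b n / β else 0 with hb'
  have hb1 : ∀ n, ‖b' n‖ ≤ 1 := by
    intro n
    rw [hb']; dsimp only
    split_ifs with hn
    · rw [norm_div, Complex.norm_real, Real.norm_of_nonneg hβ0.le, div_le_one hβ0]
      exact hA2 n hn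
    · simp
  have h1 := sum_rpow_le_of_class hp hγ hM hJ hQ hG hb1 hA hAM (fun n hn => by simp [hb', hn])
  have hsum : ∀ z, ‖∑ n ∈ A, b n * chr Q ((n : ℤ), G n) z‖ ^ p =
      β ^ p * ‖∑ n ∈ A, b' n * chr Q ((n : ℤ), G n) z‖ ^ p := by
    intro z
    have : ∑ n ∈ A, b n * chr Q ((n : ℤ), G n) z =
        β * ∑ n ∈ A, b' n * chr Q ((n : ℤ), G n) z := by
      rw [Finset.mul_sum]
      refine Finset.sum_congr rfl fun n hn => ?_
      simp only [hb', if_pos hn]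
      have : (β : ℂ) ≠ 0 := by exact_mod_cast hβ0.ne'
      field_simp
    rw [this, norm_mul, Complex.norm_real, Real.norm_of_nonneg hβ0.le,
      Real.mul_rpow hβ0.le (norm_nonneg _)]
  simp only [hsum]
  rw [← Finset.mul_sum]
  have hβs : β ≤ 2 * s * (A.card : ℝ) ^ (-1 / q) := by
    have e1 : A.card * (β / 2) ^ q ≤ s ^ q := by
      refine le_trans ?_ (hsb.trans' (Finset.sum_le_sum_of_subset_of_nonneg hAM
        fun n _ _ => by positivity))
      rw [← nsmul_eq_mul]
      refine Finset.card_nsmul_le_sum _ _ _ fun n hn => ?_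
      refine Real.rpow_le_rpow (by positivity) ?_ hq0.le
      refine le_trans (le_of_eq ?_) (hA1 n hn).le
      rw [hβ, pow_succ]; field_simp
    have e2 := Real.rpow_le_rpow (by positivity) e1 (by positivity : 0 ≤ 1 / q)
    rw [Real.mul_rpow hn0.le (by positivity), ← Real.rpow_mul (by positivity),
      ← Real.rpow_mul hs.le, mul_one_div_cancel hq0.ne', Real.rpow_one, Real.rpow_one] at e2
    have e3 : (A.card : ℝ) ^ (1 / q) * (A.card : ℝ) ^ (-1 / q) = 1 := by
      rw [← Real.rpow_add hn0]; simp [neg_div]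
    have e4 := mul_le_mul_of_nonneg_right e2 (by positivity : 0 ≤ (A.card : ℝ) ^ (-1 / q))
    have e5 : (A.card : ℝ) ^ (1 / q) * (β / 2) * (A.card : ℝ) ^ (-1 / q) = β / 2 := by
      rw [mul_right_comm, e3, one_mul]
    rw [e5] at e4
    linarith
  have h2 := class_weight_le hp hq hpq hn1 hnM hh hγ.le_one hβ0.le hs.le hβs
  set V : ℝ := (M : ℝ) ^ (p - 3 - p / q) / h + (M : ℝ) ^ (p / 2 - p / q) with hV
  set Y : ℝ := (lossConst C₀ J * (M : ℝ) ^ (50 / (J : ℝ))) * (Nat.log 2 M + 2) with hY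
  have hY0 : 0 ≤ Y := by positivity
  calc _ ≤ β ^ p * (2 ^ (p + 1) * (lossConst C₀ J * (M : ℝ) ^ (50 / (J : ℝ))) * (Nat.log 2 M + 2) *
        (Q ^ 2 * ((A.card : ℝ) ^ (p - 3) / h + (A.card : ℝ) ^ (p / 2)))) :=
        mul_le_mul_of_nonneg_left h1 (by positivity)
    _ = 2 ^ (p + 1) * Y * Q ^ 2 *
        (β ^ p * ((A.card : ℝ) ^ (p - 3) / h + (A.card : ℝ) ^ (p / 2))) := by rw [hY]; ring
    _ ≤ 2 ^ (p + 1) * Y * Q ^ 2 * (2 ^ (p + 1) * s ^ p * V) :=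
        mul_le_mul_of_nonneg_left h2 (by positivity)
    _ = _ := by
        rw [show (4 : ℝ) = 2 * 2 by norm_num, Real.mul_rpow (by norm_num) (by norm_num), hY]; ring

theorem tail_weight_le (hp : 4 ≤ p) (hq : 1 ≤ q) (hM : 1 ≤ M) (hs : 0 < s)
    (hAM : A ⊆ range M) (hA : ∀ n ∈ A, ‖b n‖ ≤ s / (M : ℝ) ^ 2) :
    ∑ z, ‖∑ n ∈ A, b n * chr Q ((n : ℤ), G n) z‖ ^ p ≤
      Q ^ 2 * (M : ℝ) ^ (p / 2 - p / q) * s ^ p := by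
  have hM1 : (1 : ℝ) ≤ M := by exact_mod_cast hM
  have hM0 : (0 : ℝ) < M := by linarith
  have hp0 : 0 < p := by linarith
  have hcard : (A.card : ℝ) ≤ M := by
    have := Finset.card_le_card hAM
    rw [Finset.card_range] at this
    exact_mod_cast this
  have h1 : ∀ z, ‖∑ n ∈ A, b n * chr Q ((n : ℤ), G n) z‖ ^ p ≤
      (M : ℝ) ^ (p / 2 - p / q) * s ^ p := by
    intro z
    have e1 : ‖∑ n ∈ A, b n * chr Q ((n : ℤ), G n) z‖ ≤ s * (M : ℝ) ^ (-1 : ℝ) := by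
      refine (norm_sum_le _ _).trans ((Finset.sum_le_card_nsmul A _ (s / (M : ℝ) ^ 2)
        fun n hn => ?_).trans ?_)
      · rw [norm_mul, norm_chr, mul_one]; exact hA n hn
      · rw [nsmul_eq_mul]
        refine (mul_le_mul_of_nonneg_right hcard (by positivity)).trans (le_of_eq ?_)
        rw [Real.rpow_neg_one]; field_simp
    refine (Real.rpow_le_rpow (norm_nonneg _) e1 hp0.le).trans ?_
    rw [Real.mul_rpow hs.le (by positivity), ← Real.rpow_mul hM0.le, mul_comm]
    refine mul_le_mul_of_nonneg_right (Real.rpow_le_rpow_of_exponent_le hM1 ?_) (by positivity)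
    have : p / q ≤ p := div_le_self hp0.le hq
    linarith
  refine (Finset.sum_le_card_nsmul _ _ _ fun z _ => h1 z).trans (le_of_eq ?_)
  rw [Finset.card_univ, Fintype.card_prod, ZMod.card, nsmul_eq_mul]
  push_cast
  ring

theorem sum_rpow_le (hp : 4 ≤ p) (hq : 1 ≤ q) (hpq : 1 / q + 3 / p ≤ 1)
    (hγ : UniformlyConvex γ h C₀) (hM : 1 ≤ M) (hJ : 1 ≤ J)
    (hQ : modulusBound hγ hM J ≤ Q) (hG : ∀ n, |(G n : ℝ) - γ n| ≤ 1) :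
    ∑ z, ‖∑ n ∈ range M, b n * chr Q ((n : ℤ), G n) z‖ ^ p ≤
      (8 * (Nat.log 2 M + 2)) ^ (p + 1) * (lossConst C₀ J * (M : ℝ) ^ (50 / (J : ℝ))) *
        (Q ^ 2 * ((M : ℝ) ^ (p - 3 - p / q) / h + (M : ℝ) ^ (p / 2 - p / q)) *
          ((∑ n ∈ range M, ‖b n‖ ^ q) ^ (1 / q)) ^ p) := by
  classical
  have hh := hγ.pos
  have hC₀ := hγ.one_le
  have hl1 : 1 ≤ lossConst C₀ J := by
    unfold lossConst
    refine one_le_mul_of_one_le_of_one_le (one_le_pow₀ ?_) (one_le_pow₀ (by norm_num))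
    have : (1 : ℝ) ≤ 36 ^ J := one_le_pow₀ (by norm_num)
    nlinarith
  have hq0 : 0 < q := by linarith
  have hM1 : (1 : ℝ) ≤ M := by exact_mod_cast hM
  set s : ℝ := (∑ n ∈ range M, ‖b n‖ ^ q) ^ (1 / q) with hsdef
  have hbs : ∀ n ∈ range M, ‖b n‖ ≤ s := fun n hn => norm_le_lq hq b hn
  have hs0 : 0 ≤ s := by positivity
  rcases hs0.eq_or_lt with hs | hs
  · have : ∀ z, ∑ n ∈ range M, b n * chr Q ((n : ℤ), G n) z = 0 := by
      intro z
      refine Finset.sum_eq_zero fun n hn => ?_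
      have := hbs n hn
      rw [← hs] at this
      rw [norm_le_zero_iff.1 this, zero_mul]
    simp only [this, norm_zero, Real.zero_rpow (by linarith : p ≠ 0), Finset.sum_const_zero]
    positivity
  have hsq : ∑ n ∈ range M, ‖b n‖ ^ q ≤ s ^ q := by
    rw [hsdef, ← Real.rpow_mul (by positivity), one_div_mul_cancel hq0.ne', Real.rpow_one]
  set L : ℕ := 2 * (Nat.log 2 M + 1) with hL
  have hL2 : (M : ℝ) ^ 2 ≤ 2 ^ L := by
    have : M ≤ 2 ^ (Nat.log 2 M + 1) := (Nat.lt_pow_succ_log_self (by norm_num) M).le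
    rw [hL, mul_comm, pow_mul]
    exact_mod_cast Nat.pow_le_pow_left this 2
  have hcls : ∀ n, ∃ j ∈ range (L + 1), n ∈ range M →
      (j < L → s / 2 ^ (j + 1) < ‖b n‖) ∧ ‖b n‖ ≤ s / 2 ^ j := by
    intro n
    by_cases hn : n ∈ range M
    · obtain ⟨j, hj, h⟩ := exists_dyadic_class hs (hbs n hn) L
      exact ⟨j, hj, fun _ => h⟩
    · exact ⟨0, by simp, fun h => absurd h hn⟩
  choose κ hκ hκ' using hcls
  set V : ℝ := (M : ℝ) ^ (p - 3 - p / q) / h + (M : ℝ) ^ (p / 2 - p / q) with hV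
  have hV0 : 0 ≤ V := by positivity
  set ℓ : ℝ := Nat.log 2 M + 2 with hℓ
  have hℓ2 : 2 ≤ ℓ := by rw [hℓ]; have : (0 : ℝ) ≤ Nat.log 2 M := Nat.cast_nonneg _; linarith
  set Y : ℝ := lossConst C₀ J * (M : ℝ) ^ (50 / (J : ℝ)) with hY
  have hY1 : 1 ≤ Y :=
    one_le_mul_of_one_le_of_one_le hl1 (Real.one_le_rpow hM1 (by positivity))
  set g : ℕ → ZMod Q × ZMod Q → ℂ := fun j z =>
    ∑ n ∈ (range M).filter (fun n => κ n = j), b n * chr Q ((n : ℤ), G n) z with hg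
  have hpiece : ∀ j ∈ range (L + 1), ∑ z, ‖g j z‖ ^ p ≤
      4 ^ (p + 1) * Y * ℓ * (Q ^ 2 * V * s ^ p) := by
    intro j hj
    rcases Nat.lt_or_ge j L with hjL | hjL
    · refine sum_rpow_dyadic_le hp hq hpq hγ hM hJ hQ hG hs hsq (Finset.filter_subset _ _) j ?_ ?_
      · intro n hn
        obtain ⟨hn1, rfl⟩ := Finset.mem_filter.1 hn
        exact (hκ' n hn1).1 hjL
      · intro n hn
        obtain ⟨hn1, rfl⟩ := Finset.mem_filter.1 hn
        exact (hκ' n hn1).2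
    · have hjL : j = L := by rw [Finset.mem_range] at hj; omega
      have h1 := tail_weight_le (Q := Q) (G := G) (b := b) hp hq hM hs
        (Finset.filter_subset (fun n => κ n = j) (range M)) (fun n hn => by
          obtain ⟨hn1, hn2⟩ := Finset.mem_filter.1 hn
          refine ((hκ' n hn1).2).trans ?_
          rw [hn2, hjL]
          exact div_le_div_of_nonneg_left hs.le (by positivity) hL2)
      refine h1.trans ?_
      have h2 : (M : ℝ) ^ (p / 2 - p / q) ≤ V := by
        rw [hV]
        have : 0 ≤ (M : ℝ) ^ (p - 3 - p / q) / h := by positivity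
        linarith
      have h3 : Q ^ 2 * (M : ℝ) ^ (p / 2 - p / q) * s ^ p ≤ Q ^ 2 * V * s ^ p :=
        mul_le_mul_of_nonneg_right (mul_le_mul_of_nonneg_left h2 (by positivity)) (by positivity)
      refine h3.trans (le_mul_of_one_le_left (by positivity) ?_)
      refine one_le_mul_of_one_le_of_one_le (one_le_mul_of_one_le_of_one_le ?_ hY1) (by linarith)
      exact Real.one_le_rpow (by norm_num) (by linarith)
  have hsplit : ∀ z, ‖∑ n ∈ range M, b n * chr Q ((n : ℤ), G n) z‖ ^ p ≤
      (2 * ℓ) ^ (p - 1) * ∑ j ∈ range (L + 1), ‖g j z‖ ^ p := by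
    intro z
    rw [← Finset.sum_fiberwise_of_maps_to (fun n _ => hκ n)]
    have e1 := Real.rpow_le_rpow (norm_nonneg _)
      (norm_sum_le (range (L + 1)) (fun j => g j z)) (by linarith : 0 ≤ p)
    refine e1.trans ((Real.rpow_sum_le_const_mul_sum_rpow_of_nonneg (range (L + 1))
      (by linarith : 1 ≤ p) fun j _ => norm_nonneg _).trans ?_)
    refine mul_le_mul_of_nonneg_right ?_ (by positivity)
    refine Real.rpow_le_rpow (by positivity) ?_ (by linarith)
    rw [Finset.card_range, hL, hℓ]; push_cast; linarith
  have h1 := Finset.sum_le_sum fun z (_ : z ∈ (univ : Finset (ZMod Q × ZMod Q))) => hsplit z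
  rw [← Finset.mul_sum, Finset.sum_comm] at h1
  have h2 := Finset.sum_le_sum hpiece
  rw [Finset.sum_const, Finset.card_range, nsmul_eq_mul] at h2
  set X : ℝ := Q ^ 2 * V * s ^ p with hX
  have hX0 : 0 ≤ X := by positivity
  have hL3 : ((L + 1 : ℕ) : ℝ) ≤ 2 * ℓ := by rw [hL, hℓ]; push_cast; linarith
  have h0 : 0 ≤ 4 ^ (p + 1) * Y * ℓ * X := by positivity
  calc _ ≤ (2 * ℓ) ^ (p - 1) * ((2 * ℓ) * (4 ^ (p + 1) * Y * ℓ * X)) := by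
        refine h1.trans (mul_le_mul_of_nonneg_left (h2.trans ?_) (by positivity))
        exact mul_le_mul_of_nonneg_right hL3 h0
    _ = (2 * ℓ) ^ p * ℓ * 4 ^ (p + 1) * (Y * X) := by
        have : (2 * ℓ) ^ p = (2 * ℓ) ^ (p - 1) * (2 * ℓ) := by
          rw [← Real.rpow_add_one (by positivity)]; congr 1; ring
        rw [this]; ring
    _ ≤ (2 * ℓ) ^ p * (2 * ℓ) * 4 ^ (p + 1) * (Y * X) := by
        gcongr; linarith
    _ = (8 * ℓ) ^ (p + 1) * Y * X := by
        rw [← Real.rpow_add_one (by positivity), ← Real.mul_rpow (by positivity) (by norm_num),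
          show 2 * ℓ * 4 = 8 * ℓ by ring]
        ring

end

/-- The `L^p` estimate on the finite grid. -/
theorem exists_sum_rpow_le {p q : ℝ} (hp : 4 ≤ p) (hq : 1 ≤ q) (hpq : 1 / q + 3 / p ≤ 1)
    {C₀ ε : ℝ} (hC₀ : 1 ≤ C₀) (hε : 0 < ε) :
    ∃ C : ℝ, 0 < C ∧ ∀ (M : ℕ) (γ : ℕ → ℝ) (h : ℝ), 1 ≤ M → UniformlyConvex γ h C₀ →
      ∃ Q₀ : ℕ, ∀ (Q : ℕ) [NeZero Q] (G : ℕ → ℤ) (b : ℕ → ℂ), Q₀ ≤ Q →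
        (∀ n, |(G n : ℝ) - γ n| ≤ 1) →
        ∑ z, ‖∑ n ∈ range M, b n * chr Q ((n : ℤ), G n) z‖ ^ p ≤
          C * (M : ℝ) ^ ε *
            (Q ^ 2 * ((M : ℝ) ^ (p - 3 - p / q) / h + (M : ℝ) ^ (p / 2 - p / q)) *
              ((∑ n ∈ range M, ‖b n‖ ^ q) ^ (1 / q)) ^ p) := by
  set J : ℕ := ⌈100 / ε⌉₊ with hJdef
  have hJ : 1 ≤ J := Nat.ceil_pos.2 (by positivity)
  have hJ' : (0 : ℝ) < J := by exact_mod_cast hJ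
  have hJε : 50 / (J : ℝ) ≤ ε / 2 := by
    have : 100 / ε ≤ J := Nat.le_ceil _
    rw [div_le_iff₀ hε] at this
    rw [div_le_div_iff₀ hJ' (by norm_num)]
    linarith
  set δ : ℝ := ε / (2 * (p + 1)) with hδ
  have hδ0 : 0 < δ := by have : 0 < p + 1 := by linarith
                         positivity
  have hl0 : 0 < lossConst C₀ J := by unfold lossConst; positivity
  refine ⟨(8 * (2 / δ + 2)) ^ (p + 1) * lossConst C₀ J, by positivity, ?_⟩
  intro M γ h hM hγ
  refine ⟨⌈modulusBound hγ hM J⌉₊, ?_⟩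
  intro Q _ G b hQ hG
  have hQ' : modulusBound hγ hM J ≤ Q := (Nat.le_ceil _).trans (by exact_mod_cast hQ)
  refine (sum_rpow_le hp hq hpq hγ hM hJ hQ' hG).trans ?_
  have hh := hγ.pos
  have hM1 : (1 : ℝ) ≤ M := by exact_mod_cast hM
  have hM0 : (0 : ℝ) < M := by linarith
  refine mul_le_mul_of_nonneg_right ?_ (by positivity)
  have e1 := natLog_add_two_le hM hδ0
  have e2 : (8 * (Nat.log 2 M + 2 : ℝ)) ^ (p + 1) ≤
      (8 * (2 / δ + 2)) ^ (p + 1) * (M : ℝ) ^ (ε / 2) := by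
    have e3 : (M : ℝ) ^ (ε / 2) = ((M : ℝ) ^ δ) ^ (p + 1) := by
      rw [← Real.rpow_mul hM0.le, hδ]
      congr 1
      have : p + 1 ≠ 0 := by linarith
      field_simp
    rw [e3, ← Real.mul_rpow (by positivity) (by positivity)]
    exact Real.rpow_le_rpow (by positivity) (by linarith) (by linarith)
  have e4 : (M : ℝ) ^ (50 / (J : ℝ)) ≤ (M : ℝ) ^ (ε / 2) :=
    Real.rpow_le_rpow_of_exponent_le hM1 hJε
  have e5 : (M : ℝ) ^ ε = (M : ℝ) ^ (ε / 2) * (M : ℝ) ^ (ε / 2) := by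
    rw [← Real.rpow_add hM0]; congr 1; ring
  rw [e5]
  calc _ ≤ ((8 * (2 / δ + 2)) ^ (p + 1) * (M : ℝ) ^ (ε / 2)) *
        (lossConst C₀ J * (M : ℝ) ^ (ε / 2)) :=
        mul_le_mul e2 (mul_le_mul_of_nonneg_left e4 hl0.le) (by positivity) (by positivity)
    _ = _ := by ring

/-- The additive character `x ↦ e^{2πix}` of the real line. -/
noncomputable def ex (x : ℝ) : ℂ := Complex.exp (Complex.I * ((2 * Real.pi * x : ℝ) : ℂ))

theorem ex_add (x y : ℝ) : ex (x + y) = ex x * ex y := by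
  rw [ex, ex, ex, ← Complex.exp_add]
  congr 1
  push_cast
  ring

theorem norm_ex (x : ℝ) : ‖ex x‖ = 1 := by
  rw [ex, mul_comm, Complex.norm_exp_ofReal_mul_I]

theorem ex_intCast (j : ℤ) : ex j = 1 := by
  rw [ex, ← Complex.exp_int_mul_two_pi_mul_I j]
  congr 1
  push_cast
  ring

theorem norm_ex_sub_one_le (x : ℝ) : ‖ex x - 1‖ ≤ 2 * Real.pi * |x| := by
  refine Real.norm_exp_I_mul_ofReal_sub_one_le.trans_eq ?_
  rw [Real.norm_eq_abs, abs_mul, abs_of_pos Real.two_pi_pos]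

theorem continuous_ex : Continuous ex := by
  unfold ex
  fun_prop

theorem ex_natCast_mul (σ : ℝ) (k : ℕ) :
    ex (σ * k) = 1 + ∑ j ∈ range k, (ex σ - 1) * ex (σ * j) := by
  induction k with
  | zero =>
    have := ex_intCast 0
    simpa using this
  | succ k ih =>
    rw [Finset.sum_range_succ, ← add_assoc, ← ih, Nat.cast_succ, mul_add_one, ex_add]
    ring

theorem add_rpow_le_two_rpow_mul {p x y : ℝ} (hp : 0 ≤ p) (hx : 0 ≤ x) (hy : 0 ≤ y) :
    (x + y) ^ p ≤ 2 ^ p * (x ^ p + y ^ p) := by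
  have hx' := Real.rpow_nonneg hx p
  have hy' := Real.rpow_nonneg hy p
  have h2 : (0 : ℝ) ≤ 2 ^ p := by positivity
  rcases le_total x y with h | h
  · refine (Real.rpow_le_rpow (by linarith) (by linarith : x + y ≤ 2 * y) hp).trans ?_
    rw [Real.mul_rpow (by norm_num) hy]
    nlinarith
  · refine (Real.rpow_le_rpow (by linarith) (by linarith : x + y ≤ 2 * x) hp).trans ?_
    rw [Real.mul_rpow (by norm_num) hx]
    nlinarith

section

variable {M : ℕ} {p q : ℝ}

theorem lq_norm_mul_le (hq : 1 ≤ q) {β : ℝ} (hβ : 0 ≤ β) (b w : ℕ → ℂ)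
    (hw : ∀ n ∈ range M, ‖w n‖ ≤ β) :
    (∑ n ∈ range M, ‖b n * w n‖ ^ q) ^ (1 / q) ≤ β * (∑ n ∈ range M, ‖b n‖ ^ q) ^ (1 / q) := by
  have hq0 : 0 < q := by linarith
  have h1 : ∑ n ∈ range M, ‖b n * w n‖ ^ q ≤ β ^ q * ∑ n ∈ range M, ‖b n‖ ^ q := by
    rw [Finset.mul_sum]
    refine Finset.sum_le_sum fun n hn => ?_
    rw [norm_mul, Real.mul_rpow (norm_nonneg _) (norm_nonneg _), mul_comm]
    exact mul_le_mul_of_nonneg_right (Real.rpow_le_rpow (norm_nonneg _) (hw n hn) hq0.le)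
      (by positivity)
  refine (Real.rpow_le_rpow (by positivity) h1 (by positivity)).trans_eq ?_
  rw [Real.mul_rpow (by positivity) (by positivity), ← Real.rpow_mul hβ,
    mul_one_div_cancel hq0.ne', Real.rpow_one]

theorem lq_norm_mul_eq (b w : ℕ → ℂ) (hw : ∀ n, ‖w n‖ = 1) :
    ∑ n ∈ range M, ‖b n * w n‖ ^ q = ∑ n ∈ range M, ‖b n‖ ^ q :=
  Finset.sum_congr rfl fun n _ => by rw [norm_mul, hw, mul_one]

/-- Slowly varying phases do not affect an estimate which is uniform in the coefficients. -/
theorem sum_norm_mul_ex_rpow_le {Ω : Type*} [Fintype Ω] (hp : 1 ≤ p) (hq : 1 ≤ q) {X : ℝ}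
    (hX : 0 ≤ X) (χ : ℕ → Ω → ℂ)
    (H : ∀ b : ℕ → ℂ, ∑ z, ‖∑ n ∈ range M, b n * χ n z‖ ^ p ≤
      X * ((∑ n ∈ range M, ‖b n‖ ^ q) ^ (1 / q)) ^ p)
    {σ : ℕ → ℝ} {K : ℕ} (hK : 1 ≤ K) {B : ℝ} (hB : 0 ≤ B) (hσ : ∀ n ∈ range M, |σ n| * K ≤ B)
    {k : Ω → ℕ} (hk : ∀ z, k z ≤ K) (b : ℕ → ℂ) :
    ∑ z, ‖∑ n ∈ range M, b n * (χ n z * ex (σ n * k z))‖ ^ p ≤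
      2 ^ p * (1 + (2 * Real.pi * B) ^ p) * X * ((∑ n ∈ range M, ‖b n‖ ^ q) ^ (1 / q)) ^ p := by
  have hK0 : (0 : ℝ) < K := by exact_mod_cast hK
  have hp0 : 0 < p := by linarith
  have hπ := Real.pi_pos
  set S : ℝ := (∑ n ∈ range M, ‖b n‖ ^ q) ^ (1 / q) with hS
  have hS0 : 0 ≤ S := by positivity
  set w : ℕ → ℕ → ℂ := fun j n => K * (ex (σ n) - 1) * ex (σ n * j) with hw
  have hwB : ∀ j, ∀ n ∈ range M, ‖w j n‖ ≤ 2 * Real.pi * B := by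
    intro j n hn
    rw [hw]
    dsimp only
    rw [norm_mul, norm_mul, norm_ex, mul_one, Complex.norm_natCast]
    calc (K : ℝ) * ‖ex (σ n) - 1‖ ≤ K * (2 * Real.pi * |σ n|) :=
          mul_le_mul_of_nonneg_left (norm_ex_sub_one_le _) hK0.le
      _ = 2 * Real.pi * (|σ n| * K) := by ring
      _ ≤ _ := mul_le_mul_of_nonneg_left (hσ n hn) (by positivity)
  set F : (ℕ → ℂ) → Ω → ℝ := fun c z => ‖∑ n ∈ range M, c n * χ n z‖ with hF
  have hF0 : ∀ c z, 0 ≤ F c z := fun c z => norm_nonneg _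
  have hpt : ∀ z, ‖∑ n ∈ range M, b n * (χ n z * ex (σ n * k z))‖ ≤
      (K : ℝ)⁻¹ * ∑ j ∈ range K, (F b z + F (fun n => b n * w j n) z) := by
    intro z
    have he : ∑ n ∈ range M, b n * (χ n z * ex (σ n * k z)) =
        ∑ n ∈ range M, b n * χ n z +
          (K : ℂ)⁻¹ * ∑ j ∈ range (k z), ∑ n ∈ range M, b n * w j n * χ n z := by
      rw [Finset.sum_comm, Finset.mul_sum, ← Finset.sum_add_distrib]
      refine Finset.sum_congr rfl fun n _ => ?_
      rw [ex_natCast_mul, mul_add, mul_add, mul_one, Finset.mul_sum, Finset.mul_sum,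
        Finset.mul_sum]
      congr 1
      refine Finset.sum_congr rfl fun j _ => ?_
      rw [hw]
      have : (K : ℂ) ≠ 0 := by exact_mod_cast hK0.ne'
      field_simp
    rw [he]
    refine (norm_add_le _ _).trans ?_
    rw [Finset.sum_add_distrib, mul_add, Finset.sum_const, Finset.card_range, nsmul_eq_mul,
      inv_mul_cancel_left₀ hK0.ne', norm_mul, norm_inv, Complex.norm_natCast]
    refine add_le_add le_rfl (mul_le_mul_of_nonneg_left ?_ (by positivity))
    refine (norm_sum_le _ _).trans ?_
    refine Finset.sum_le_sum_of_subset_of_nonneg (Finset.range_mono (hk z)) fun j _ _ => hF0 _ _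
  have hpow : ∀ z, ‖∑ n ∈ range M, b n * (χ n z * ex (σ n * k z))‖ ^ p ≤
      (K : ℝ)⁻¹ * ∑ j ∈ range K, 2 ^ p * (F b z ^ p + F (fun n => b n * w j n) z ^ p) := by
    intro z
    refine (Real.rpow_le_rpow (norm_nonneg _) (hpt z) hp0.le).trans ?_
    have h1 : ∀ j, 0 ≤ F b z + F (fun n => b n * w j n) z :=
      fun j => add_nonneg (hF0 _ _) (hF0 _ _)
    rw [Real.mul_rpow (by positivity) (Finset.sum_nonneg fun j _ => h1 j)]
    have h2 := Real.rpow_sum_le_const_mul_sum_rpow_of_nonneg (range K) hp (fun j _ => h1 j)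
    rw [Finset.card_range] at h2
    have h3 : (K : ℝ)⁻¹ ^ p * (K : ℝ) ^ (p - 1) = (K : ℝ)⁻¹ := by
      rw [Real.inv_rpow hK0.le, ← Real.rpow_neg hK0.le, ← Real.rpow_add hK0,
        show -p + (p - 1) = -1 by ring, Real.rpow_neg_one]
    refine (mul_le_mul_of_nonneg_left h2 (by positivity)).trans ?_
    rw [← mul_assoc, h3]
    refine mul_le_mul_of_nonneg_left (Finset.sum_le_sum fun j _ => ?_) (by positivity)
    exact add_rpow_le_two_rpow_mul hp0.le (hF0 b z) (hF0 (fun n => b n * w j n) z)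
  refine (Finset.sum_le_sum fun z _ => hpow z).trans ?_
  rw [← Finset.mul_sum, Finset.sum_comm]
  have hterm : ∀ j ∈ range K, ∑ z, 2 ^ p * (F b z ^ p + F (fun n => b n * w j n) z ^ p) ≤
      2 ^ p * (1 + (2 * Real.pi * B) ^ p) * X * S ^ p := by
    intro j _
    rw [← Finset.mul_sum, Finset.sum_add_distrib]
    have h1 := H b
    have h2 := H (fun n => b n * w j n)
    have h3 := lq_norm_mul_le (M := M) hq (by positivity : 0 ≤ 2 * Real.pi * B) b (w j)
      (hwB j)
    have h4 := Real.rpow_le_rpow (by positivity) h3 hp0.le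
    rw [Real.mul_rpow (by positivity) hS0] at h4
    have h5 := h2.trans (mul_le_mul_of_nonneg_left h4 hX)
    have h6 := mul_le_mul_of_nonneg_left (add_le_add h1 h5) (by positivity : (0 : ℝ) ≤ 2 ^ p)
    refine h6.trans_eq ?_
    ring
  refine (mul_le_mul_of_nonneg_left (Finset.sum_le_sum hterm) (by positivity)).trans_eq ?_
  rw [Finset.sum_const, Finset.card_range, nsmul_eq_mul, inv_mul_cancel_left₀ hK0.ne']

end

theorem stdAddChar_eq_ex (Q : ℕ) [NeZero Q] (j : ℤ) :
    (ZMod.stdAddChar (j : ZMod Q) : ℂ) = ex (j / Q) := by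
  rw [ZMod.stdAddChar_coe, ex]
  congr 1
  push_cast
  ring

theorem chr_eq_ex (Q : ℕ) [NeZero Q] (ζ : ℤ × ℤ) (z : ZMod Q × ZMod Q) :
    chr Q ζ z = ex ((ζ.1 * z.1.val + ζ.2 * z.2.val) / Q) := by
  have h := stdAddChar_eq_ex Q (ζ.1 * z.1.val + ζ.2 * z.2.val)
  push_cast at h
  rw [ZMod.natCast_zmod_val, ZMod.natCast_zmod_val] at h
  exact h

theorem sum_zmod_eq_sum_range (Q : ℕ) [NeZero Q] (f : ℕ → ℝ) :
    ∑ x : ZMod Q, f x.val = ∑ i ∈ range Q, f i := by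
  refine Finset.sum_bij (fun x _ => x.val) (fun x _ => Finset.mem_range.2 (ZMod.val_lt x))
    (fun x _ y _ h => ZMod.val_injective Q h) (fun i hi => ⟨i, Finset.mem_univ _, ?_⟩)
    fun _ _ => rfl
  exact ZMod.val_cast_of_lt (Finset.mem_range.1 hi)

theorem sum_range_mul_eq (L K : ℕ) (f : ℕ → ℝ) :
    ∑ n ∈ range (L * K), f n = ∑ l ∈ range L, ∑ r ∈ range K, f (K * l + r) := by
  have := sum_Ico_mul_eq K 0 L f
  simpa using this

/-- Folding the second coordinate of the grid onto the windows. -/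
theorem sum_grid_eq {Q L r : ℕ} [NeZero Q] (hr : 0 < r) (hQ : Q = L * r) (φ : ℝ → ℝ) :
    ∑ z : ZMod Q × ZMod Q, φ ((z.2.val / r : ℕ) + (z.1.val : ℝ) / Q) =
      r * ∑ m ∈ range (L * Q), φ ((m : ℝ) / Q) := by
  have hQ0 : (Q : ℝ) ≠ 0 := by exact_mod_cast NeZero.ne Q
  rw [Fintype.sum_prod_type,
    sum_zmod_eq_sum_range Q fun i => ∑ y : ZMod Q, φ ((y.val / r : ℕ) + (i : ℝ) / Q),
    sum_range_mul_eq L Q, Finset.sum_comm (s := range L), Finset.mul_sum]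
  refine Finset.sum_congr rfl fun i _ => ?_
  rw [sum_zmod_eq_sum_range Q fun y => φ ((y / r : ℕ) + (i : ℝ) / Q)]
  have h1 : ∑ y ∈ range Q, φ ((y / r : ℕ) + (i : ℝ) / Q) =
      ∑ y ∈ range (L * r), φ ((y / r : ℕ) + (i : ℝ) / Q) := by rw [hQ]
  rw [h1, sum_range_mul_eq L r, Finset.mul_sum]
  refine Finset.sum_congr rfl fun l _ => ?_
  have h2 : ∀ j ∈ range r, φ (((r * l + j) / r : ℕ) + (i : ℝ) / Q) = φ (((Q * l + i : ℕ) : ℝ) / Q) := by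
    intro j hj
    rw [Nat.mul_add_div hr, Nat.div_eq_of_lt (Finset.mem_range.1 hj), add_zero]
    congr 1
    push_cast
    field_simp
  rw [Finset.sum_congr rfl h2, Finset.sum_const, Finset.card_range, nsmul_eq_mul]

theorem phase_eq {Q L r : ℕ} [NeZero Q] (hr : 0 < r) (hQ : Q = L * r) (n : ℕ) (g : ℝ) (G : ℤ)
    (z : ZMod Q × ZMod Q) :
    ex (-g) * (chr Q ((n : ℤ), G) z * ex ((L * g - G) / Q * z.2.val) *
      ex (g / Q * ((z.1.val + Q - L * (z.2.val % r) : ℕ) : ℝ))) =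
      ex ((n + g) * ((z.2.val / r : ℕ) + (z.1.val : ℝ) / Q)) := by
  have hQ0 : (Q : ℝ) ≠ 0 := by exact_mod_cast NeZero.ne Q
  have hr0 : (r : ℝ) ≠ 0 := by exact_mod_cast hr.ne'
  have hle : L * (z.2.val % r) ≤ z.1.val + Q := by
    have : L * (z.2.val % r) ≤ L * r := Nat.mul_le_mul_left _ (Nat.mod_lt _ hr).le
    omega
  have hy : (z.2.val : ℝ) = r * (z.2.val / r : ℕ) + (z.2.val % r : ℕ) := by
    exact_mod_cast (Nat.div_add_mod _ _).symm
  have hQ' : (Q : ℝ) = L * r := by exact_mod_cast hQ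
  rw [chr_eq_ex, ← ex_add, ← ex_add, ← ex_add, Nat.cast_sub hle]
  generalize z.2.val / r = l at *
  generalize z.2.val % r = j at *
  have h1 : -g + (((((n : ℤ), G) : ℤ × ℤ).1 * (z.1.val : ℝ) + (((n : ℤ), G) : ℤ × ℤ).2 * z.2.val) / Q
      + (L * g - G) / Q * z.2.val + g / Q * (((z.1.val + Q : ℕ) : ℝ) - (L * j : ℕ))) =
      (n + g) * (l + (z.1.val : ℝ) / Q) + ((-(n * l : ℤ) : ℤ) : ℝ) := by
    rw [hy]
    push_cast
    have hL0 : (L : ℝ) ≠ 0 := by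
      rintro h
      rw [h, zero_mul] at hQ'
      exact hQ0 hQ'
    rw [hQ']
    field_simp
    ring
  rw [h1, ex_add, ex_intCast, mul_one]

section

variable {p q C₀ ε : ℝ}

/-- The discretised estimate on `L` windows. -/
theorem exists_sum_window_le (hp : 4 ≤ p) (hq : 1 ≤ q) (hpq : 1 / q + 3 / p ≤ 1)
    (hC₀ : 1 ≤ C₀) (hε : 0 < ε) :
    ∃ C : ℝ, 0 < C ∧ ∀ (M L : ℕ) (g : ℕ → ℝ) (h : ℝ), 1 ≤ M → 1 ≤ L →
      UniformlyConvex (fun n => L * g n) h C₀ → (∀ n ∈ range M, |g n| ≤ 16) →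
      ∃ Q : ℕ, 1 ≤ Q ∧ ∀ b : ℕ → ℂ,
        ∑ m ∈ range (L * Q), ‖∑ n ∈ range M, b n * ex ((n + g n) * ((m : ℝ) / Q))‖ ^ p ≤
          C * (M : ℝ) ^ ε * (L * Q * ((M : ℝ) ^ (p - 3 - p / q) / h + (M : ℝ) ^ (p / 2 - p / q)) *
            ((∑ n ∈ range M, ‖b n‖ ^ q) ^ (1 / q)) ^ p) := by
  obtain ⟨C, hC, H⟩ := exists_sum_rpow_le hp hq hpq hC₀ hε
  have hπ := Real.pi_pos
  refine ⟨2 ^ p * (1 + (2 * Real.pi * 32) ^ p) * (2 ^ p * (1 + (2 * Real.pi * 1) ^ p)) * C,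
    by positivity, fun M L g h hM hL hg hg16 => ?_⟩
  obtain ⟨Q₀, hQ₀⟩ := H M _ h hM hg
  have hh := hg.pos
  set r : ℕ := Q₀ + 1 with hr
  set Q : ℕ := L * r with hQ
  have hQ1 : 1 ≤ Q := Nat.mul_pos hL (Nat.succ_pos _)
  have hQQ : Q₀ ≤ Q := by
    have : 1 * r ≤ L * r := Nat.mul_le_mul_right _ hL
    omega
  have : NeZero Q := ⟨by omega⟩
  have hQ0 : (0 : ℝ) < Q := by exact_mod_cast hQ1
  have hr0 : (0 : ℝ) < r := by exact_mod_cast Nat.succ_pos _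
  refine ⟨Q, hQ1, fun b => ?_⟩
  set G : ℕ → ℤ := fun n => round (L * g n) with hG
  have hG1 : ∀ n, |(G n : ℝ) - L * g n| ≤ 1 := fun n => abs_round_sub_le _
  set V : ℝ := (M : ℝ) ^ (p - 3 - p / q) / h + (M : ℝ) ^ (p / 2 - p / q) with hV
  have hV0 : 0 ≤ V := by positivity
  have hX : 0 ≤ C * (M : ℝ) ^ ε * (Q ^ 2 * V) := by positivity
  have h1 := sum_norm_mul_ex_rpow_le (p := p) (q := q) (by linarith) hq hX
    (fun n => chr Q ((n : ℤ), G n))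
    (fun c => (hQ₀ Q G c hQQ hG1).trans_eq (by ring)) (σ := fun n => (L * g n - G n) / Q) hQ1
    (B := 1) zero_le_one
    (fun n _ => by
      rw [abs_div, abs_of_pos hQ0, div_mul_cancel₀ _ hQ0.ne', abs_sub_comm]
      exact hG1 n)
    (k := fun z => z.2.val) (fun z => (ZMod.val_lt _).le)
  have h2 := sum_norm_mul_ex_rpow_le (p := p) (q := q) (by linarith) hq (by positivity) _ h1
    (σ := fun n => g n / Q) (K := 2 * Q) (by omega) (B := 32) (by norm_num)
    (fun n hn => by
      rw [abs_div, abs_of_pos hQ0]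
      push_cast
      have := hg16 n hn
      field_simp
      linarith)
    (k := fun z => z.1.val + Q - L * (z.2.val % r))
    (fun z => (Nat.sub_le _ _).trans (by have := ZMod.val_lt z.1; omega))
    (fun n => b n * ex (-g n))
  rw [lq_norm_mul_eq _ _ fun n => norm_ex _] at h2
  have h3 : ∀ z : ZMod Q × ZMod Q, ‖∑ n ∈ range M, b n * ex (-g n) *
      (chr Q ((n : ℤ), G n) z * ex ((L * g n - G n) / Q * z.2.val) *
        ex (g n / Q * ((z.1.val + Q - L * (z.2.val % r) : ℕ) : ℝ)))‖ ^ p =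
      (fun x => ‖∑ n ∈ range M, b n * ex ((n + g n) * x)‖ ^ p)
        ((z.2.val / r : ℕ) + (z.1.val : ℝ) / Q) := by
    intro z
    simp only
    congr 2
    refine Finset.sum_congr rfl fun n _ => ?_
    rw [mul_assoc, phase_eq (Nat.succ_pos _) hQ]
  have h4 := sum_grid_eq (r := r) (Nat.succ_pos _) hQ
    fun x => ‖∑ n ∈ range M, b n * ex ((n + g n) * x)‖ ^ p
  rw [Finset.sum_congr rfl fun z _ => h3 z, h4] at h2
  rw [← mul_le_mul_iff_right₀ hr0]
  refine h2.trans_eq ?_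
  have hQr : (Q : ℝ) = L * r := by rw [hQ]; push_cast; ring
  rw [show (Q : ℝ) ^ 2 = L * r * Q by rw [← hQr]; ring]
  ring

end

theorem intervalIntegral_eq_integral_sum {f : ℝ → ℝ} (hf : Continuous f) {L Q : ℕ} (hQ : 1 ≤ Q) :
    ∫ x in (0 : ℝ)..L, f x =
      ∫ v in (0 : ℝ)..(1 / Q : ℝ), ∑ m ∈ range (L * Q), f ((m : ℝ) / Q + v) := by
  have hQ0 : (Q : ℝ) ≠ 0 := by exact_mod_cast (by omega : Q ≠ 0)
  have h1 := intervalIntegral.sum_integral_adjacent_intervals (μ := volume) (f := f)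
    (a := fun m : ℕ => (m : ℝ) / Q) (n := L * Q) fun m _ => hf.intervalIntegrable _ _
  have h2 : ((L * Q : ℕ) : ℝ) / Q = L := by
    push_cast
    field_simp
  rw [h2, Nat.cast_zero, zero_div] at h1
  have h3 : ∀ m ∈ range (L * Q),
      IntervalIntegrable (fun v => f ((m : ℝ) / Q + v)) volume 0 (1 / Q : ℝ) :=
    fun m _ => (hf.comp (continuous_const.add continuous_id)).intervalIntegrable _ _
  rw [← h1, intervalIntegral.integral_finsetSum h3]
  refine Finset.sum_congr rfl fun m _ => ?_
  rw [intervalIntegral.integral_comp_add_left f]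
  congr 1
  · ring
  · push_cast
    ring

section

variable {p q C₀ ε : ℝ}

theorem exists_intervalIntegral_le (hp : 4 ≤ p) (hq : 1 ≤ q) (hpq : 1 / q + 3 / p ≤ 1)
    (hC₀ : 1 ≤ C₀) (hε : 0 < ε) :
    ∃ C : ℝ, 0 < C ∧ ∀ (M L : ℕ) (g : ℕ → ℝ) (h : ℝ), 1 ≤ M → 1 ≤ L →
      UniformlyConvex (fun n => L * g n) h C₀ → (∀ n ∈ range M, |g n| ≤ 16) → ∀ b : ℕ → ℂ,
        ∫ x in (0 : ℝ)..L, ‖∑ n ∈ range M, b n * ex ((n + g n) * x)‖ ^ p ≤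
          C * (M : ℝ) ^ ε * (L * ((M : ℝ) ^ (p - 3 - p / q) / h + (M : ℝ) ^ (p / 2 - p / q)) *
            ((∑ n ∈ range M, ‖b n‖ ^ q) ^ (1 / q)) ^ p) := by
  obtain ⟨C, hC, H⟩ := exists_sum_window_le hp hq hpq hC₀ hε
  refine ⟨C, hC, fun M L g h hM hL hg hg16 b => ?_⟩
  obtain ⟨Q, hQ1, hQ⟩ := H M L g h hM hL hg hg16
  have hQ0 : (0 : ℝ) < Q := by exact_mod_cast hQ1
  have hcont : ∀ c : ℝ, Continuous fun x => ‖∑ n ∈ range M, b n * ex ((n + g n) * (c + x))‖ ^ p := by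
    intro c
    refine Continuous.rpow_const (continuous_norm.comp (continuous_finsetSum _ fun n _ => ?_))
      fun _ => Or.inr (by linarith)
    exact continuous_const.mul (continuous_ex.comp (by fun_prop))
  have hcont0 := hcont 0
  simp only [zero_add] at hcont0
  rw [intervalIntegral_eq_integral_sum hcont0 hQ1]
  have hbd : ∀ v : ℝ, ∑ m ∈ range (L * Q), ‖∑ n ∈ range M, b n * ex ((n + g n) * ((m : ℝ) / Q + v))‖ ^ p ≤
      C * (M : ℝ) ^ ε * (L * Q * ((M : ℝ) ^ (p - 3 - p / q) / h + (M : ℝ) ^ (p / 2 - p / q)) *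
            ((∑ n ∈ range M, ‖b n‖ ^ q) ^ (1 / q)) ^ p) := by
    intro v
    have h1 := hQ fun n => b n * ex ((n + g n) * v)
    rw [lq_norm_mul_eq _ _ fun n => norm_ex _] at h1
    refine le_trans (le_of_eq ?_) h1
    refine Finset.sum_congr rfl fun m _ => ?_
    congr 2
    refine Finset.sum_congr rfl fun n _ => ?_
    rw [mul_add, add_comm, ex_add, mul_assoc]
  refine (intervalIntegral.integral_mono_on (by positivity)
    (Continuous.intervalIntegrable (continuous_finsetSum _ fun m _ => hcont _) _ _)
    (intervalIntegrable_const) fun v _ => hbd v).trans_eq ?_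
  rw [intervalIntegral.integral_const, smul_eq_mul]
  field_simp
  ring

end

section

variable {N θ : ℝ} {R : ℕ} {a : ℕ → ℝ}

/-- The nonlinear part of a short generalized Dirichlet sequence extends to an infinite
uniformly convex sequence. -/
theorem exists_convex_part (hR : 1 ≤ R) (hN : N = (R : ℝ) ^ 2) (hθ : 0 < θ)
    (ha : ShortGDS N R θ a) :
    ∃ v : ℕ → ℝ,
      (∀ n, (v (n + 2) - v (n + 1)) - (v (n + 1) - v n) ∈
        Set.Icc (θ / (4 * N ^ 2)) (4 * θ / N ^ 2)) ∧
      (∀ n ∈ range R, 0 ≤ v n ∧ v n ≤ 4 * θ / N) ∧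
      ∀ n ∈ range R, a (n + 1) = a 1 + n * (a 2 - a 1) + v n := by
  have hR0 : (0 : ℝ) < R := by exact_mod_cast hR
  have hN0 : 0 < N := by rw [hN]; positivity
  set d : ℕ → ℝ := fun i =>
    if i + 3 ≤ R then (a (i + 3) - a (i + 2)) - (a (i + 2) - a (i + 1)) else θ / N ^ 2 with hd
  have hdmem : ∀ i, d i ∈ Set.Icc (θ / (4 * N ^ 2)) (4 * θ / N ^ 2) := by
    intro i
    rw [hd]
    dsimp only
    split_ifs with hi
    · exact ha.2 (i + 1) (by omega) (by omega)
    · constructor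
      · gcongr
        nlinarith [sq_nonneg N]
      · gcongr
        linarith
  have hd0 : ∀ i, 0 ≤ d i := fun i => le_trans (by positivity) (hdmem i).1
  set u : ℕ → ℝ := fun n => ∑ i ∈ range n, d i with hu
  have hu0 : ∀ n, 0 ≤ u n := fun n => Finset.sum_nonneg fun i _ => hd0 i
  have hule : ∀ n, n ≤ R → u n ≤ R * (4 * θ / N ^ 2) := by
    intro n hn
    have h1 := Finset.sum_le_card_nsmul (range n) d _ fun i _ => (hdmem i).2
    rw [Finset.card_range, nsmul_eq_mul] at h1
    refine h1.trans (mul_le_mul_of_nonneg_right ?_ (by positivity))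
    exact_mod_cast hn
  have hslope : ∀ n, n + 2 ≤ R → a (n + 2) - a (n + 1) = a 2 - a 1 + u n := by
    intro n
    induction n with
    | zero => simp [hu]
    | succ n ih =>
      intro hn
      have h1 := ih (by omega)
      have h2 : u (n + 1) = u n + d n := Finset.sum_range_succ _ _
      have h3 : d n = (a (n + 3) - a (n + 2)) - (a (n + 2) - a (n + 1)) := if_pos hn
      rw [h2, h3]
      show a (n + 3) - a (n + 2) = _
      linarith
  refine ⟨fun n => ∑ j ∈ range n, u j, fun n => ?_, fun n hn => ⟨?_, ?_⟩, fun n => ?_⟩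
  · have h1 : u (n + 1) = u n + d n := Finset.sum_range_succ _ _
    simp only [Finset.sum_range_succ]
    rw [h1]
    convert hdmem n using 1
    ring
  · exact Finset.sum_nonneg fun j _ => hu0 j
  · have hn' := (Finset.mem_range.1 hn).le
    have h1 := Finset.sum_le_card_nsmul (range n) u _ fun j hj =>
      hule j ((Finset.mem_range.1 hj).le.trans hn')
    rw [Finset.card_range, nsmul_eq_mul] at h1
    refine h1.trans ?_
    have h2 : (n : ℝ) ≤ R := by exact_mod_cast hn'
    refine (mul_le_mul_of_nonneg_right h2 (by positivity)).trans_eq ?_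
    rw [hN]
    field_simp
  · induction n with
    | zero => simp
    | succ n ih =>
      intro hn
      have hn' := Finset.mem_range.1 hn
      have h1 := ih (Finset.mem_range.2 (by omega))
      have h2 := hslope n (by omega)
      beta_reduce at h1 ⊢
      rw [Finset.sum_range_succ]
      push_cast
      linarith

theorem exp_eq_ex (t x : ℝ) :
    Complex.exp (Complex.I * (t : ℂ) * (x : ℂ)) = ex (t * x / (2 * Real.pi)) := by
  rw [ex, mul_div_cancel₀ _ Real.two_pi_pos.ne', mul_assoc]
  push_cast
  rfl

theorem sum_Icc_one_eq_sum_range {E : Type*} [AddCommMonoid E] (R : ℕ) (f : ℕ → E) :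
    ∑ n ∈ Finset.Icc 1 R, f n = ∑ n ∈ range R, f (n + 1) := by
  rw [Finset.range_eq_Ico, Finset.sum_Ico_add' f 0 R 1]
  rfl

end

section

variable {p q ε : ℝ}

set_option maxHeartbeats 1000000 in
theorem exists_integral_le (hp : 4 ≤ p) (hq : 1 ≤ q) (hpq : 1 / q + 3 / p ≤ 1) (hε : 0 < ε) :
    ∃ C : ℝ, 0 < C ∧ ∀ (R : ℕ) (N θ T t₀ : ℝ) (a : ℕ → ℝ) (b : ℕ → ℂ),
      1 ≤ R → N = (R : ℝ) ^ 2 → 0 < θ → θ ≤ 1 → N ≤ T → T * θ ≤ N ^ 2 → ShortGDS N R θ a →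
      ∫ t in Set.Icc (t₀ - T) (t₀ + T),
          ‖∑ n ∈ Finset.Icc 1 R, b n * Complex.exp (Complex.I * (t : ℂ) * (a n : ℂ))‖ ^ p ≤
        C * (R : ℝ) ^ ε *
          ((R : ℝ) ^ (p - 3 - p / q) * N ^ 2 * θ⁻¹ + T * (R : ℝ) ^ (p / 2 - p / q)) *
            ((∑ n ∈ Finset.Icc 1 R, ‖b n‖ ^ q) ^ (1 / q)) ^ p := by
  obtain ⟨C, hC, H⟩ := exists_intervalIntegral_le hp hq hpq (by norm_num : (1 : ℝ) ≤ 256) hε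
  have hπ := Real.pi_gt_three
  have hπ' := Real.pi_lt_d2
  refine ⟨C * 400, by positivity, fun R N θ T t₀ a b hR hN hθ hθ1 hNT hTN ha => ?_⟩
  obtain ⟨v, hv2, hv, hav⟩ := exists_convex_part hR hN hθ ha
  have hR0 : (0 : ℝ) < R := by exact_mod_cast hR
  have hN0 : 0 < N := by rw [hN]; positivity
  have hT0 : 0 < T := by linarith
  set α : ℝ := a 2 - a 1 with hα
  have hα1 : 1 / (4 * N) ≤ α := ha.1.1
  have hα0 : 0 < α := lt_of_lt_of_le (by positivity) hα1
  set W : ℝ := 2 * Real.pi / α with hW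
  have hW0 : 0 < W := by positivity
  have hWN : W ≤ 8 * Real.pi * N := by
    rw [div_le_iff₀ (by positivity)] at hα1
    rw [hW, div_le_iff₀ hα0]
    nlinarith
  set L : ℕ := ⌈2 * T / W⌉₊ with hL
  have hL1 : 1 ≤ L := Nat.ceil_pos.2 (by positivity)
  have hWL : 2 * T ≤ L * W := by
    rw [← div_le_iff₀ hW0]
    exact Nat.le_ceil _
  have hWL' : L * W ≤ (2 + 8 * Real.pi) * T := by
    have h1 := (Nat.ceil_lt_add_one (by positivity : 0 ≤ 2 * T / W)).le
    have h2 := mul_le_mul_of_nonneg_right h1 hW0.le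
    rw [add_mul, div_mul_cancel₀ _ hW0.ne', one_mul] at h2
    nlinarith
  set h : ℝ := T * θ / (4 * Real.pi * N ^ 2) with hh
  have hconv : UniformlyConvex (fun n => L * (v n / α)) h 256 := by
    have hLα : (L : ℝ) / α = L * W / (2 * Real.pi) := by
      rw [hW]; field_simp
    have hdiff : ∀ n, (L * (v (n + 2) / α) - L * (v (n + 1) / α)) -
        (L * (v (n + 1) / α) - L * (v n / α)) =
        L * W / (2 * Real.pi) * ((v (n + 2) - v (n + 1)) - (v (n + 1) - v n)) := by
      intro n
      rw [← hLα]
      ring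
    refine ⟨by positivity, ?_, by norm_num, fun n => ?_, fun n => ?_⟩
    · rw [hh, div_le_one (by positivity)]
      nlinarith [sq_nonneg N]
    · rw [hdiff]
      calc h = 2 * T / (2 * Real.pi) * (θ / (4 * N ^ 2)) := by rw [hh]; field_simp
        _ ≤ _ := mul_le_mul (by gcongr) (hv2 n).1 (by positivity) (by positivity)
    · rw [hdiff]
      calc L * W / (2 * Real.pi) * ((v (n + 2) - v (n + 1)) - (v (n + 1) - v n))
          ≤ (2 + 8 * Real.pi) * T / (2 * Real.pi) * (4 * θ / N ^ 2) :=
            mul_le_mul (by gcongr) (hv2 n).2 (le_trans (by positivity) (hv2 n).1) (by positivity)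
        _ = (16 + 64 * Real.pi) * h := by rw [hh]; field_simp; ring
        _ ≤ 256 * h := mul_le_mul_of_nonneg_right (by linarith) (by positivity)
  have hg : ∀ n ∈ range R, |v n / α| ≤ 16 := by
    intro n hn
    rw [abs_of_nonneg (div_nonneg (hv n hn).1 hα0.le), div_le_iff₀ hα0]
    refine (hv n hn).2.trans ?_
    have h1 : 4 * θ / N ≤ 4 / N := by gcongr; linarith
    have h2 : 4 / N = 16 * (1 / (4 * N)) := by field_simp; norm_num
    linarith
  have hI := H R L (fun n => v n / α) h hR hL1 hconv hg
    fun n => b (n + 1) * ex ((t₀ - T) * a (n + 1) / (2 * Real.pi))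
  rw [lq_norm_mul_eq (fun n => b (n + 1)) _ fun n => norm_ex _] at hI
  set F : ℝ → ℝ := fun t => ‖∑ n ∈ Finset.Icc 1 R,
    b n * Complex.exp (Complex.I * (t : ℂ) * (a n : ℂ))‖ ^ p with hF
  have hFc : Continuous F := by
    refine Continuous.rpow_const (by fun_prop) fun _ => Or.inr (by linarith)
  have hF0 : ∀ t, 0 ≤ F t := fun t => by positivity
  have hFeq : ∀ x : ℝ, ‖∑ n ∈ range R, b (n + 1) * ex ((t₀ - T) * a (n + 1) / (2 * Real.pi)) *
      ex ((n + v n / α) * x)‖ ^ p = F (W * x + (t₀ - T)) := by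
    intro x
    rw [hF]
    dsimp only
    rw [sum_Icc_one_eq_sum_range]
    congr 1
    have h1 : ∀ n ∈ range R, b (n + 1) * Complex.exp (Complex.I * ((W * x + (t₀ - T) : ℝ) : ℂ) *
        (a (n + 1) : ℂ)) = ex (x * a 1 / α) *
        (b (n + 1) * ex ((t₀ - T) * a (n + 1) / (2 * Real.pi)) * ex ((n + v n / α) * x)) := by
      intro n hn
      have h2 : (W * x + (t₀ - T)) * a (n + 1) / (2 * Real.pi) =
          x * a 1 / α + ((t₀ - T) * a (n + 1) / (2 * Real.pi) + (n + v n / α) * x) := by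
        have h3 : (n + v n / α) * x = x * (a (n + 1) - a 1) / α := by
          rw [hav n hn]
          field_simp
          ring
        rw [h3, hW]
        field_simp
        ring
      rw [exp_eq_ex, h2, ex_add, ex_add]
      ring
    rw [Finset.sum_congr rfl h1, ← Finset.mul_sum, norm_mul, norm_ex, one_mul]
  simp only [hFeq] at hI
  rw [intervalIntegral.integral_comp_mul_add F hW0.ne', mul_zero, zero_add, smul_eq_mul,
    inv_mul_le_iff₀ hW0] at hI
  rw [sum_Icc_one_eq_sum_range R fun n => ‖b n‖ ^ q]
  set S : ℝ := ((∑ n ∈ range R, ‖b (n + 1)‖ ^ q) ^ (1 / q)) ^ p with hS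
  have hS0 : 0 ≤ S := by positivity
  have hstep : ∫ t in Set.Icc (t₀ - T) (t₀ + T), F t ≤
      ∫ t in (t₀ - T)..(W * L + (t₀ - T)), F t := by
    rw [intervalIntegral.integral_of_le (by nlinarith), integral_Icc_eq_integral_Ioc]
    refine setIntegral_mono_set ?_ (Filter.Eventually.of_forall fun t => hF0 t)
      (Set.Ioc_subset_Ioc_right (by linarith)).eventuallyLE
    exact (hFc.integrableOn_Icc (a := t₀ - T) (b := W * L + (t₀ - T))).mono_set
      Set.Ioc_subset_Icc_self
  refine hstep.trans (hI.trans ?_)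
  set A : ℝ := (R : ℝ) ^ (p - 3 - p / q) with hA
  set B : ℝ := (R : ℝ) ^ (p / 2 - p / q) with hB
  have hA0 : 0 ≤ A := by positivity
  have hB0 : 0 ≤ B := by positivity
  have hh0 : 0 < h := hconv.pos
  have hTh : T / h = 4 * Real.pi * N ^ 2 * θ⁻¹ := by
    rw [hh]; field_simp
  have hWL28 : L * W ≤ 28 * T := hWL'.trans (by nlinarith)
  have key : L * W * (A / h + B) ≤ 400 * (A * N ^ 2 * θ⁻¹ + T * B) := by
    calc L * W * (A / h + B) ≤ 28 * T * (A / h + B) := by gcongr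
      _ = 28 * (A * (T / h)) + 28 * (T * B) := by ring
      _ = 112 * Real.pi * (A * N ^ 2 * θ⁻¹) + 28 * (T * B) := by rw [hTh]; ring
      _ ≤ 400 * (A * N ^ 2 * θ⁻¹) + 400 * (T * B) := by
          gcongr
          · linarith
          · norm_num
      _ = _ := by ring
  calc W * (C * (R : ℝ) ^ ε * (L * (A / h + B) * S))
      = C * (R : ℝ) ^ ε * (L * W * (A / h + B)) * S := by ring
    _ ≤ C * (R : ℝ) ^ ε * (400 * (A * N ^ 2 * θ⁻¹ + T * B)) * S := by gcongr
    _ = _ := by ring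

end

section

variable {p q : ℝ}

/-- Taking `p`-th roots in the integral estimate, in terms of `N = R²`. -/
theorem rpow_one_div_le_of_le {I C S N R θ T ε : ℝ} (hp : 4 ≤ p) (hq : 1 ≤ q) (hI0 : 0 ≤ I)
    (hC : 0 < C) (hS : 0 ≤ S) (hR : 1 ≤ R) (hN : N = R ^ 2) (hθ : 0 < θ) (hT : 0 < T) (hε : 0 < ε)
    (hI : I ≤ C * R ^ ε * (R ^ (p - 3 - p / q) * N ^ 2 * θ⁻¹ + T * R ^ (p / 2 - p / q)) * S ^ p) :
    I ^ (1 / p) ≤ C ^ (1 / p) * N ^ ε *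
      (N ^ ((1 : ℝ) / 2 * (1 + 1 / p - 1 / q)) * θ ^ (-(1 : ℝ) / p) +
        T ^ (1 / p) * N ^ ((1 : ℝ) / 4 - 1 / (2 * q))) * S := by
  have hp0 : 0 < p := by linarith
  have hq0 : 0 < q := by linarith
  have hR0 : 0 < R := by linarith
  have hN' : ∀ x : ℝ, N ^ x = R ^ (2 * x) := by
    intro x
    rw [hN, ← Real.rpow_natCast, ← Real.rpow_mul hR0.le]
    norm_num
  have hfirst : (R ^ (p - 3 - p / q) * N ^ 2 * θ⁻¹) ^ (1 / p) =
      N ^ ((1 : ℝ) / 2 * (1 + 1 / p - 1 / q)) * θ ^ (-(1 : ℝ) / p) := by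
    rw [Real.mul_rpow (by rw [hN]; positivity) (by positivity), ← Real.rpow_natCast, hN' ((2 : ℕ) : ℝ),
      ← Real.rpow_add hR0, ← Real.rpow_mul hR0.le, hN', Real.inv_rpow hθ.le, ← Real.rpow_neg hθ.le,
      neg_div]
    congr 2
    push_cast
    field_simp
    ring
  have hsecond : (T * R ^ (p / 2 - p / q)) ^ (1 / p) =
      T ^ (1 / p) * N ^ ((1 : ℝ) / 4 - 1 / (2 * q)) := by
    rw [Real.mul_rpow hT.le (by positivity), ← Real.rpow_mul hR0.le, hN']
    congr 2
    field_simp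
    ring
  have hA0 : 0 ≤ R ^ (p - 3 - p / q) * N ^ 2 * θ⁻¹ := by positivity
  have hB0 : 0 ≤ T * R ^ (p / 2 - p / q) := by positivity
  have hεN : (R ^ ε) ^ (1 / p) ≤ N ^ ε := by
    rw [← Real.rpow_mul hR0.le, hN']
    refine Real.rpow_le_rpow_of_exponent_le hR ?_
    rw [mul_one_div, div_le_iff₀ hp0]
    nlinarith
  refine (Real.rpow_le_rpow hI0 hI (by positivity)).trans ?_
  rw [Real.mul_rpow (by positivity) (by positivity), Real.mul_rpow (by positivity) (by positivity),
    Real.mul_rpow hC.le (by positivity), ← Real.rpow_mul hS, mul_one_div_cancel hp0.ne',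
    Real.rpow_one, ← hfirst, ← hsecond]
  refine mul_le_mul_of_nonneg_right (mul_le_mul (mul_le_mul_of_nonneg_left hεN (by positivity))
    (Real.rpow_add_le_add_rpow hA0 hB0 (by positivity) ?_) (by positivity) ?_) hS
  · rw [div_le_one hp0]
    linarith
  · rw [hN]
    positivity

end

end ShortDirichlet

/-- `(ℓ^q, L^p)` estimates for short generalized Dirichlet polynomials
`∑ b_n e^{ita_n}` on intervals of length `2T`, `Nθ⁻¹ ≤ T ≤ N²θ⁻¹`. -/
theorem short_dirichlet_polynomial_Lp (p q : ℝ) (hp : 4 ≤ p) (hq : 1 ≤ q)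
    (hpq : 1 / q + 3 / p ≤ 1) :
    ∃ C : ℝ, 0 < C ∧ ∀ ε : ℝ, 0 < ε → ∃ Cε : ℝ, 0 < Cε ∧
      ∀ (N R : ℕ) (θ T t₀ : ℝ) (a : ℕ → ℝ) (b : ℕ → ℂ),
        2 ≤ N → (R : ℝ) = Real.sqrt N → 0 < θ → θ ≤ 1 →
        (N : ℝ) * θ⁻¹ ≤ T → T ≤ (N : ℝ) ^ 2 * θ⁻¹ →
        ShortGDS N R θ a →
        (∫ t in Set.Icc (t₀ - T) (t₀ + T),
            ‖∑ n ∈ Finset.Icc 1 R, b n * Complex.exp (Complex.I * (t : ℂ) * (a n : ℂ))‖ ^ p) ^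
            (1 / p) ≤
          Cε * (N : ℝ) ^ ε * Real.log (θ⁻¹ + 1) ^ C *
            ((N : ℝ) ^ ((1 : ℝ) / 2 * (1 + 1 / p - 1 / q)) * θ ^ (-(1 : ℝ) / p) +
              T ^ (1 / p) * (N : ℝ) ^ ((1 : ℝ) / 4 - 1 / (2 * q))) *
            (∑ n ∈ Finset.Icc 1 R, ‖b n‖ ^ q) ^ (1 / q) := by
  refine ⟨1, one_pos, fun ε hε => ?_⟩
  obtain ⟨C, hC, H⟩ := ShortDirichlet.exists_integral_le hp hq hpq hε
  have hlog2 : 0 < Real.log 2 := Real.log_pos (by norm_num)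
  refine ⟨C ^ (1 / p) / Real.log 2, by positivity, fun N R θ T t₀ a b hN hRN hθ hθ1 hT1 hT2 ha => ?_⟩
  have hN2 : (2 : ℝ) ≤ N := by exact_mod_cast hN
  have hNR : (N : ℝ) = (R : ℝ) ^ 2 := by rw [hRN, Real.sq_sqrt (by positivity)]
  have hR1 : (1 : ℝ) ≤ R := by
    rw [hRN, Real.one_le_sqrt]
    linarith
  have hθinv : 1 ≤ θ⁻¹ := (one_le_inv₀ hθ).2 hθ1
  have hNT : (N : ℝ) ≤ T := le_trans (by nlinarith) hT1
  have hT0 : 0 < T := by linarith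
  have hTθ : T * θ ≤ (N : ℝ) ^ 2 := by rwa [← div_eq_mul_inv, le_div_iff₀ hθ] at hT2
  have hI := H R N θ T t₀ a b (by exact_mod_cast hR1) hNR hθ hθ1 hNT hTθ ha
  have h1 := ShortDirichlet.rpow_one_div_le_of_le hp hq
    (integral_nonneg fun t => by positivity) hC (by positivity) hR1 hNR hθ hT0 hε hI
  refine h1.trans (mul_le_mul_of_nonneg_right (mul_le_mul_of_nonneg_right ?_ (by positivity))
    (by positivity))
  have hlog : Real.log 2 ≤ Real.log (θ⁻¹ + 1) := Real.log_le_log (by norm_num) (by linarith)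
  rw [Real.rpow_one, div_mul_eq_mul_div, div_mul_eq_mul_div, le_div_iff₀ hlog2]
  gcongr
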